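/- (Quenched central limit theorem, corollary of Theorem 1.1) Assume: (a) ℙ is invariant and ergodic with respect to each of the maps T_{e_i}, i = 1,…,d, where e_i is the i-th unit vector; and (c) the quenched kernels are strongly irreducible uniformly in ω, i.e. there exist ε > 0 and N ∈ ℕ such that for all x ∈ ℤ^d, all ω ∈ Ω and all e ∈ ℤ^d with ‖e‖₂ = 1, Q_ω^n(x,x+e) ≥ ε for some n ≤ N. Then there exists a symmetric positive-definite d×d real matrix A such that for ℙ-almost every ω ∈ Ω, the laws of X_N/√N under P_{0,ω} converge weakly, as N → ∞, to the centered Gaussian distribution on ℝ^d with covariance matrix A; here P_{0,ω} is the law on (ℤ^d)^ℕ of the Markov chain (X_n) started at 0 with transition kernel Q_ω. -/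

import Mathlib

open scoped Classical

noncomputable section

/-- Points of `ℤ^d`. -/
abbrev Zd (d : ℕ) := Fin d → ℤ

/-- Euclidean norm on `ℤ^d`. -/
def eucNorm {d : ℕ} (v : Zd d) : ℝ := Real.sqrt (∑ i, ((v i : ℝ)) ^ 2)

/-- `M(ω) = Σ_i Σ_x W_i(T_x ω) · 1{0 ∈ C_i + x}`, where the `i`-th cycle is
`C_i = (z i 0, …, z i (n i))`. -/
def Mfun {d K : ℕ} {Ω : Type*} (n : Fin K → ℕ) (z : Fin K → ℕ → Zd d)
    (T : Zd d → Ω → Ω) (W : Fin K → Ω → ℝ) (ω : Ω) : ℝ :=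
  ∑ i : Fin K, ∑' x : Zd d, if ∃ j < n i, z i j + x = 0 then W i (T x ω) else 0

/-- `p_v(ω) = M(ω)⁻¹ Σ_i Σ_x W_i(T_x ω) · 1{(0,v) ∈ C_i + x}`. -/
def pfun {d K : ℕ} {Ω : Type*} (n : Fin K → ℕ) (z : Fin K → ℕ → Zd d)
    (T : Zd d → Ω → Ω) (W : Fin K → Ω → ℝ) (ω : Ω) (v : Zd d) : ℝ :=
  (Mfun n z T W ω)⁻¹ *
    ∑ i : Fin K, ∑' x : Zd d,
      if ∃ j, 1 ≤ j ∧ j ≤ n i ∧ z i (j - 1) + x = 0 ∧ z i j + x = v then W i (T x ω) else 0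

/-- `Λ`, the (finite) set of possible jumps. -/
def Lam {d K : ℕ} (n : Fin K → ℕ) (z : Fin K → ℕ → Zd d) : Finset (Zd d) :=
  Finset.univ.biUnion fun i => (Finset.range (n i)).image fun j => z i (j + 1) - z i j

/-- The quenched transition kernel `Q_ω(x,y) = p_{y-x}(T_x ω)`. -/
def Qker {d K : ℕ} {Ω : Type*} (n : Fin K → ℕ) (z : Fin K → ℕ → Zd d)
    (T : Zd d → Ω → Ω) (W : Fin K → Ω → ℝ) (ω : Ω) (x y : Zd d) : ℝ :=
  pfun n z T W (T x ω) (y - x)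

/-- `n`-fold composition of a transition kernel. -/
def kerpow {d : ℕ} (Q : Zd d → Zd d → ℝ) : ℕ → Zd d → Zd d → ℝ
  | 0 => fun x y => if x = y then 1 else 0
  | m + 1 => fun x y => ∑' zz : Zd d, kerpow Q m x zz * Q zz y

open MeasureTheory
open scoped ENNReal

/-- The invariant measure `ℚ` for the environment chain: density `M/Z` w.r.t. `ℙ`. -/
def Qmeas {d K : ℕ} {Ω : Type*} [MeasurableSpace Ω] (μ : Measure Ω)
    (n : Fin K → ℕ) (z : Fin K → ℕ → Zd d)
    (T : Zd d → Ω → Ω) (W : Fin K → Ω → ℝ) : Measure Ω :=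
  μ.withDensity fun ω => ENNReal.ofReal (Mfun n z T W ω / ∫ ω', Mfun n z T W ω' ∂μ)

/-- The transition operator `R` of the environment chain. -/
def Rop {d K : ℕ} {Ω : Type*} (n : Fin K → ℕ) (z : Fin K → ℕ → Zd d)
    (T : Zd d → Ω → Ω) (W : Fin K → Ω → ℝ) (f : Ω → ℝ) (ω : Ω) : ℝ :=
  ∑ v ∈ Lam n z, f (T v ω) * pfun n z T W ω v

/-- The data of a cycle representation: cycles `z i 0, …, z i (n i)`, a `ℤ^d`-action `T` and
the weights `W`. -/
structure CycleData (d K : ℕ) (Ω : Type*) where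
  n : Fin K → ℕ
  z : Fin K → ℕ → Zd d
  T : Zd d → Ω → Ω
  W : Fin K → Ω → ℝ

namespace CycleData

section Defs

variable {d K : ℕ} {Ω : Type*} (D : CycleData d K Ω)

/-- The total weight of the cycles through the origin. -/
def M (ω : Ω) : ℝ := Mfun D.n D.z D.T D.W ω

/-- The jump probabilities. -/
def p (v : Zd d) (ω : Ω) : ℝ := pfun D.n D.z D.T D.W ω v

/-- The set of possible jumps. -/
def jumps : Finset (Zd d) := Lam D.n D.z

lemma mem_jumps {i : Fin K} {j : ℕ} (hj : j < D.n i) :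
    D.z i (j + 1) - D.z i j ∈ D.jumps := by
  unfold jumps Lam
  simp only [Finset.mem_biUnion, Finset.mem_univ, true_and, Finset.mem_image, Finset.mem_range]
  exact ⟨i, j, hj, rfl⟩

/-- The transition operator of the environment chain. -/
def avg {E : Type*} [AddCommMonoid E] [Module ℝ E] (f : Ω → E) (ω : Ω) : E :=
  ∑ v ∈ D.jumps, D.p v ω • f (D.T v ω)

/-- The transition operator of the walk in the environment `ω`. -/
def step {E : Type*} [AddCommMonoid E] [Module ℝ E] (ω : Ω) (F : Zd d → E) (x : Zd d) : E :=
  ∑ v ∈ D.jumps, D.p v (D.T x ω) • F (x + v)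

/-- The cycle data on `ℤ^d` obtained by freezing the environment `ω`. -/
def lattice (ω : Ω) : CycleData d K (Zd d) where
  n := D.n
  z := D.z
  T := fun x y => x + y
  W := fun i y => D.W i (D.T y ω)

/-- The standing assumptions on a cycle representation, relative to an invariant measure. -/
structure Admissible [MeasurableSpace Ω] (D : CycleData d K Ω) (μ : Measure Ω)
    (c C ε : ℝ) (N : ℕ) : Prop where
  len_pos : ∀ i, 0 < D.n i
  closed : ∀ i, D.z i (D.n i) = D.z i 0
  inj : ∀ i, ∀ j k, j < D.n i → k < D.n i → D.z i j = D.z i k → j = k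
  T_add : ∀ x y ω, D.T (x + y) ω = D.T x (D.T y ω)
  T_zero : ∀ ω, D.T 0 ω = ω
  W_nonneg : ∀ i ω, 0 ≤ D.W i ω
  W_meas : ∀ i, Measurable (D.W i)
  c_pos : 0 < c
  M_lower : ∀ ω, c ≤ D.M ω
  M_upper : ∀ ω, D.M ω ≤ C
  pres : ∀ x, MeasurePreserving (D.T x) μ μ
  ε_pos : 0 < ε
  irr : ∀ ω (i : Fin d), ∃ m ≤ N,
    ε ≤ kerpow (Qker D.n D.z D.T D.W ω) m 0 (Pi.single i 1)

end Defs

namespace Admissible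

variable {d K : ℕ} {Ω : Type*} [MeasurableSpace Ω] {D : CycleData d K Ω} {μ : Measure Ω}
  {c C ε : ℝ} {N : ℕ}

lemma T_meas (h : D.Admissible μ c C ε N) (x : Zd d) : Measurable (D.T x) := (h.pres x).measurable

lemma T_neg_T (h : D.Admissible μ c C ε N) (x : Zd d) (ω : Ω) : D.T (-x) (D.T x ω) = ω := by
  rw [← h.T_add, neg_add_cancel, h.T_zero]

lemma T_T_neg (h : D.Admissible μ c C ε N) (x : Zd d) (ω : Ω) : D.T x (D.T (-x) ω) = ω := by
  rw [← h.T_add, add_neg_cancel, h.T_zero]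

lemma M_pos (h : D.Admissible μ c C ε N) (ω : Ω) : 0 < D.M ω := h.c_pos.trans_le (h.M_lower ω)

lemma M_eq (h : D.Admissible μ c C ε N) (ω : Ω) :
    D.M ω = ∑ i, ∑ j ∈ Finset.range (D.n i), D.W i (D.T (-D.z i j) ω) := by
  unfold M Mfun
  refine Finset.sum_congr rfl fun i _ => ?_
  rw [tsum_eq_sum (s := (Finset.range (D.n i)).image fun j => -D.z i j)]
  · rw [Finset.sum_image]
    · refine Finset.sum_congr rfl fun j hj => ?_
      rw [if_pos ⟨j, Finset.mem_range.1 hj, by simp⟩]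
    · intro j hj k hk hjk
      exact h.inj i j k (by simpa using hj) (by simpa using hk) (by simpa using hjk)
  · intro x hx
    rw [if_neg]
    rintro ⟨j, hj, hjx⟩
    refine hx (Finset.mem_image.2 ⟨j, Finset.mem_range.2 hj, ?_⟩)
    rw [neg_eq_iff_add_eq_zero, hjx]

lemma M_mul_p (h : D.Admissible μ c C ε N) (v : Zd d) (ω : Ω) :
    D.M ω * D.p v ω = ∑ i, ∑ j ∈ Finset.range (D.n i),
      if D.z i (j + 1) - D.z i j = v then D.W i (D.T (-D.z i j) ω) else 0 := by
  have hM := (h.M_pos ω).ne'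
  unfold p pfun
  rw [show Mfun D.n D.z D.T D.W ω = D.M ω from rfl, mul_inv_cancel_left₀ hM]
  refine Finset.sum_congr rfl fun i _ => ?_
  rw [tsum_eq_sum (s := (Finset.range (D.n i)).image fun j => -D.z i j)]
  · rw [Finset.sum_image]
    · refine Finset.sum_congr rfl fun j hj => ?_
      rw [Finset.mem_range] at hj
      refine if_congr ⟨?_, ?_⟩ rfl rfl
      · rintro ⟨k, hk1, hk2, hk3, hk4⟩
        have : k - 1 = j := h.inj i _ _ (by omega) hj (by simpa [add_neg_eq_zero] using hk3)
        obtain rfl : k = j + 1 := by omega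
        rw [← hk4, sub_eq_add_neg]
      · intro hv
        exact ⟨j + 1, by omega, by omega, by simp, by rw [← hv, sub_eq_add_neg]⟩
    · intro j hj k hk hjk
      exact h.inj i j k (by simpa using hj) (by simpa using hk) (by simpa using hjk)
  · intro x hx
    rw [if_neg]
    rintro ⟨j, hj1, hj2, hjx, -⟩
    refine hx (Finset.mem_image.2 ⟨j - 1, Finset.mem_range.2 (by omega), ?_⟩)
    rw [neg_eq_iff_add_eq_zero, hjx]

lemma M_mul_sum (h : D.Admissible μ c C ε N) (F : Zd d → ℝ) (ω : Ω) :
    D.M ω * ∑ v ∈ D.jumps, D.p v ω * F v = ∑ i, ∑ j ∈ Finset.range (D.n i),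
      D.W i (D.T (-D.z i j) ω) * F (D.z i (j + 1) - D.z i j) := by
  rw [Finset.mul_sum]
  simp_rw [← mul_assoc, h.M_mul_p, Finset.sum_mul]
  rw [Finset.sum_comm]
  refine Finset.sum_congr rfl fun i _ => ?_
  rw [Finset.sum_comm]
  refine Finset.sum_congr rfl fun j hj => ?_
  rw [Finset.sum_eq_single (D.z i (j + 1) - D.z i j)]
  · simp
  · intro v _ hv
    rw [if_neg (Ne.symm hv), zero_mul]
  · intro hv
    exact absurd (D.mem_jumps (Finset.mem_range.1 hj)) hv

lemma p_nonneg (h : D.Admissible μ c C ε N) (v : Zd d) (ω : Ω) : 0 ≤ D.p v ω := by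
  have h1 : 0 ≤ D.M ω * D.p v ω := by
    rw [h.M_mul_p]
    refine Finset.sum_nonneg fun i _ => Finset.sum_nonneg fun j _ => ?_
    split_ifs
    · exact h.W_nonneg _ _
    · exact le_rfl
  exact nonneg_of_mul_nonneg_right h1 (h.M_pos ω)

lemma sum_p (h : D.Admissible μ c C ε N) (ω : Ω) : ∑ v ∈ D.jumps, D.p v ω = 1 := by
  have h1 := h.M_mul_sum (fun _ => 1) ω
  simp only [mul_one] at h1
  rw [← h.M_eq] at h1
  exact mul_left_cancel₀ (h.M_pos ω).ne' (by rw [h1, mul_one])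

lemma p_eq_zero (h : D.Admissible μ c C ε N) {v : Zd d} (hv : v ∉ D.jumps) (ω : Ω) : D.p v ω = 0 := by
  have h1 : D.M ω * D.p v ω = 0 := by
    rw [h.M_mul_p]
    refine Finset.sum_eq_zero fun i _ => Finset.sum_eq_zero fun j hj => ?_
    rw [if_neg]
    rintro rfl
    exact hv (D.mem_jumps (Finset.mem_range.1 hj))
  exact (mul_eq_zero.1 h1).resolve_left (h.M_pos ω).ne'

lemma p_le_one (h : D.Admissible μ c C ε N) (v : Zd d) (ω : Ω) : D.p v ω ≤ 1 := by
  by_cases hv : v ∈ D.jumps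
  · rw [← h.sum_p ω]
    exact Finset.single_le_sum (f := fun v => D.p v ω) (fun v _ => h.p_nonneg v ω) hv
  · rw [h.p_eq_zero hv]
    exact zero_le_one

lemma W_le (h : D.Admissible μ c C ε N) (i : Fin K) (ω : Ω) : D.W i ω ≤ C := by
  refine le_trans ?_ (h.M_upper (D.T (D.z i 0) ω))
  rw [h.M_eq]
  have h1 : D.W i ω = D.W i (D.T (-D.z i 0) (D.T (D.z i 0) ω)) := by rw [h.T_neg_T]
  rw [h1]
  refine le_trans ?_ (Finset.single_le_sum
    (f := fun i' => ∑ j ∈ Finset.range (D.n i'), D.W i' (D.T (-D.z i' j) (D.T (D.z i 0) ω)))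
    (fun i' _ => Finset.sum_nonneg fun j _ => h.W_nonneg _ _) (Finset.mem_univ i))
  exact Finset.single_le_sum (f := fun j => D.W i (D.T (-D.z i j) (D.T (D.z i 0) ω)))
    (fun j _ => h.W_nonneg _ _) (Finset.mem_range.2 (h.len_pos i))

lemma M_meas (h : D.Admissible μ c C ε N) : Measurable D.M := by
  have : D.M = fun ω => ∑ i, ∑ j ∈ Finset.range (D.n i), D.W i (D.T (-D.z i j) ω) :=
    funext h.M_eq
  rw [this]
  exact Finset.measurable_sum _ fun i _ => Finset.measurable_sum _ fun j _ =>
    (h.W_meas i).comp (h.T_meas _)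

lemma p_meas (h : D.Admissible μ c C ε N) (v : Zd d) : Measurable (D.p v) := by
  have h1 : D.p v = fun ω => (D.M ω)⁻¹ * ∑ i, ∑ j ∈ Finset.range (D.n i),
      if D.z i (j + 1) - D.z i j = v then D.W i (D.T (-D.z i j) ω) else 0 := by
    funext ω
    rw [← h.M_mul_p, inv_mul_cancel_left₀ (h.M_pos ω).ne']
  rw [h1]
  refine h.M_meas.inv.mul (Finset.measurable_sum _ fun i _ => Finset.measurable_sum _ fun j _ => ?_)
  split_ifs
  · exact (h.W_meas i).comp (h.T_meas _)
  · exact measurable_const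

lemma integrable_comp (h : D.Admissible μ c C ε N) {f : Ω → ℝ} (hf : Integrable f μ) (x : Zd d) :
    Integrable (fun ω => f (D.T x ω)) μ := (h.pres x).integrable_comp_of_integrable hf

lemma measurableEmbedding (h : D.Admissible μ c C ε N) (x : Zd d) : MeasurableEmbedding (D.T x) :=
  MeasurableEquiv.measurableEmbedding
    ⟨⟨D.T x, D.T (-x), h.T_neg_T x, h.T_T_neg x⟩, h.T_meas x, h.T_meas (-x)⟩

lemma integral_comp (h : D.Admissible μ c C ε N) (f : Ω → ℝ) (x : Zd d) : ∫ ω, f (D.T x ω) ∂μ = ∫ ω, f ω ∂μ :=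
  (h.pres x).integral_comp (h.measurableEmbedding x) f

lemma integrable_W_mul (h : D.Admissible μ c C ε N) {f : Ω → ℝ} (hf : Integrable f μ) (i : Fin K) :
    Integrable (fun ω => D.W i ω * f ω) μ :=
  hf.bdd_mul (c := C) (h.W_meas i).aestronglyMeasurable
    (Filter.Eventually.of_forall fun ω => by
      rw [Real.norm_of_nonneg (h.W_nonneg i ω)]; exact h.W_le i ω)

lemma integrable_M_mul (h : D.Admissible μ c C ε N) {f : Ω → ℝ} (hf : Integrable f μ) :
    Integrable (fun ω => D.M ω * f ω) μ :=
  hf.bdd_mul (c := C) h.M_meas.aestronglyMeasurable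
    (Filter.Eventually.of_forall fun ω => by
      rw [Real.norm_of_nonneg (h.M_pos ω).le]; exact h.M_upper ω)

lemma integrable_p_mul (h : D.Admissible μ c C ε N) {f : Ω → ℝ} (hf : Integrable f μ) (v : Zd d) :
    Integrable (fun ω => D.p v ω * f ω) μ :=
  hf.bdd_mul (c := 1) (h.p_meas v).aestronglyMeasurable
    (Filter.Eventually.of_forall fun ω => by
      rw [Real.norm_of_nonneg (h.p_nonneg v ω)]; exact h.p_le_one v ω)

lemma integrable_avg (h : D.Admissible μ c C ε N) {f : Ω → ℝ} (hf : Integrable f μ) : Integrable (D.avg f) μ :=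
  integrable_finsetSum _ fun v _ => h.integrable_p_mul (h.integrable_comp hf v) v

/-- Integrals over the edges of the chain are sums over the cycles. -/
lemma integral_M_mul_sum (h : D.Admissible μ c C ε N) {F : Zd d → Ω → ℝ} (hF : ∀ v ∈ D.jumps, Integrable (F v) μ) :
    ∫ ω, D.M ω * ∑ v ∈ D.jumps, D.p v ω * F v ω ∂μ = ∑ i, ∑ j ∈ Finset.range (D.n i),
      ∫ ω, D.W i ω * F (D.z i (j + 1) - D.z i j) (D.T (D.z i j) ω) ∂μ := by
  have h1 : ∀ i, ∀ j ∈ Finset.range (D.n i),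
      Integrable (fun ω => D.W i ω * F (D.z i (j + 1) - D.z i j) (D.T (D.z i j) ω)) μ :=
    fun i j hj => h.integrable_W_mul
      (h.integrable_comp (hF _ (D.mem_jumps (Finset.mem_range.1 hj))) _) i
  have h2 : ∀ i j ω, D.W i (D.T (-D.z i j) ω) * F (D.z i (j + 1) - D.z i j) ω =
      (fun ω => D.W i ω * F (D.z i (j + 1) - D.z i j) (D.T (D.z i j) ω)) (D.T (-D.z i j) ω) := by
    intro i j ω
    simp only [h.T_T_neg]
  have h3 : ∀ ω, D.M ω * ∑ v ∈ D.jumps, D.p v ω * F v ω = ∑ i, ∑ j ∈ Finset.range (D.n i),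
      D.W i (D.T (-D.z i j) ω) * F (D.z i (j + 1) - D.z i j) ω :=
    fun ω => h.M_mul_sum (fun v => F v ω) ω
  simp_rw [h3, h2]
  rw [integral_finsetSum]
  · refine Finset.sum_congr rfl fun i _ => ?_
    rw [integral_finsetSum]
    · exact Finset.sum_congr rfl fun j _ => h.integral_comp
        (fun ω => D.W i ω * F (D.z i (j + 1) - D.z i j) (D.T (D.z i j) ω)) _
    · exact fun j hj => h.integrable_comp (h1 i j hj) _
  · exact fun i _ => integrable_finsetSum _ fun j hj => h.integrable_comp (h1 i j hj) _

lemma integral_M_mul (h : D.Admissible μ c C ε N) {G : Ω → ℝ} (hG : Integrable G μ) :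
    ∫ ω, D.M ω * G ω ∂μ = ∑ i, ∑ j ∈ Finset.range (D.n i),
      ∫ ω, D.W i ω * G (D.T (D.z i j) ω) ∂μ := by
  rw [← h.integral_M_mul_sum (F := fun _ => G) (fun _ _ => hG)]
  refine integral_congr_ae (Filter.Eventually.of_forall fun ω => ?_)
  simp only
  rw [← Finset.sum_mul, h.sum_p, one_mul]

lemma sum_range_cyclic (h : D.Admissible μ c C ε N) {i : Fin K} {A : Type*} [AddCommMonoid A] (f : Zd d → A) :
    ∑ j ∈ Finset.range (D.n i), f (D.z i (j + 1)) = ∑ j ∈ Finset.range (D.n i), f (D.z i j) := by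
  obtain ⟨k, hk⟩ : ∃ k, D.n i = k + 1 := ⟨D.n i - 1, by have := h.len_pos i; omega⟩
  have h1 := h.closed i
  rw [hk] at h1 ⊢
  rw [Finset.sum_range_succ, Finset.sum_range_succ', h1]

/-- The measure with density `M` is invariant for the environment chain. -/
lemma integral_M_mul_avg (h : D.Admissible μ c C ε N) {f : Ω → ℝ} (hf : Integrable f μ) :
    ∫ ω, D.M ω * D.avg f ω ∂μ = ∫ ω, D.M ω * f ω ∂μ := by
  have h1 := h.integral_M_mul_sum (F := fun v ω => f (D.T v ω))
    (fun v _ => h.integrable_comp hf v)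
  simp only [avg, smul_eq_mul]
  rw [h1, h.integral_M_mul hf]
  refine Finset.sum_congr rfl fun i _ => ?_
  simp_rw [← h.T_add, sub_add_cancel]
  exact h.sum_range_cyclic fun x => ∫ ω, D.W i ω * f (D.T x ω) ∂μ

end Admissible
end CycleData

namespace CycleData

section Operators

variable {d K : ℕ} {Ω : Type*} {D : CycleData d K Ω} {E : Type*} [AddCommGroup E] [Module ℝ E]

lemma avg_add (f g : Ω → E) (ω : Ω) :
    D.avg (fun ω => f ω + g ω) ω = D.avg f ω + D.avg g ω := by
  simp only [avg, smul_add, Finset.sum_add_distrib]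

lemma avg_sub (f g : Ω → E) (ω : Ω) :
    D.avg (fun ω => f ω - g ω) ω = D.avg f ω - D.avg g ω := by
  simp only [avg, smul_sub, Finset.sum_sub_distrib]

lemma avg_const_mul (a : ℝ) (f : Ω → ℝ) (ω : Ω) :
    D.avg (fun ω => a * f ω) ω = a * D.avg f ω := by
  simp only [avg, smul_eq_mul, Finset.mul_sum]
  exact Finset.sum_congr rfl fun v _ => by ring

lemma avg_sum {ι : Type*} (s : Finset ι) (f : ι → Ω → E) (ω : Ω) :
    D.avg (fun ω => ∑ k ∈ s, f k ω) ω = ∑ k ∈ s, D.avg (f k) ω := by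
  simp only [avg, Finset.smul_sum]
  exact Finset.sum_comm

lemma step_add (ω : Ω) (F G : Zd d → E) (x : Zd d) :
    D.step ω (fun y => F y + G y) x = D.step ω F x + D.step ω G x := by
  simp only [step, smul_add, Finset.sum_add_distrib]

lemma step_sub (ω : Ω) (F G : Zd d → E) (x : Zd d) :
    D.step ω (fun y => F y - G y) x = D.step ω F x - D.step ω G x := by
  simp only [step, smul_sub, Finset.sum_sub_distrib]

lemma step_sum (ω : Ω) {ι : Type*} (s : Finset ι) (F : ι → Zd d → E) (x : Zd d) :
    D.step ω (fun y => ∑ k ∈ s, F k y) x = ∑ k ∈ s, D.step ω (F k) x := by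
  simp only [step, Finset.smul_sum]
  exact Finset.sum_comm

lemma step_smul_const (ω : Ω) (F : Zd d → ℝ) (a : E) (x : Zd d) :
    D.step ω (fun y => F y • a) x = D.step ω F x • a := by
  simp only [step, Finset.sum_smul, smul_eq_mul, smul_smul]

lemma iterate_step_add (ω : Ω) (F G : Zd d → E) (m : ℕ) (x : Zd d) :
    (D.step ω)^[m] (fun y => F y + G y) x = (D.step ω)^[m] F x + (D.step ω)^[m] G x := by
  induction m generalizing F G with
  | zero => rfl
  | succ m ih =>
    simp only [Function.iterate_succ_apply]
    rw [← ih]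
    refine congrFun (congrArg _ (funext fun y => ?_)) x
    exact step_add ω F G y

lemma iterate_step_sub (ω : Ω) (F G : Zd d → E) (m : ℕ) (x : Zd d) :
    (D.step ω)^[m] (fun y => F y - G y) x = (D.step ω)^[m] F x - (D.step ω)^[m] G x := by
  induction m generalizing F G with
  | zero => rfl
  | succ m ih =>
    simp only [Function.iterate_succ_apply]
    rw [← ih]
    refine congrFun (congrArg _ (funext fun y => ?_)) x
    exact step_sub ω F G y

lemma iterate_step_sum (ω : Ω) {ι : Type*} (s : Finset ι) (F : ι → Zd d → E) (m : ℕ) (x : Zd d) :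
    (D.step ω)^[m] (fun y => ∑ k ∈ s, F k y) x = ∑ k ∈ s, (D.step ω)^[m] (F k) x := by
  induction m generalizing F with
  | zero => rfl
  | succ m ih =>
    simp only [Function.iterate_succ_apply]
    rw [← ih]
    refine congrFun (congrArg _ (funext fun y => ?_)) x
    exact step_sum ω s F y

lemma iterate_step_smul_const (ω : Ω) (F : Zd d → ℝ) (a : E) (m : ℕ) (x : Zd d) :
    (D.step ω)^[m] (fun y => F y • a) x = (D.step ω)^[m] F x • a := by
  induction m generalizing F with
  | zero => rfl
  | succ m ih =>
    simp only [Function.iterate_succ_apply]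
    rw [← ih]
    refine congrFun (congrArg _ (funext fun y => ?_)) x
    exact step_smul_const ω F a y

/-- The set of possible displacements in `m` steps. -/
def reach (D : CycleData d K Ω) : ℕ → Finset (Zd d)
  | 0 => {0}
  | m + 1 => Finset.image₂ (fun v r => v + r) D.jumps (reach D m)

lemma iterate_step_congr (ω : Ω) {F G : Zd d → E} (m : ℕ) (x : Zd d)
    (hFG : ∀ r ∈ D.reach m, F (x + r) = G (x + r)) :
    (D.step ω)^[m] F x = (D.step ω)^[m] G x := by
  induction m generalizing x with
  | zero => simpa [reach] using hFG
  | succ m ih =>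
    simp only [Function.iterate_succ_apply', step]
    refine Finset.sum_congr rfl fun v hv => ?_
    rw [ih]
    intro r hr
    have := hFG (v + r) (Finset.mem_image₂_of_mem hv hr)
    rwa [← add_assoc] at this

/-- The probability of moving from `x` to `y` in `m` steps. -/
def trans (D : CycleData d K Ω) (ω : Ω) (m : ℕ) (x y : Zd d) : ℝ :=
  (D.step ω)^[m] (fun y' => if y' = y then 1 else 0) x

lemma trans_eq_zero (ω : Ω) {m : ℕ} {x y : Zd d} (hy : y - x ∉ D.reach m) :
    D.trans ω m x y = 0 := by
  have h0 : ∀ m, ∀ x, (D.step ω)^[m] (fun _ => (0 : ℝ)) x = 0 := by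
    intro m
    induction m with
    | zero => intro x; rfl
    | succ m ih => intro x; simp [Function.iterate_succ_apply', step, ih]
  rw [trans, iterate_step_congr (G := fun _ => (0 : ℝ)), h0]
  intro r hr
  rw [if_neg]
  rintro rfl
  exact hy (by simpa using hr)

lemma iterate_step_eq_sum (ω : Ω) (F : Zd d → E) (m : ℕ) (x : Zd d) :
    (D.step ω)^[m] F x = ∑ r ∈ D.reach m, D.trans ω m x (x + r) • F (x + r) := by
  simp only [trans]
  simp_rw [← iterate_step_smul_const]
  rw [← iterate_step_sum]
  refine iterate_step_congr ω m x fun r hr => ?_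
  rw [Finset.sum_eq_single r]
  · simp
  · intro r' _ hr'
    rw [if_neg, zero_smul]
    simpa using hr'.symm
  · exact fun h => absurd hr h

lemma iterate_step_eq_sum_image (ω : Ω) (F : Zd d → E) (m : ℕ) :
    (D.step ω)^[m] F 0 = ∑ r ∈ D.reach m, D.trans ω m 0 r • F r := by
  simpa using iterate_step_eq_sum (D := D) ω F m 0

end Operators

namespace Admissible

variable {d K : ℕ} {Ω : Type*} [MeasurableSpace Ω] {D : CycleData d K Ω} {μ : Measure Ω}
  {c C ε : ℝ} {N : ℕ}

lemma avg_comp_T (h : D.Admissible μ c C ε N) {E : Type*} [AddCommGroup E] [Module ℝ E]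
    (f : Ω → E) (x : Zd d) (ω : Ω) :
    D.avg f (D.T x ω) = D.step ω (fun y => f (D.T y ω)) x := by
  simp only [avg, step, ← h.T_add, add_comm x]

lemma iterate_avg_comp_T (h : D.Admissible μ c C ε N) {E : Type*} [AddCommGroup E] [Module ℝ E]
    (f : Ω → E) (m : ℕ) (x : Zd d) (ω : Ω) :
    D.avg^[m] f (D.T x ω) = (D.step ω)^[m] (fun y => f (D.T y ω)) x := by
  induction m generalizing f with
  | zero => rfl
  | succ m ih =>
    simp only [Function.iterate_succ_apply]
    rw [ih]
    refine congrFun (congrArg _ (funext fun y => ?_)) x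
    exact h.avg_comp_T f y ω

lemma iterate_avg_eq (h : D.Admissible μ c C ε N) {E : Type*} [AddCommGroup E] [Module ℝ E]
    (f : Ω → E) (m : ℕ) (ω : Ω) :
    D.avg^[m] f ω = (D.step ω)^[m] (fun y => f (D.T y ω)) 0 := by
  rw [← h.iterate_avg_comp_T, h.T_zero]

lemma iterate_step_shift (h : D.Admissible μ c C ε N) {E : Type*} [AddCommGroup E] [Module ℝ E]
    (F : Zd d → E) (m : ℕ) (x v : Zd d) (ω : Ω) :
    (D.step ω)^[m] F (x + v) = (D.step (D.T v ω))^[m] (fun y => F (y + v)) x := by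
  induction m generalizing F with
  | zero => rfl
  | succ m ih =>
    simp only [Function.iterate_succ_apply]
    rw [ih]
    refine congrFun (congrArg _ (funext fun y => ?_)) x
    simp only [step, ← h.T_add, add_right_comm y v]

lemma kerpow_eq (h : D.Admissible μ c C ε N) (ω : Ω) (m : ℕ) (x y : Zd d) :
    kerpow (Qker D.n D.z D.T D.W ω) m x y = D.trans ω m x y := by
  induction m generalizing y with
  | zero => simp [kerpow, trans]
  | succ m ih =>
    simp only [kerpow, ih]
    rw [tsum_eq_sum (s := (D.reach m).image fun r => x + r), Finset.sum_image (by simp)]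
    · rw [trans, Function.iterate_succ_apply, iterate_step_eq_sum]
      refine Finset.sum_congr rfl fun r _ => ?_
      rw [smul_eq_mul]
      congr 1
      simp only [step, smul_eq_mul, mul_ite, mul_one, mul_zero, Qker]
      rw [Finset.sum_ite, Finset.sum_const_zero, add_zero]
      have h1 : ∀ v, x + r + v = y ↔ v = y - (x + r) := fun v => by
        rw [eq_sub_iff_add_eq, add_comm v]
      simp_rw [h1]
      rw [Finset.filter_eq']
      split_ifs with hv
      · rw [Finset.sum_singleton]
        rfl
      · rw [Finset.sum_empty]
        exact h.p_eq_zero hv _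
    · intro w hw
      rw [D.trans_eq_zero, zero_mul]
      intro hw'
      exact hw (Finset.mem_image.2 ⟨_, hw', by simp⟩)

lemma avg_mono (h : D.Admissible μ c C ε N) {f g : Ω → ℝ} (hfg : ∀ ω, f ω ≤ g ω) (ω : Ω) :
    D.avg f ω ≤ D.avg g ω :=
  Finset.sum_le_sum fun v _ => mul_le_mul_of_nonneg_left (hfg _) (h.p_nonneg v ω)

lemma avg_const (h : D.Admissible μ c C ε N) (a : ℝ) (ω : Ω) : D.avg (fun _ => a) ω = a := by
  simp only [avg, smul_eq_mul, ← Finset.sum_mul, h.sum_p, one_mul]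

lemma avg_meas (h : D.Admissible μ c C ε N) {f : Ω → ℝ} (hf : Measurable f) :
    Measurable (D.avg f) :=
  Finset.measurable_sum _ fun v _ => (h.p_meas v).mul (hf.comp (h.T_meas v))

lemma abs_avg_le (h : D.Admissible μ c C ε N) {f : Ω → ℝ} {B : ℝ} (hf : ∀ ω, |f ω| ≤ B) (ω : Ω) :
    |D.avg f ω| ≤ B := by
  rw [abs_le]
  constructor
  · rw [← h.avg_const (-B) ω]
    exact h.avg_mono (fun ω => (abs_le.1 (hf ω)).1) ω
  · rw [← h.avg_const B ω]
    exact h.avg_mono (fun ω => (abs_le.1 (hf ω)).2) ω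


lemma step_mono (h : D.Admissible μ c C ε N) {F G : Zd d → ℝ} (hFG : ∀ x, F x ≤ G x)
    (ω : Ω) (x : Zd d) : D.step ω F x ≤ D.step ω G x :=
  Finset.sum_le_sum fun v _ => mul_le_mul_of_nonneg_left (hFG _) (h.p_nonneg v _)

lemma iterate_step_mono (h : D.Admissible μ c C ε N) {F G : Zd d → ℝ} (hFG : ∀ x, F x ≤ G x)
    (ω : Ω) (m : ℕ) (x : Zd d) : (D.step ω)^[m] F x ≤ (D.step ω)^[m] G x := by
  induction m generalizing x with
  | zero => exact hFG x
  | succ m ih =>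
    simp only [Function.iterate_succ_apply']
    exact h.step_mono ih ω x

lemma iterate_step_const (h : D.Admissible μ c C ε N) (a : ℝ) (ω : Ω) (m : ℕ) (x : Zd d) :
    (D.step ω)^[m] (fun _ => a) x = a := by
  induction m generalizing x with
  | zero => rfl
  | succ m ih =>
    simp only [Function.iterate_succ_apply', step, ih, smul_eq_mul, ← Finset.sum_mul, h.sum_p,
      one_mul]

lemma trans_nonneg (h : D.Admissible μ c C ε N) (ω : Ω) (m : ℕ) (x y : Zd d) :
    0 ≤ D.trans ω m x y := by
  rw [← h.iterate_step_const 0 ω m x]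
  refine h.iterate_step_mono (fun y' => ?_) ω m x
  split_ifs <;> norm_num

lemma norm_iterate_step_le (h : D.Admissible μ c C ε N) {E : Type*} [NormedAddCommGroup E]
    [NormedSpace ℝ E] (F : Zd d → E) (ω : Ω) (m : ℕ) (x : Zd d) :
    ‖(D.step ω)^[m] F x‖ ≤ (D.step ω)^[m] (fun y => ‖F y‖) x := by
  rw [iterate_step_eq_sum, iterate_step_eq_sum]
  refine (norm_sum_le _ _).trans (Finset.sum_le_sum fun r _ => ?_)
  rw [norm_smul, Real.norm_of_nonneg (h.trans_nonneg _ _ _ _), smul_eq_mul]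

lemma exists_trans_ge (h : D.Admissible μ c C ε N) (ω : Ω) (i : Fin d) :
    ∃ m ≤ N, ε ≤ D.trans ω m 0 (Pi.single i 1) := by
  obtain ⟨m, hm, hε⟩ := h.irr ω i
  exact ⟨m, hm, by rwa [h.kerpow_eq] at hε⟩

/-- The recursive majorant of the second moment of an additive cocycle along the walk. -/
def cocycleBound (D : CycleData d K Ω) (g : Ω → ℝ) : ℕ → Ω → ℝ
  | 0 => fun _ => 0
  | m + 1 => fun ω => 2 * D.avg (cocycleBound D g m) ω + 2 * g ω

lemma iterate_step_cocycle_sq_le (h : D.Admissible μ c C ε N) {G : Zd d → Ω → ℝ}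
    (hG : ∀ x y ω, G (x + y) ω = G x (D.T y ω) + G y ω) (m : ℕ) (ω : Ω) :
    (D.step ω)^[m] (fun x => G x ω ^ 2) 0 ≤
      cocycleBound D (fun ω => ∑ v ∈ D.jumps, D.p v ω * G v ω ^ 2) m ω := by
  induction m generalizing ω with
  | zero =>
    have h0 := hG 0 0 ω
    rw [add_zero, h.T_zero] at h0
    have h1 : G 0 ω = 0 := by linarith
    simp [h1, cocycleBound]
  | succ m ih =>
    simp only [Function.iterate_succ_apply', step, cocycleBound, avg, Finset.mul_sum,
      smul_eq_mul, h.T_zero]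
    rw [← Finset.sum_add_distrib]
    refine Finset.sum_le_sum fun v _ => ?_
    rw [h.iterate_step_shift]
    have h2 : (D.step (D.T v ω))^[m] (fun y => G (y + v) ω ^ 2) 0 ≤
        (D.step (D.T v ω))^[m] (fun y => (G y (D.T v ω) ^ 2 + G y (D.T v ω) ^ 2) +
          2 * G v ω ^ 2) 0 := by
      refine h.iterate_step_mono (fun y => ?_) _ _ _
      rw [hG]
      nlinarith [sq_nonneg (G y (D.T v ω) - G v ω)]
    rw [iterate_step_add, iterate_step_add, h.iterate_step_const] at h2
    have h3 := ih (D.T v ω)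
    nlinarith [h.p_nonneg v ω, mul_le_mul_of_nonneg_left (h2.trans
      (add_le_add (add_le_add h3 h3) le_rfl)) (h.p_nonneg v ω)]

lemma integrable_cocycleBound (h : D.Admissible μ c C ε N) {g : Ω → ℝ} (hg : Integrable g μ)
    (m : ℕ) : Integrable (cocycleBound D g m) μ := by
  induction m with
  | zero => exact integrable_zero _ _ _
  | succ m ih => exact ((h.integrable_avg ih).const_mul 2).add (hg.const_mul 2)

lemma integral_M_mul_cocycleBound (h : D.Admissible μ c C ε N) {g : Ω → ℝ} (hg : Integrable g μ)
    (m : ℕ) : ∫ ω, D.M ω * cocycleBound D g m ω ∂μ = 2 * (2 ^ m - 1) * ∫ ω, D.M ω * g ω ∂μ := by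
  induction m with
  | zero => simp [cocycleBound]
  | succ m ih =>
    have h1 := h.integrable_M_mul (h.integrable_avg (h.integrable_cocycleBound hg m))
    have h2 := h.integrable_M_mul hg
    calc ∫ ω, D.M ω * cocycleBound D g (m + 1) ω ∂μ
        = ∫ ω, 2 * (D.M ω * D.avg (cocycleBound D g m) ω) + 2 * (D.M ω * g ω) ∂μ := by
          refine integral_congr_ae (Filter.Eventually.of_forall fun ω => ?_)
          simp only [cocycleBound]
          ring
      _ = _ := by
          rw [integral_add (h1.const_mul 2) (h2.const_mul 2), integral_const_mul,
            integral_const_mul, h.integral_M_mul_avg (h.integrable_cocycleBound hg m), ih]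
          ring

/-- The constant in the coercivity estimate. -/
def coerConst (c ε : ℝ) (N : ℕ) : ℝ := (N + 1) * (2 * 2 ^ N) / (c * ε)

lemma coerConst_nonneg (h : D.Admissible μ c C ε N) : 0 ≤ coerConst c ε N := by
  have := h.c_pos
  have := h.ε_pos
  unfold coerConst
  positivity

/-- Irreducibility bounds an additive cocycle in the unit directions by its Dirichlet form. -/
lemma integral_cocycle_sq_le (h : D.Admissible μ c C ε N) {G : Zd d → Ω → ℝ}
    (hG : ∀ x y ω, G (x + y) ω = G x (D.T y ω) + G y ω)
    (hintg : ∀ v ∈ D.jumps, Integrable (fun ω => G v ω ^ 2) μ) (i : Fin d) :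
    ∫ ω, G (Pi.single i 1) ω ^ 2 ∂μ ≤
      coerConst c ε N * ∫ ω, D.M ω * ∑ v ∈ D.jumps, D.p v ω * G v ω ^ 2 ∂μ := by
  have hc := h.c_pos
  have hε := h.ε_pos
  set g : Ω → ℝ := fun ω => ∑ v ∈ D.jumps, D.p v ω * G v ω ^ 2 with hg
  have hgi : Integrable g μ := integrable_finsetSum _ fun v hv => h.integrable_p_mul (hintg v hv) v
  have hg0 : 0 ≤ ∫ ω, D.M ω * g ω ∂μ := integral_nonneg fun ω => mul_nonneg (h.M_pos ω).le
    (Finset.sum_nonneg fun v _ => mul_nonneg (h.p_nonneg v ω) (sq_nonneg _))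
  have hb0 : ∀ m ω, 0 ≤ cocycleBound D g m ω := by
    intro m ω
    refine le_trans ?_ (h.iterate_step_cocycle_sq_le hG m ω)
    rw [← h.iterate_step_const 0 ω m 0]
    exact h.iterate_step_mono (fun _ => sq_nonneg _) ω m 0
  have hpt : ∀ ω, G (Pi.single i 1) ω ^ 2 ≤
      (c * ε)⁻¹ * ∑ m ∈ Finset.range (N + 1), D.M ω * cocycleBound D g m ω := by
    intro ω
    obtain ⟨m, hm, hmε⟩ := h.exists_trans_ge ω i
    have h1 : D.trans ω m 0 (Pi.single i 1) * G (Pi.single i 1) ω ^ 2 ≤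
        (D.step ω)^[m] (fun x => G x ω ^ 2) 0 := by
      rw [trans, ← smul_eq_mul, ← iterate_step_smul_const]
      refine h.iterate_step_mono (fun y => ?_) ω m 0
      split_ifs with hy
      · simp [hy]
      · simpa using sq_nonneg _
    have h2 : ε * G (Pi.single i 1) ω ^ 2 ≤ cocycleBound D g m ω :=
      ((mul_le_mul_of_nonneg_right hmε (sq_nonneg _)).trans h1).trans
        (h.iterate_step_cocycle_sq_le hG m ω)
    have h3 : D.M ω * cocycleBound D g m ω ≤
        ∑ m ∈ Finset.range (N + 1), D.M ω * cocycleBound D g m ω :=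
      Finset.single_le_sum (f := fun m => D.M ω * cocycleBound D g m ω)
        (fun m _ => mul_nonneg (h.M_pos ω).le (hb0 m ω)) (Finset.mem_range.2 (by omega))
    rw [inv_mul_eq_div, le_div_iff₀ (by positivity)]
    nlinarith [mul_le_mul_of_nonneg_left h2 hc.le,
      mul_le_mul_of_nonneg_right (h.M_lower ω) (hb0 m ω)]
  have hbi : ∀ m, Integrable (fun ω => D.M ω * cocycleBound D g m ω) μ :=
    fun m => h.integrable_M_mul (h.integrable_cocycleBound hgi m)
  refine (integral_mono_of_nonneg (Filter.Eventually.of_forall fun ω => sq_nonneg _)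
    ((integrable_finsetSum _ fun m _ => hbi m).const_mul _)
    (Filter.Eventually.of_forall hpt)).trans ?_
  rw [integral_const_mul, integral_finsetSum _ fun m _ => hbi m]
  have h4 : ∀ m ∈ Finset.range (N + 1), ∫ ω, D.M ω * cocycleBound D g m ω ∂μ ≤
      2 * 2 ^ N * ∫ ω, D.M ω * g ω ∂μ := by
    intro m hm
    rw [h.integral_M_mul_cocycleBound hgi]
    refine mul_le_mul_of_nonneg_right ?_ hg0
    have : (2 : ℝ) ^ m ≤ 2 ^ N := pow_le_pow_right₀ (by norm_num) (by simp at hm; omega)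
    linarith
  refine (mul_le_mul_of_nonneg_left (Finset.sum_le_card_nsmul _ _ _ h4)
    (by positivity)).trans (le_of_eq ?_)
  rw [Finset.card_range, nsmul_eq_mul, coerConst]
  push_cast
  simp only [hg]
  field_simp

/-! ### The frozen environment -/

lemma lattice_M (h : D.Admissible μ c C ε N) (ω : Ω) (x : Zd d) :
    (D.lattice ω).M x = D.M (D.T x ω) := by
  simp only [M, Mfun, lattice, h.T_add]

lemma lattice_p (h : D.Admissible μ c C ε N) (ω : Ω) (v x : Zd d) :
    (D.lattice ω).p v x = D.p v (D.T x ω) := by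
  simp only [p, pfun, Mfun, lattice, h.T_add]

lemma lattice_avg (h : D.Admissible μ c C ε N) (ω : Ω) {E : Type*} [AddCommGroup E] [Module ℝ E]
    (F : Zd d → E) : (D.lattice ω).avg F = D.step ω F := by
  funext x
  simp only [avg, step, h.lattice_p]
  exact Finset.sum_congr rfl fun v _ => by simp [lattice, add_comm]

lemma lattice_admissible (h : D.Admissible μ c C ε N) (ω : Ω) :
    (D.lattice ω).Admissible Measure.count c C ε N where
  len_pos := h.len_pos
  closed := h.closed
  inj := h.inj
  T_add := fun x y z => add_assoc x y z
  T_zero := fun x => zero_add x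
  W_nonneg := fun i x => h.W_nonneg i _
  W_meas := fun i => Measurable.of_discrete
  c_pos := h.c_pos
  M_lower := fun x => by rw [h.lattice_M]; exact h.M_lower _
  M_upper := fun x => by rw [h.lattice_M]; exact h.M_upper _
  pres := fun x => measurePreserving_add_left Measure.count x
  ε_pos := h.ε_pos
  irr := fun x i => by
    obtain ⟨m, hm, hε⟩ := h.irr (D.T x ω) i
    refine ⟨m, hm, ?_⟩
    convert hε using 2
    funext y y'
    have := h.lattice_p ω (y' - y) (y + x)
    rw [h.T_add] at this
    exact this

end Admissible
end CycleData

/-! ### Sums along a cycle -/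

section Cyclic

lemma sum_range_periodic {A : Type*} [AddCommMonoid A] {n : ℕ} {f : ℕ → A}
    (hf : ∀ j, f (j + n) = f j) (s : ℕ) :
    ∑ j ∈ Finset.range n, f (j + s) = ∑ j ∈ Finset.range n, f j := by
  have h1 : ∀ g : ℕ → A, (∀ j, g (j + n) = g j) →
      ∑ j ∈ Finset.range n, g (j + 1) = ∑ j ∈ Finset.range n, g j := by
    intro g hg
    cases n with
    | zero => simp
    | succ k =>
      rw [Finset.sum_range_succ, Finset.sum_range_succ']
      have := hg 0
      rw [zero_add] at this
      rw [this]
  induction s with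
  | zero => rfl
  | succ s ih =>
    rw [← ih, ← h1 fun j => f (j + s)]
    · exact Finset.sum_congr rfl fun j _ => by congr 1; ring
    · intro j
      rw [← hf (j + s)]
      congr 1
      ring

variable {n L : ℕ} {a : ℕ → ℕ → ℝ}

lemma cycle_time_sum_diff (ha : ∀ k j, a k (j + n) = a k j) (hL : n ∣ L) (j : ℕ) :
    ∑ k ∈ Finset.range L, a k j - ∑ k ∈ Finset.range L, a k (j + 1) =
      ∑ k ∈ Finset.range L, ((a k j - a (k + 1) (j + 1)) -
        (a k (j + 1 + k) - a (k + 1) (j + 1 + k + 1))) := by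
  have h1 : ∑ k ∈ Finset.range L, (a k (j + 1 + k) - a (k + 1) (j + 1 + k + 1)) =
      a 0 (j + 1) - a L (j + 1) := by
    have := Finset.sum_range_sub' (fun k => a k (j + 1 + k)) L
    rw [add_zero] at this
    have h2 : a L (j + 1 + L) = a L (j + 1) := by
      have h3 : ∀ q, a L (j + 1 + n * q) = a L (j + 1) := by
        intro q
        induction q with
        | zero => simp
        | succ q ih => rw [Nat.mul_succ, ← add_assoc, ha, ih]
      obtain ⟨q, hq⟩ := hL
      nth_rewrite 2 [hq]
      exact h3 q
    rw [← h2, ← this]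
    rfl
  have h3 := Finset.sum_range_sub' (fun k => a k (j + 1)) L
  rw [Finset.sum_sub_distrib, h1, ← h3]
  simp only [Finset.sum_sub_distrib]
  ring

lemma cycle_abs_diff_le (ha : ∀ k j, a k (j + n) = a k j) (hL : n ∣ L) :
    ∑ j ∈ Finset.range n,
        |∑ k ∈ Finset.range L, a k (j + 1) - ∑ k ∈ Finset.range L, a k j| ≤
      2 * ∑ k ∈ Finset.range L, ∑ j ∈ Finset.range n, |a k j - a (k + 1) (j + 1)| := by
  have h1 : ∀ j ∈ Finset.range n,
      |∑ k ∈ Finset.range L, a k (j + 1) - ∑ k ∈ Finset.range L, a k j| ≤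
      ∑ k ∈ Finset.range L, (|a k j - a (k + 1) (j + 1)| +
        |a k (j + 1 + k) - a (k + 1) (j + 1 + k + 1)|) := by
    intro j _
    rw [abs_sub_comm, cycle_time_sum_diff ha hL]
    exact (Finset.abs_sum_le_sum_abs _ _).trans (Finset.sum_le_sum fun k _ => abs_sub _ _)
  refine (Finset.sum_le_sum h1).trans (le_of_eq ?_)
  rw [Finset.sum_comm, Finset.mul_sum]
  refine Finset.sum_congr rfl fun k _ => ?_
  rw [Finset.sum_add_distrib, two_mul]
  congr 1
  have h2 := sum_range_periodic (n := n) (f := fun j => |a k j - a (k + 1) (j + 1)|)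
    (fun j => by simp only [ha, add_right_comm j n 1]) (1 + k)
  rw [← h2]
  exact Finset.sum_congr rfl fun j _ => by simp only [add_assoc]

lemma cycle_sq_diff_le (ha : ∀ k j, a k (j + n) = a k j) (hL : n ∣ L) :
    ∑ j ∈ Finset.range n,
        (∑ k ∈ Finset.range L, a k (j + 1) - ∑ k ∈ Finset.range L, a k j) ^ 2 ≤
      4 * L * ∑ k ∈ Finset.range L, ∑ j ∈ Finset.range n, (a k j - a (k + 1) (j + 1)) ^ 2 := by
  have h1 : ∀ j ∈ Finset.range n,
      (∑ k ∈ Finset.range L, a k (j + 1) - ∑ k ∈ Finset.range L, a k j) ^ 2 ≤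
      2 * L * ∑ k ∈ Finset.range L, ((a k j - a (k + 1) (j + 1)) ^ 2 +
        (a k (j + 1 + k) - a (k + 1) (j + 1 + k + 1)) ^ 2) := by
    intro j _
    rw [← neg_sq, neg_sub, cycle_time_sum_diff ha hL]
    refine (sq_sum_le_card_mul_sum_sq (α := ℝ)).trans ?_
    rw [Finset.card_range, show (2 : ℝ) * L = L * 2 by ring, mul_assoc (L : ℝ)]
    refine mul_le_mul_of_nonneg_left ?_ (by positivity)
    rw [Finset.mul_sum]
    refine Finset.sum_le_sum fun k _ => ?_
    nlinarith [sq_nonneg ((a k j - a (k + 1) (j + 1)) +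
      (a k (j + 1 + k) - a (k + 1) (j + 1 + k + 1)))]
  refine (Finset.sum_le_sum h1).trans (le_of_eq ?_)
  rw [← Finset.mul_sum, show (4 : ℝ) * L = 2 * L * 2 by ring, mul_assoc (2 * (L : ℝ))]
  congr 1
  rw [Finset.sum_comm, Finset.mul_sum]
  refine Finset.sum_congr rfl fun k _ => ?_
  rw [Finset.sum_add_distrib, two_mul]
  congr 1
  have h2 := sum_range_periodic (n := n) (f := fun j => (a k j - a (k + 1) (j + 1)) ^ 2)
    (fun j => by simp only [ha, add_right_comm j n 1]) (1 + k)
  rw [← h2]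
  exact Finset.sum_congr rfl fun j _ => by simp only [add_assoc]

lemma cycle_weighted_le (ha : ∀ k j, a k (j + n) = a k j) (hL : n ∣ L) (hn : 0 < n)
    {w w' : ℕ → ℝ} (hw : ∀ j, w (j + n) = w j) (hw' : ∀ j, w' (j + n) = w' j)
    (hpos : ∀ j, 0 < w j) (hpos' : ∀ j, 0 ≤ w' j) {κ : ℝ} (hκ0 : 0 ≤ κ)
    (hκ : ∀ j j', (w (j + 1) - w j) ^ 2 ≤ κ * (w (j' + 1) * w' j'))
    (hκ' : ∀ j j', (w (j + 1) - w j) ^ 2 ≤ κ * (w (j' + 1) * w' (j' + 1))) :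
    ∑ j ∈ Finset.range n, (∑ k ∈ Finset.range L, a k j ^ 2) * (w (j + 1) - w j) ≤
      (∑ k ∈ Finset.range L, ∑ j ∈ Finset.range n, (a k j - a (k + 1) (j + 1)) ^ 2 * w (j + 1)) +
      4 * n ^ 2 * κ * ∑ k ∈ Finset.range (L + 1), ∑ j ∈ Finset.range n, a k j ^ 2 * w' j := by
  set e : ℕ → ℝ := fun j => ∑ k ∈ Finset.range L, a k j ^ 2 with he
  set S : ℝ := ∑ k ∈ Finset.range L, ∑ j ∈ Finset.range n, |a k j ^ 2 - a (k + 1) (j + 1) ^ 2|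
    with hS
  have hS0 : ∑ j ∈ Finset.range n, |e (j + 1) - e j| ≤ 2 * S :=
    cycle_abs_diff_le (a := fun k j => a k j ^ 2) (fun k j => by simp only [ha]) hL
  have hcyc : ∑ j ∈ Finset.range n, (w (j + 1) - w j) = 0 := by
    rw [Finset.sum_sub_distrib, sum_range_periodic hw, sub_self]
  have he0 : ∀ j ∈ Finset.range n, |e j - e 0| ≤ 2 * S := by
    intro j hj
    rw [← Finset.sum_range_sub]
    refine (Finset.abs_sum_le_sum_abs _ _).trans (le_trans ?_ hS0)
    exact Finset.sum_le_sum_of_subset_of_nonneg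
      (Finset.range_subset_range.2 (Finset.mem_range.1 hj).le) fun _ _ _ => abs_nonneg _
  have h1 : ∑ j ∈ Finset.range n, e j * (w (j + 1) - w j) ≤
      ∑ j ∈ Finset.range n, 2 * S * |w (j + 1) - w j| := by
    have : ∑ j ∈ Finset.range n, e j * (w (j + 1) - w j) =
        ∑ j ∈ Finset.range n, (e j - e 0) * (w (j + 1) - w j) := by
      simp only [sub_mul (e _)]
      rw [Finset.sum_sub_distrib, ← Finset.mul_sum, hcyc, mul_zero, sub_zero]
    rw [this]
    refine Finset.sum_le_sum fun j hj => (le_abs_self _).trans ?_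
    rw [abs_mul]
    exact mul_le_mul_of_nonneg_right (he0 j hj) (abs_nonneg _)
  have hn' : (0 : ℝ) < n := by exact_mod_cast hn
  have h2 : ∀ j, 2 * S * |w (j + 1) - w j| ≤
      ∑ k ∈ Finset.range L, ∑ j' ∈ Finset.range n,
        ((n : ℝ)⁻¹ * ((a k j' - a (k + 1) (j' + 1)) ^ 2 * w (j' + 1)) +
          2 * n * κ * (a k j' ^ 2 * w' j' + a (k + 1) (j' + 1) ^ 2 * w' (j' + 1))) := by
    intro j
    rw [hS, Finset.mul_sum, Finset.sum_mul]
    refine Finset.sum_le_sum fun k _ => ?_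
    rw [Finset.mul_sum, Finset.sum_mul]
    refine Finset.sum_le_sum fun j' _ => ?_
    have hb := hκ j j'
    have hb' := hκ' j j'
    have hwp := hpos (j' + 1)
    generalize a k j' = x at *
    generalize a (k + 1) (j' + 1) = y at *
    generalize w (j + 1) - w j = Δ at *
    generalize w (j' + 1) = ww at *
    generalize w' j' = u at *
    generalize w' (j' + 1) = u' at *
    have e1 : |x ^ 2 - y ^ 2| = |x - y| * |x + y| := by rw [← abs_mul]; congr 1; ring
    have e2 : 2 * |x ^ 2 - y ^ 2| * |Δ| ≤
        (n : ℝ)⁻¹ * ((x - y) ^ 2 * ww) + n * ((x + y) ^ 2 * Δ ^ 2 / ww) := by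
      have h5 : 0 ≤ (n : ℝ)⁻¹ * ww * (|x - y| - n * (|x + y| * |Δ|) / ww) ^ 2 := by positivity
      have h6 : (n : ℝ)⁻¹ * ww * (|x - y| - n * (|x + y| * |Δ|) / ww) ^ 2 =
          (n : ℝ)⁻¹ * (|x - y| ^ 2 * ww) + n * (|x + y| ^ 2 * |Δ| ^ 2 / ww)
            - 2 * (|x - y| * |x + y|) * |Δ| := by
        field_simp
        ring
      rw [h6, sq_abs, sq_abs, sq_abs, ← e1] at h5
      linarith
    refine e2.trans (add_le_add le_rfl ?_)
    have e3 : (x + y) ^ 2 * Δ ^ 2 / ww ≤ 2 * κ * (x ^ 2 * u + y ^ 2 * u') := by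
      rw [div_le_iff₀ hwp]
      have h7 : (x + y) ^ 2 ≤ 2 * x ^ 2 + 2 * y ^ 2 := by nlinarith [sq_nonneg (x - y)]
      nlinarith [mul_le_mul_of_nonneg_right h7 (sq_nonneg Δ),
        mul_le_mul_of_nonneg_left hb (sq_nonneg x), mul_le_mul_of_nonneg_left hb' (sq_nonneg y)]
    calc (n : ℝ) * ((x + y) ^ 2 * Δ ^ 2 / ww) ≤ n * (2 * κ * (x ^ 2 * u + y ^ 2 * u')) :=
          mul_le_mul_of_nonneg_left e3 hn'.le
      _ = _ := by ring
  refine (h1.trans (Finset.sum_le_sum fun j _ => h2 j)).trans ?_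
  rw [Finset.sum_const, Finset.card_range, nsmul_eq_mul]
  simp only [Finset.sum_add_distrib, ← Finset.mul_sum]
  have h8 : ∀ k, ∑ j ∈ Finset.range n, a (k + 1) (j + 1) ^ 2 * w' (j + 1) =
      ∑ j ∈ Finset.range n, a (k + 1) j ^ 2 * w' j := fun k =>
    sum_range_periodic (f := fun j => a (k + 1) j ^ 2 * w' j)
      (fun j => by simp only [ha, hw']) 1
  simp only [h8]
  set X := ∑ k ∈ Finset.range L, ∑ j ∈ Finset.range n, (a k j - a (k + 1) (j + 1)) ^ 2 * w (j + 1)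
  have hnn : ∀ k, 0 ≤ ∑ j ∈ Finset.range n, a k j ^ 2 * w' j := fun k =>
    Finset.sum_nonneg fun j _ => mul_nonneg (sq_nonneg _) (hpos' j)
  have h9 := Finset.sum_range_succ (fun k => ∑ j ∈ Finset.range n, a k j ^ 2 * w' j) L
  have h10 := Finset.sum_range_succ' (fun k => ∑ j ∈ Finset.range n, a k j ^ 2 * w' j) L
  set Y := ∑ k ∈ Finset.range (L + 1), ∑ j ∈ Finset.range n, a k j ^ 2 * w' j
  set Y1 := ∑ k ∈ Finset.range L, ∑ j ∈ Finset.range n, a k j ^ 2 * w' j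
  set Y2 := ∑ k ∈ Finset.range L, ∑ j ∈ Finset.range n, a (k + 1) j ^ 2 * w' j
  have h11 : Y1 + Y2 ≤ 2 * Y := by linarith [hnn 0, hnn L]
  calc (n : ℝ) * ((n : ℝ)⁻¹ * X + 2 * n * κ * (Y1 + Y2))
      = X + 2 * n ^ 2 * κ * (Y1 + Y2) := by field_simp
    _ ≤ X + 2 * n ^ 2 * κ * (2 * Y) := by
        have : 0 ≤ 2 * (n : ℝ) ^ 2 * κ := by positivity
        exact add_le_add le_rfl (mul_le_mul_of_nonneg_left h11 this)
    _ = _ := by ring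

end Cyclic

/-! ### The heat kernel of the walk in a fixed environment -/

section FiniteSupport

variable {d : ℕ}

lemma integrable_count_of_finite {f : Zd d → ℝ} (hf : f.support.Finite) :
    Integrable f Measure.count :=
  integrable_count_iff.2 (summable_of_hasFiniteSupport (hf.subset fun x hx => by
    simpa using hx))

lemma integral_count_eq_sum {f : Zd d → ℝ} {s : Finset (Zd d)} (hs : ∀ x ∉ s, f x = 0) :
    ∫ x, f x ∂Measure.count = ∑ x ∈ s, f x := by
  have hf : f.support.Finite := s.finite_toSet.subset fun x hx => by
    by_contra hxs
    exact hx (hs x hxs)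
  rw [integral_countable (integrable_count_of_finite hf), tsum_eq_sum (s := s)]
  · refine Finset.sum_congr rfl fun x _ => ?_
    simp [Measure.real]
  · intro x hx
    rw [hs x hx, smul_zero]

lemma finite_support_mul_right {f : Zd d → ℝ} (hf : f.support.Finite) (g : Zd d → ℝ) :
    (fun x => f x * g x).support.Finite :=
  hf.subset fun x hx => by
    simp only [Function.mem_support] at hx ⊢
    exact left_ne_zero_of_mul hx

lemma finite_support_translate {f : Zd d → ℝ} (hf : f.support.Finite) (v : Zd d) :
    (fun x => f (v + x)).support.Finite :=
  (hf.preimage (f := fun x => v + x) (add_right_injective v).injOn)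

lemma finite_support_of_imp {ι : Type*} {f : Zd d → ℝ} {s : Finset ι} {g : ι → Zd d → ℝ}
    (hg : ∀ k ∈ s, (g k).support.Finite) (h : ∀ x, (∀ k ∈ s, g k x = 0) → f x = 0) :
    f.support.Finite := by
  refine (Set.Finite.biUnion s.finite_toSet hg).subset fun x hx => ?_
  by_contra hx'
  simp only [Finset.mem_coe, Set.mem_iUnion, Function.mem_support, exists_prop, not_exists,
    not_and, not_not] at hx'
  exact hx (h x hx')

end FiniteSupport

namespace CycleData

section Lattice

variable {d K : ℕ}

/-- The periodic enumeration of the points of a cycle. -/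
def cyc {Ω : Type*} (D : CycleData d K Ω) (i : Fin K) (j : ℕ) : Zd d := D.z i (j % D.n i)

/-- The mean of an edge function for the stationary chain on the lattice. -/
def edge (D : CycleData d K (Zd d)) (Φ : Zd d → Zd d → ℝ) : ℝ :=
  ∫ x, D.M x * ∑ v ∈ D.jumps, D.p v x * Φ x (v + x) ∂Measure.count

/-- Edge functions with finitely many nonzero values. -/
def FinEdge (Φ : Zd d → Zd d → ℝ) : Prop := ∀ v, (fun x => Φ x (v + x)).support.Finite

/-- The adjoint of the transition operator with respect to the invariant measure. -/
def adj (D : CycleData d K (Zd d)) (f : Zd d → ℝ) (y : Zd d) : ℝ :=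
  (D.M y)⁻¹ * ∑ i, ∑ j ∈ Finset.range (D.n i),
    D.W i (-D.z i (j + 1) + y) * f (D.z i j + (-D.z i (j + 1) + y))

/-- The density of the walk started at the origin. -/
def dens (D : CycleData d K (Zd d)) (m : ℕ) : Zd d → ℝ :=
  (D.adj)^[m] fun y => if y = 0 then (D.M 0)⁻¹ else 0

/-- The weighted second moment of the density. -/
def densSq (D : CycleData d K (Zd d)) (w : Zd d → ℝ) (m : ℕ) : ℝ :=
  ∫ x, D.M x * (D.dens m x ^ 2 * w x) ∂Measure.count

lemma finEdge_left {f : Zd d → ℝ} (hf : f.support.Finite) (g : Zd d → Zd d → ℝ) :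
    FinEdge fun x y => f x * g x y := fun _ => finite_support_mul_right hf _

lemma finEdge_of_imp {f g : Zd d → ℝ} (hf : f.support.Finite) (hg : g.support.Finite)
    {Φ : Zd d → Zd d → ℝ} (h : ∀ x y, f x = 0 → g y = 0 → Φ x y = 0) : FinEdge Φ := by
  intro v
  refine (hf.union (finite_support_translate hg v)).subset fun x hx => ?_
  by_contra hx'
  simp only [Set.mem_union, Function.mem_support, not_or, not_not] at hx'
  exact hx (h _ _ hx'.1 hx'.2)

lemma FinEdge.sum {ι : Type*} {s : Finset ι} {Φ : ι → Zd d → Zd d → ℝ}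
    (h : ∀ k ∈ s, FinEdge (Φ k)) : FinEdge fun x y => ∑ k ∈ s, Φ k x y :=
  fun v => finite_support_of_imp (s := s) (fun k hk => h k hk v) fun _ hx =>
    Finset.sum_eq_zero hx

lemma FinEdge.const_mul {Φ : Zd d → Zd d → ℝ} (h : FinEdge Φ) (a : ℝ) :
    FinEdge fun x y => a * Φ x y := fun v => (h v).subset fun x hx => by
  simp only [Function.mem_support] at hx ⊢
  exact right_ne_zero_of_mul hx

lemma FinEdge.add {Φ Ψ : Zd d → Zd d → ℝ} (h : FinEdge Φ) (h' : FinEdge Ψ) :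
    FinEdge fun x y => Φ x y + Ψ x y := fun v => ((h v).union (h' v)).subset
  (Function.support_add _ _)

end Lattice

namespace Admissible

variable {d K : ℕ} {D : CycleData d K (Zd d)} {c C ε : ℝ} {N : ℕ}

lemma cyc_periodic (D : CycleData d K (Zd d)) (i : Fin K) (j : ℕ) :
    D.cyc i (j + D.n i) = D.cyc i j := by
  simp [cyc]

lemma cyc_of_lt (D : CycleData d K (Zd d)) {i : Fin K} {j : ℕ} (hj : j < D.n i) :
    D.cyc i j = D.z i j := by
  rw [cyc, Nat.mod_eq_of_lt hj]

lemma cyc_succ_of_lt (h : D.Admissible Measure.count c C ε N) {i : Fin K} {j : ℕ}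
    (hj : j < D.n i) : D.cyc i (j + 1) = D.z i (j + 1) := by
  rcases Nat.lt_or_ge (j + 1) (D.n i) with h1 | h1
  · exact cyc_of_lt D h1
  · have h2 : j + 1 = D.n i := by omega
    rw [cyc, h2, Nat.mod_self, h.closed]

lemma edge_eq (h : D.Admissible Measure.count c C ε N) (hT : ∀ x y, D.T x y = x + y)
    {Φ : Zd d → Zd d → ℝ} (hΦ : FinEdge Φ) :
    D.edge Φ = ∑ i, ∫ x, D.W i x *
      ∑ j ∈ Finset.range (D.n i), Φ (D.cyc i j + x) (D.cyc i (j + 1) + x) ∂Measure.count := by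
  rw [edge, h.integral_M_mul_sum (F := fun v x => Φ x (v + x))
    (fun v _ => integrable_count_of_finite (hΦ v))]
  refine Finset.sum_congr rfl fun i _ => ?_
  simp_rw [Finset.mul_sum]
  rw [integral_finsetSum]
  · refine Finset.sum_congr rfl fun j hj => ?_
    rw [Finset.mem_range] at hj
    rw [cyc_of_lt D hj, h.cyc_succ_of_lt hj]
    simp only [hT, ← add_assoc, sub_add_cancel]
  · intro j _
    refine h.integrable_W_mul (integrable_count_of_finite ?_) i
    have := finite_support_translate (hΦ (D.cyc i (j + 1) - D.cyc i j)) (D.cyc i j)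
    simpa only [← add_assoc, sub_add_cancel] using this

lemma finEdge_cycle_integrable (h : D.Admissible Measure.count c C ε N)
    {Φ : Zd d → Zd d → ℝ} (hΦ : FinEdge Φ) (i : Fin K) :
    Integrable (fun x => D.W i x *
      ∑ j ∈ Finset.range (D.n i), Φ (D.cyc i j + x) (D.cyc i (j + 1) + x)) Measure.count := by
  refine h.integrable_W_mul (integrable_finsetSum _ fun j _ => integrable_count_of_finite ?_) i
  have := finite_support_translate (hΦ (D.cyc i (j + 1) - D.cyc i j)) (D.cyc i j)
  simpa only [← add_assoc, sub_add_cancel] using this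

lemma edge_mono (h : D.Admissible Measure.count c C ε N) (hT : ∀ x y, D.T x y = x + y)
    {Φ Ψ : Zd d → Zd d → ℝ} (hΦ : FinEdge Φ) (hΨ : FinEdge Ψ)
    (hle : ∀ i x, ∑ j ∈ Finset.range (D.n i), Φ (D.cyc i j + x) (D.cyc i (j + 1) + x) ≤
      ∑ j ∈ Finset.range (D.n i), Ψ (D.cyc i j + x) (D.cyc i (j + 1) + x)) :
    D.edge Φ ≤ D.edge Ψ := by
  rw [h.edge_eq hT hΦ, h.edge_eq hT hΨ]
  refine Finset.sum_le_sum fun i _ => integral_mono (h.finEdge_cycle_integrable hΦ i)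
    (h.finEdge_cycle_integrable hΨ i) fun x => ?_
  exact mul_le_mul_of_nonneg_left (hle i x) (h.W_nonneg i x)

lemma edge_integrable (h : D.Admissible Measure.count c C ε N) {Φ : Zd d → Zd d → ℝ}
    (hΦ : FinEdge Φ) :
    Integrable (fun x => D.M x * ∑ v ∈ D.jumps, D.p v x * Φ x (v + x)) Measure.count :=
  h.integrable_M_mul (integrable_finsetSum _ fun v _ =>
    h.integrable_p_mul (integrable_count_of_finite (hΦ v)) v)

lemma edge_add (h : D.Admissible Measure.count c C ε N) {Φ Ψ : Zd d → Zd d → ℝ}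
    (hΦ : FinEdge Φ) (hΨ : FinEdge Ψ) :
    D.edge (fun x y => Φ x y + Ψ x y) = D.edge Φ + D.edge Ψ := by
  rw [edge, edge, edge, ← integral_add (h.edge_integrable hΦ) (h.edge_integrable hΨ)]
  simp only [mul_add, Finset.sum_add_distrib]

lemma edge_const_mul (a : ℝ) (Φ : Zd d → Zd d → ℝ) :
    D.edge (fun x y => a * Φ x y) = a * D.edge Φ := by
  rw [edge, edge, ← integral_const_mul]
  simp only [Finset.mul_sum]
  congr 1
  funext x
  exact Finset.sum_congr rfl fun v _ => by ring

lemma edge_sum (h : D.Admissible Measure.count c C ε N) {ι : Type*} {s : Finset ι}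
    {Φ : ι → Zd d → Zd d → ℝ} (hΦ : ∀ k ∈ s, FinEdge (Φ k)) :
    D.edge (fun x y => ∑ k ∈ s, Φ k x y) = ∑ k ∈ s, D.edge (Φ k) := by
  unfold edge
  rw [← integral_finsetSum _ fun k hk => h.edge_integrable (hΦ k hk)]
  congr 1
  funext x
  simp only [Finset.mul_sum]
  rw [Finset.sum_comm]

lemma edge_left (h : D.Admissible Measure.count c C ε N) (f : Zd d → ℝ) :
    D.edge (fun x _ => f x) = ∫ x, D.M x * f x ∂Measure.count := by
  simp only [edge, ← Finset.sum_mul, h.sum_p, one_mul]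

lemma edge_right (h : D.Admissible Measure.count c C ε N) (hT : ∀ x y, D.T x y = x + y)
    {f : Zd d → ℝ} (hf : f.support.Finite) :
    D.edge (fun _ y => f y) = ∫ x, D.M x * f x ∂Measure.count := by
  rw [← h.integral_M_mul_avg (integrable_count_of_finite hf)]
  simp only [edge, avg, hT, smul_eq_mul]

lemma adj_finite (f : Zd d → ℝ) (hf : f.support.Finite) : (D.adj f).support.Finite := by
  refine finite_support_of_imp (s := Finset.univ)
    (g := fun i x => ∑ j ∈ Finset.range (D.n i), |f (D.z i j + (-D.z i (j + 1) + x))|)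
    (fun i _ => finite_support_of_imp (s := Finset.range (D.n i))
      (g := fun j x => f ((D.z i j + -D.z i (j + 1)) + x))
      (fun j _ => finite_support_translate hf _) fun x hx => ?_) fun x hx => ?_
  · refine Finset.sum_eq_zero fun j hj => ?_
    rw [← add_assoc, hx j hj, abs_zero]
  · rw [adj, Finset.sum_eq_zero, mul_zero]
    intro i hi
    refine Finset.sum_eq_zero fun j hj => ?_
    have := (Finset.sum_eq_zero_iff_of_nonneg fun _ _ => abs_nonneg _).1 (hx i hi) j hj
    rw [abs_eq_zero.1 this, mul_zero]

lemma adj_nonneg (h : D.Admissible Measure.count c C ε N) {f : Zd d → ℝ} (hf : ∀ x, 0 ≤ f x)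
    (x : Zd d) : 0 ≤ D.adj f x :=
  mul_nonneg (inv_nonneg.2 (h.M_pos x).le) (Finset.sum_nonneg fun i _ =>
    Finset.sum_nonneg fun _ _ => mul_nonneg (h.W_nonneg i _) (hf _))

lemma integral_M_mul_adj (h : D.Admissible Measure.count c C ε N) (hT : ∀ x y, D.T x y = x + y)
    {f : Zd d → ℝ} (hf : f.support.Finite) (g : Zd d → ℝ) :
    ∫ x, D.M x * (D.adj f x * g x) ∂Measure.count = D.edge fun x y => f x * g y := by
  rw [edge, h.integral_M_mul_sum (F := fun v x => f x * g (v + x))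
    (fun v _ => integrable_count_of_finite (finEdge_left hf (fun _ y => g y) v))]
  have h1 : ∀ x, D.M x * (D.adj f x * g x) = ∑ i, ∑ j ∈ Finset.range (D.n i),
      (fun y => D.W i y * (f (D.z i j + y) * g (D.z i (j + 1) + y))) (D.T (-D.z i (j + 1)) x) := by
    intro x
    rw [adj, ← mul_assoc, mul_inv_cancel_left₀ (h.M_pos x).ne', Finset.sum_mul]
    refine Finset.sum_congr rfl fun i _ => ?_
    rw [Finset.sum_mul]
    refine Finset.sum_congr rfl fun j _ => ?_
    simp only [hT, add_neg_cancel_left, mul_assoc]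
  have h2 : ∀ i j, Integrable (fun y => D.W i y * (f (D.z i j + y) * g (D.z i (j + 1) + y)))
      Measure.count := fun i j => h.integrable_W_mul (integrable_count_of_finite
        (finite_support_mul_right (finite_support_translate hf _) _)) i
  simp_rw [h1]
  rw [integral_finsetSum _ fun i _ => integrable_finsetSum _ fun j _ =>
    h.integrable_comp (h2 i j) _]
  refine Finset.sum_congr rfl fun i _ => ?_
  rw [integral_finsetSum _ fun j _ => h.integrable_comp (h2 i j) _]
  refine Finset.sum_congr rfl fun j _ => ?_
  rw [h.integral_comp (fun y => D.W i y * (f (D.z i j + y) * g (D.z i (j + 1) + y)))]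
  simp only [hT, ← add_assoc, sub_add_cancel]

lemma dens_succ (m : ℕ) : D.dens (m + 1) = D.adj (D.dens m) := by
  rw [dens, Function.iterate_succ_apply']
  rfl

lemma dens_finite (m : ℕ) : (D.dens m).support.Finite := by
  induction m with
  | zero =>
    refine (Set.finite_singleton (0 : Zd d)).subset fun x hx => ?_
    by_contra hx'
    simp only [Set.mem_singleton_iff] at hx'
    simp [dens, hx'] at hx
  | succ m ih => rw [dens_succ]; exact adj_finite _ ih

lemma dens_nonneg (h : D.Admissible Measure.count c C ε N) (m : ℕ) (x : Zd d) :
    0 ≤ D.dens m x := by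
  induction m generalizing x with
  | zero =>
    simp only [dens, Function.iterate_zero, id]
    split_ifs
    · exact inv_nonneg.2 (h.M_pos 0).le
    · exact le_rfl
  | succ m ih => rw [dens_succ]; exact h.adj_nonneg ih x

lemma integral_M_mul_dens (h : D.Admissible Measure.count c C ε N)
    (hT : ∀ x y, D.T x y = x + y) (m : ℕ) (g : Zd d → ℝ) :
    ∫ x, D.M x * (D.dens m x * g x) ∂Measure.count = D.avg^[m] g 0 := by
  induction m generalizing g with
  | zero =>
    rw [integral_count_eq_sum (s := {0})]
    · simp [dens, mul_inv_cancel_left₀ (h.M_pos 0).ne']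
    · intro x hx
      simp only [Finset.mem_singleton] at hx
      simp [dens, hx]
  | succ m ih =>
    rw [dens_succ, h.integral_M_mul_adj hT (dens_finite m), Function.iterate_succ_apply, ← ih]
    simp only [edge, avg, smul_eq_mul, Finset.mul_sum, hT]
    congr 1
    funext x
    exact Finset.sum_congr rfl fun v _ => by ring

lemma dens_sq_finite (m : ℕ) (w : Zd d → ℝ) : (fun x => D.dens m x ^ 2 * w x).support.Finite :=
  finite_support_mul_right ((dens_finite m).subset fun x hx => by
    simp only [Function.mem_support] at hx ⊢
    exact fun h0 => hx (by rw [h0]; norm_num)) w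

lemma finEdge_dissipation (m : ℕ) (w : Zd d → ℝ) :
    FinEdge fun x y => (D.dens m x - D.dens (m + 1) y) ^ 2 * w y :=
  finEdge_of_imp (dens_finite m) (dens_finite (m + 1)) fun x y hx hy => by rw [hx, hy]; ring

lemma dissipation_eq (h : D.Admissible Measure.count c C ε N) (hT : ∀ x y, D.T x y = x + y)
    (m : ℕ) (w : Zd d → ℝ) :
    D.edge (fun x y => (D.dens m x - D.dens (m + 1) y) ^ 2 * w y) =
      D.densSq w m + D.edge (fun x y => D.dens m x ^ 2 * (w y - w x)) - D.densSq w (m + 1) := by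
  have e1 : FinEdge fun x y => D.dens m x ^ 2 * (w y - w x) := fun v =>
    dens_sq_finite m fun x => w (v + x) - w x
  have e2 : FinEdge fun x _ : Zd d => D.dens m x ^ 2 * w x := fun _ => dens_sq_finite m w
  have e3 : FinEdge fun x y => D.dens m x * (D.dens (m + 1) y * w y) :=
    finEdge_left (dens_finite m) fun _ y => D.dens (m + 1) y * w y
  have e4 : FinEdge fun _ y : Zd d => D.dens (m + 1) y ^ 2 * w y := fun v =>
    finite_support_translate (dens_sq_finite (m + 1) w) v
  have h1 : (fun x y => (D.dens m x - D.dens (m + 1) y) ^ 2 * w y) = fun x y =>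
      ((D.dens m x ^ 2 * (w y - w x) + D.dens m x ^ 2 * w x) +
        (-2) * (D.dens m x * (D.dens (m + 1) y * w y))) + D.dens (m + 1) y ^ 2 * w y := by
    funext x y
    ring
  rw [h1, h.edge_add ((e1.add e2).add (e3.const_mul _)) e4, h.edge_add (e1.add e2) (e3.const_mul _),
    h.edge_add e1 e2, edge_const_mul, h.edge_left fun x => D.dens m x ^ 2 * w x,
    h.edge_right hT (dens_sq_finite (m + 1) w),
    ← h.integral_M_mul_adj hT (dens_finite m) (fun y => D.dens (m + 1) y * w y)]
  have h2 : ∫ x, D.M x * (D.adj (D.dens m) x * (D.dens (m + 1) x * w x)) ∂Measure.count =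
      D.densSq w (m + 1) := by
    rw [densSq, dens_succ]
    congr 1
    funext x
    ring
  rw [h2]
  simp only [densSq]
  ring

lemma densSq_one_antitone (h : D.Admissible Measure.count c C ε N)
    (hT : ∀ x y, D.T x y = x + y) : Antitone (D.densSq fun _ => 1) := by
  refine antitone_nat_of_succ_le fun m => ?_
  have h1 := h.dissipation_eq hT m fun _ => 1
  have h2 : 0 ≤ D.edge (fun x y => (D.dens m x - D.dens (m + 1) y) ^ 2 * 1) := by
    refine integral_nonneg fun x => mul_nonneg (h.M_pos x).le (Finset.sum_nonneg fun v _ =>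
      mul_nonneg (h.p_nonneg v x) (by positivity))
  have h3 : D.edge (fun x y => D.dens m x ^ 2 * ((1 : ℝ) - 1)) = 0 := by simp [edge]
  rw [h3] at h1
  linarith

lemma edge_grad_le (h : D.Admissible Measure.count c C ε N) (hT : ∀ x y, D.T x y = x + y)
    {L : ℕ} (hL : ∀ i, D.n i ∣ L) (m : ℕ) :
    D.edge (fun x y => (∑ k ∈ Finset.range L, D.dens (m + k) y -
        ∑ k ∈ Finset.range L, D.dens (m + k) x) ^ 2) ≤
      4 * L * (D.densSq (fun _ => 1) m - D.densSq (fun _ => 1) (m + L)) := by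
  have hf : (fun x => ∑ k ∈ Finset.range L, D.dens (m + k) x).support.Finite :=
    finite_support_of_imp (s := Finset.range L) (g := fun k => D.dens (m + k))
      (fun k _ => dens_finite _) fun x hx => Finset.sum_eq_zero hx
  have h1 : D.edge (fun x y => (∑ k ∈ Finset.range L, D.dens (m + k) y -
        ∑ k ∈ Finset.range L, D.dens (m + k) x) ^ 2) ≤
      D.edge (fun x y => 4 * L * ∑ k ∈ Finset.range L,
        (D.dens (m + k) x - D.dens (m + k + 1) y) ^ 2 * 1) := by
    refine h.edge_mono hT (finEdge_of_imp hf hf fun x y hx hy => by rw [hx, hy]; ring)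
      ((FinEdge.sum fun k _ => finEdge_dissipation (m + k) fun _ => 1).const_mul _) fun i x => ?_
    refine (cycle_sq_diff_le (n := D.n i) (a := fun k j => D.dens (m + k) (D.cyc i j + x))
      (fun k j => by simp only [cyc_periodic]) (hL i)).trans (le_of_eq ?_)
    rw [← Finset.mul_sum, Finset.sum_comm]
    simp only [mul_one, add_assoc]
  refine h1.trans (le_of_eq ?_)
  rw [edge_const_mul, h.edge_sum fun k _ => finEdge_dissipation (m + k) fun _ => 1]
  congr 1
  simp only [h.dissipation_eq hT]
  have h3 : ∀ m, D.edge (fun x y => D.dens m x ^ 2 * ((1 : ℝ) - 1)) = 0 := by simp [edge]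
  simp only [h3, add_zero]
  exact Finset.sum_range_sub' (fun k => D.densSq (fun _ => 1) (m + k)) L

lemma densSq_weighted_le (h : D.Admissible Measure.count c C ε N) (hT : ∀ x y, D.T x y = x + y)
    {L : ℕ} (hL : ∀ i, D.n i ∣ L) (hL0 : 0 < L) {w w' : Zd d → ℝ} (hw : ∀ x, 0 < w x)
    (hw' : ∀ x, 0 ≤ w' x) {κ : ℝ} (hκ0 : 0 ≤ κ)
    (hκ : ∀ i x j j' k, (w (D.cyc i j' + x) - w (D.cyc i j + x)) ^ 2 ≤
      κ * (w (D.cyc i k + x) * w' (D.cyc i k + x)))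
    (hκ' : ∀ i x j j' k, (w (D.cyc i j' + x) - w (D.cyc i j + x)) ^ 2 ≤
      κ * (w (D.cyc i (k + 1) + x) * w' (D.cyc i k + x))) (m : ℕ) :
    D.densSq w (m + L) ≤ D.densSq w m +
      4 * L ^ 2 * κ * ∑ k ∈ Finset.range (L + 1), D.densSq w' (m + k) := by
  have hfe : ∀ k, FinEdge fun x y => D.dens (m + k) x ^ 2 * (w y - w x) := fun k v =>
    dens_sq_finite (m + k) fun x => w (v + x) - w x
  have hfw : ∀ k, FinEdge fun x _ : Zd d => D.dens (m + k) x ^ 2 * w' x :=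
    fun k _ => dens_sq_finite (m + k) w'
  have h1 : D.edge (fun x y => ∑ k ∈ Finset.range L, D.dens (m + k) x ^ 2 * (w y - w x)) ≤
      D.edge (fun x y => (∑ k ∈ Finset.range L,
        (D.dens (m + k) x - D.dens (m + k + 1) y) ^ 2 * w y) +
        4 * L ^ 2 * κ * ∑ k ∈ Finset.range (L + 1), D.dens (m + k) x ^ 2 * w' x) := by
    refine h.edge_mono hT (FinEdge.sum fun k _ => hfe k)
      ((FinEdge.sum fun k _ => finEdge_dissipation (m + k) w).add
        ((FinEdge.sum fun k _ => hfw k).const_mul _)) fun i x => ?_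
    have h2 := cycle_weighted_le (n := D.n i) (a := fun k j => D.dens (m + k) (D.cyc i j + x))
      (fun k j => by simp only [cyc_periodic]) (hL i) (h.len_pos i)
      (w := fun j => w (D.cyc i j + x)) (w' := fun j => w' (D.cyc i j + x))
      (fun j => by simp only [cyc_periodic]) (fun j => by simp only [cyc_periodic])
      (fun j => hw _) (fun j => hw' _) hκ0 (fun j j' => hκ' i x _ _ _)
      (fun j j' => hκ i x _ _ _)
    have hnL : (D.n i : ℝ) ≤ L := by exact_mod_cast Nat.le_of_dvd hL0 (hL i)
    simp only [Finset.sum_add_distrib, Finset.sum_mul] at h2 ⊢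
    refine h2.trans (add_le_add (le_of_eq (by rw [Finset.sum_comm]; simp only [add_assoc])) ?_)
    rw [← Finset.mul_sum, Finset.sum_comm]
    refine mul_le_mul_of_nonneg_right ?_ (Finset.sum_nonneg fun j _ =>
      Finset.sum_nonneg fun k _ => mul_nonneg (sq_nonneg _) (hw' _))
    gcongr
  rw [h.edge_sum fun k _ => hfe k, h.edge_add (FinEdge.sum fun k _ => finEdge_dissipation (m + k) w)
        ((FinEdge.sum fun k _ => hfw k).const_mul _), edge_const_mul,
        h.edge_sum fun k _ => finEdge_dissipation (m + k) w, h.edge_sum fun k _ => hfw k] at h1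
  simp only [h.dissipation_eq hT, h.edge_left] at h1
  have h3 := Finset.sum_range_sub' (fun k => D.densSq w (m + k)) L
  simp only [Finset.sum_sub_distrib, Finset.sum_add_distrib, ← add_assoc, add_zero] at h1 h3
  simp only [densSq] at h1 h3 ⊢
  linarith

end Admissible
end CycleData

/-! ### A Nash inequality by averaging over translations -/

section Nash

variable {d : ℕ}

lemma integral_count_translate (f : Zd d → ℝ) (v : Zd d) :
    ∫ x, f (v + x) ∂Measure.count = ∫ x, f x ∂Measure.count :=
  integral_add_left_eq_self f v

/-- The squared `ℓ²` distance between a function and its translate. -/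
def transDiff (f : Zd d → ℝ) (y : Zd d) : ℝ := ∫ x, (f (y + x) - f x) ^ 2 ∂Measure.count

lemma finite_support_diff {f : Zd d → ℝ} (hf : f.support.Finite) (y z : Zd d) :
    (fun x => (f (y + x) - f (z + x)) ^ 2).support.Finite :=
  ((finite_support_translate hf y).union (finite_support_translate hf z)).subset fun x hx => by
    by_contra hx'
    simp only [Set.mem_union, Function.mem_support, not_or, not_not] at hx'
    simp [hx'.1, hx'.2] at hx

lemma finite_support_transDiff {f : Zd d → ℝ} (hf : f.support.Finite) (y : Zd d) :
    (fun x => (f (y + x) - f x) ^ 2).support.Finite := by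
  simpa using finite_support_diff hf y 0

lemma transDiff_add_le {f : Zd d → ℝ} (hf : f.support.Finite) {y z : Zd d} {A B : ℝ}
    (hA : 0 < A) (hB : 0 < B) (hy : transDiff f y ≤ A ^ 2) (hz : transDiff f z ≤ B ^ 2) :
    transDiff f (y + z) ≤ (A + B) ^ 2 := by
  have h1 : ∀ x, (f (y + z + x) - f x) ^ 2 ≤ (1 + B / A) * (f (y + (z + x)) - f (z + x)) ^ 2 +
      (1 + A / B) * (f (z + x) - f x) ^ 2 := by
    intro x
    rw [add_assoc]
    set a := f (y + (z + x)) - f (z + x)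
    set b := f (z + x) - f x
    have h2 : f (y + (z + x)) - f x = a + b := by simp [a, b]
    have h3 : (1 + B / A) * a ^ 2 + (1 + A / B) * b ^ 2 - (a + b) ^ 2 =
        (B * a - A * b) ^ 2 / (A * B) := by
      field_simp
      ring
    rw [h2]
    have h4 : 0 ≤ (B * a - A * b) ^ 2 / (A * B) := by positivity
    linarith
  have i1 : Integrable (fun x => (f (y + (z + x)) - f (z + x)) ^ 2) Measure.count := by
    have := finite_support_diff hf (y + z) z
    simp only [add_assoc] at this
    exact integrable_count_of_finite this
  have i2 := integrable_count_of_finite (finite_support_transDiff hf z)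
  have h5 : transDiff f (y + z) ≤ (1 + B / A) * transDiff f y + (1 + A / B) * transDiff f z := by
    rw [transDiff, transDiff, ← integral_count_translate (fun x => (f (y + x) - f x) ^ 2) z,
      transDiff, ← integral_const_mul, ← integral_const_mul,
      ← integral_add (i1.const_mul _) (i2.const_mul _)]
    exact integral_mono (integrable_count_of_finite (finite_support_transDiff hf _))
      ((i1.const_mul _).add (i2.const_mul _)) h1
  refine h5.trans ((add_le_add (mul_le_mul_of_nonneg_left hy (by positivity))
    (mul_le_mul_of_nonneg_left hz (by positivity))).trans (le_of_eq ?_))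
  field_simp
  ring

lemma transDiff_le {f : Zd d → ℝ} (hf : f.support.Finite) {E : ℝ} (hE : 0 < E)
    (h : ∀ i, transDiff f (Pi.single i 1) ≤ E ^ 2) (y : Fin d → ℕ) :
    transDiff f (fun i => (y i : ℤ)) ≤ ((1 + ∑ i, (y i : ℝ)) * E) ^ 2 := by
  have key : ∀ s : Finset (Fin d), transDiff f (∑ i ∈ s, Pi.single i (y i : ℤ)) ≤
      ((1 + ∑ i ∈ s, (y i : ℝ)) * E) ^ 2 := by
    intro s
    induction s using Finset.induction_on with
    | empty => simpa [transDiff] using sq_nonneg E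
    | insert a s ha ih =>
      rw [Finset.sum_insert ha, Finset.sum_insert ha]
      generalize y a = k
      have hs : 0 ≤ ∑ i ∈ s, (y i : ℝ) := Finset.sum_nonneg fun _ _ => Nat.cast_nonneg _
      induction k with
      | zero => simpa using ih
      | succ k ihk =>
        have e1 : (Pi.single a ((k + 1 : ℕ) : ℤ) : Zd d) + ∑ i ∈ s, Pi.single i (y i : ℤ) =
            Pi.single a 1 + (Pi.single a (k : ℤ) + ∑ i ∈ s, Pi.single i (y i : ℤ)) := by
          rw [← add_assoc, ← Pi.single_add]
          push_cast
          rw [add_comm (1 : ℤ)]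
        rw [e1]
        refine (transDiff_add_le hf hE (by positivity) (h a) ihk).trans (le_of_eq ?_)
        push_cast
        ring
  have h2 := key Finset.univ
  rwa [Finset.univ_sum_single] at h2

lemma nash_pos {f : Zd d → ℝ} (hf : f.support.Finite) (hf0 : ∀ x, 0 ≤ f x) {S : ℝ} (hS : 0 < S)
    (h : ∀ i, transDiff f (Pi.single i 1) ≤ S) {r : ℕ} (hr : 0 < r) :
    ∫ x, f x ^ 2 ∂Measure.count ≤ 2 * (1 + d * r) ^ 2 * S +
      2 * (∫ x, f x ∂Measure.count) ^ 2 / r ^ d := by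
  set Y : Finset (Fin d → ℕ) := Fintype.piFinset fun _ => Finset.range r with hY
  have hcard : (Y.card : ℝ) = (r : ℝ) ^ d := by
    rw [hY, Fintype.card_piFinset]
    simp
  have hr' : (0 : ℝ) < (r : ℝ) ^ d := by positivity
  set ι : (Fin d → ℕ) → Zd d := fun y i => (y i : ℤ) with hι
  set A : Zd d → ℝ := fun x => ((r : ℝ) ^ d)⁻¹ * ∑ y ∈ Y, f (ι y + x) with hA
  set I := ∫ x, f x ∂Measure.count with hI
  have hfi := integrable_count_of_finite hf
  have hI0 : 0 ≤ I := integral_nonneg hf0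
  have hft : ∀ y : Zd d, Integrable (fun x => f (y + x)) Measure.count := fun y =>
    integrable_count_of_finite (finite_support_translate hf y)
  have hAi : Integrable A Measure.count := (integrable_finsetSum _ fun y _ => hft _).const_mul _
  have hAint : ∫ x, A x ∂Measure.count = I := by
    rw [hA, integral_const_mul, integral_finsetSum _ fun y _ => hft _]
    simp only [integral_count_translate, ← hI]
    rw [Finset.sum_const, nsmul_eq_mul, hcard, inv_mul_cancel_left₀ hr'.ne']
  have hA0 : ∀ x, 0 ≤ A x := fun x => mul_nonneg (by positivity)
    (Finset.sum_nonneg fun y _ => hf0 _)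
  have hAle : ∀ x, A x ≤ I / r ^ d := by
    intro x
    rw [hA, div_eq_inv_mul]
    refine mul_le_mul_of_nonneg_left ?_ (by positivity)
    have h1 : ∑ y ∈ Y, f (ι y + x) = ∑ u ∈ Y.image fun y => ι y + x, f u := by
      rw [Finset.sum_image]
      intro y _ y' _ hyy
      funext i
      have := congrFun hyy i
      simpa [hι] using this
    rw [h1, hI, integral_count_eq_sum (s := hf.toFinset ∪ Y.image fun y => ι y + x)]
    · exact Finset.sum_le_sum_of_subset_of_nonneg Finset.subset_union_right fun _ _ _ => hf0 _
    · intro u hu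
      by_contra h0
      exact hu (Finset.mem_union_left _ (by simpa using h0))
  have hAsq : ∀ x, A x ^ 2 ≤ I / r ^ d * A x := fun x => by
    rw [sq]
    exact mul_le_mul_of_nonneg_right (hAle x) (hA0 x)
  have hdiff : ∀ x, (f x - A x) ^ 2 ≤ ((r : ℝ) ^ d)⁻¹ * ∑ y ∈ Y, (f (ι y + x) - f x) ^ 2 := by
    intro x
    have h1 : f x - A x = ((r : ℝ) ^ d)⁻¹ * ∑ y ∈ Y, (f x - f (ι y + x)) := by
      rw [Finset.sum_sub_distrib, Finset.sum_const, nsmul_eq_mul, hcard, mul_sub,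
        inv_mul_cancel_left₀ hr'.ne']
    have h2 : (∑ y ∈ Y, (f x - f (ι y + x))) ^ 2 ≤
        (r : ℝ) ^ d * ∑ y ∈ Y, (f (ι y + x) - f x) ^ 2 := by
      have := sq_sum_le_card_mul_sum_sq (s := Y) (f := fun y => f x - f (ι y + x))
      rw [hcard] at this
      refine this.trans (le_of_eq ?_)
      congr 1
      exact Finset.sum_congr rfl fun y _ => by ring
    rw [h1, mul_pow]
    calc (((r : ℝ) ^ d)⁻¹) ^ 2 * (∑ y ∈ Y, (f x - f (ι y + x))) ^ 2
        ≤ (((r : ℝ) ^ d)⁻¹) ^ 2 * ((r : ℝ) ^ d * ∑ y ∈ Y, (f (ι y + x) - f x) ^ 2) :=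
          mul_le_mul_of_nonneg_left h2 (by positivity)
      _ = _ := by field_simp
  have hti : ∀ y, Integrable (fun x => (f (y + x) - f x) ^ 2) Measure.count := fun y =>
    integrable_count_of_finite (finite_support_transDiff hf y)
  have hpt : ∀ x, f x ^ 2 ≤ 2 * (((r : ℝ) ^ d)⁻¹ * ∑ y ∈ Y, (f (ι y + x) - f x) ^ 2) +
      2 * (I / r ^ d * A x) := by
    intro x
    nlinarith [hdiff x, hAsq x, sq_nonneg (f x - 2 * A x)]
  have hE : ∀ i, transDiff f (Pi.single i 1) ≤ √S ^ 2 := fun i => by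
    rw [Real.sq_sqrt hS.le]
    exact h i
  have hY2 : ∀ y ∈ Y, transDiff f (ι y) ≤ (1 + d * r) ^ 2 * S := by
    intro y hy
    refine (transDiff_le hf (Real.sqrt_pos.2 hS) hE y).trans ?_
    rw [mul_pow, Real.sq_sqrt hS.le]
    have h1 : ∑ i, (y i : ℝ) ≤ d * r := by
      have := Finset.sum_le_card_nsmul Finset.univ (fun i => (y i : ℝ)) r fun i _ => by
        have := Fintype.mem_piFinset.1 hy i
        exact_mod_cast (Finset.mem_range.1 this).le
      simpa using this
    have h0 : 0 ≤ ∑ i, (y i : ℝ) := Finset.sum_nonneg fun _ _ => Nat.cast_nonneg _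
    gcongr
  have i1 := ((integrable_finsetSum Y fun y _ => hti (ι y)).const_mul ((r : ℝ) ^ d)⁻¹).const_mul 2
  have i2 := (hAi.const_mul (I / r ^ d)).const_mul 2
  have hfsq : Integrable (fun x => f x ^ 2) Measure.count := by
    simp only [sq]
    exact integrable_count_of_finite (finite_support_mul_right hf _)
  refine (integral_mono hfsq (i1.add i2) hpt).trans ?_
  simp only [Pi.add_apply]
  rw [integral_add i1 i2]
  refine add_le_add ?_ (le_of_eq ?_)
  · rw [integral_const_mul, integral_const_mul, integral_finsetSum Y fun y _ => hti (ι y),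
      mul_assoc]
    refine mul_le_mul_of_nonneg_left ?_ (by norm_num)
    rw [inv_mul_le_iff₀ hr']
    refine (Finset.sum_le_card_nsmul Y _ _ hY2).trans (le_of_eq ?_)
    rw [nsmul_eq_mul, hcard]
  · rw [integral_const_mul, integral_const_mul, hAint]
    ring

/-- A Nash inequality on `ℤ^d`. -/
lemma nash {f : Zd d → ℝ} (hf : f.support.Finite) (hf0 : ∀ x, 0 ≤ f x) {S : ℝ} (hS : 0 ≤ S)
    (h : ∀ i, transDiff f (Pi.single i 1) ≤ S) {r : ℕ} (hr : 0 < r) :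
    ∫ x, f x ^ 2 ∂Measure.count ≤ 2 * (1 + d * r) ^ 2 * S +
      2 * (∫ x, f x ∂Measure.count) ^ 2 / r ^ d := by
  refine le_of_forall_pos_le_add fun δ hδ => ?_
  have h1 : (0 : ℝ) < 2 * (1 + d * r) ^ 2 := by positivity
  have h2 := nash_pos hf hf0 (S := S + δ / (2 * (1 + d * r) ^ 2)) (by positivity)
    (fun i => (h i).trans (le_add_of_nonneg_right (by positivity))) hr
  rw [mul_add, mul_div_cancel₀ _ h1.ne'] at h2
  linarith

end Nash

/-! ### Two elementary recursions -/

/-- Polynomial decay from a discrete Nash-type differential inequality. -/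
lemma decay_of_nash {d L : ℕ} (hL : 0 < L) {a : ℕ → ℝ} (ha : Antitone a) (ha0 : ∀ m, 0 ≤ a m)
    {κ : ℝ} (hκ : ∀ m r : ℕ, 0 < r → a m ≤ κ * (r ^ 2 * (a m - a (m + L)) + 1 / r ^ d)) :
    ∃ B : ℝ, 0 ≤ B ∧ ∀ n, a n * √n ^ d ≤ B := by
  have hκ0 : 0 ≤ κ := by
    by_contra hneg
    push Not at hneg
    have h1 := hκ 0 1 one_pos
    have h2 : a (0 + L) ≤ a 0 := ha (by omega)
    have h3 : 0 < (1 : ℝ) * (a 0 - a (0 + L)) + 1 := by linarith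
    have := mul_neg_of_neg_of_pos hneg h3
    have := ha0 0
    norm_num at h1
    rw [zero_add, one_mul] at *
    linarith
  have hsum : ∀ (m J r : ℕ), 0 < r → J * a (m + J * L) ≤ κ * (r ^ 2 * a m) + J * (κ / r ^ d) := by
    intro m J r hr
    have h1 : ∀ J : ℕ, ∑ j ∈ Finset.range J, a (m + j * L) ≤
        κ * (r ^ 2 * (a m - a (m + J * L))) + J * (κ / r ^ d) := by
      intro J
      induction J with
      | zero => simp
      | succ J ih =>
        rw [Finset.sum_range_succ]
        have h2 := hκ (m + J * L) r hr
        rw [show m + J * L + L = m + (J + 1) * L by ring] at h2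
        push_cast
        have h3 : κ * (1 / (r : ℝ) ^ d) = κ / r ^ d := by ring
        nlinarith
    have h4 : J * a (m + J * L) ≤ ∑ j ∈ Finset.range J, a (m + j * L) := by
      have := Finset.card_nsmul_le_sum (Finset.range J) (fun j => a (m + j * L)) (a (m + J * L))
        fun j hj => ha (by
          have := (Finset.mem_range.1 hj).le
          gcongr)
      simpa using this
    have h5 : κ * (r ^ 2 * (a m - a (m + J * L))) ≤ κ * (r ^ 2 * a m) := by
      have := ha0 (m + J * L)
      gcongr
      linarith
    linarith [h1 J]
  obtain ⟨H, hH⟩ := exists_nat_ge (κ * 2 ^ (d + 1) + 1)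
  have hH0 : (0 : ℝ) < H := lt_of_lt_of_le (by positivity) hH
  have hHn : 0 < H := by exact_mod_cast hH0
  set B := a 0 + κ * 2 ^ (d + 1) with hB
  have hB0 : 0 ≤ B := add_nonneg (ha0 0) (by positivity)
  have hq : ∀ q : ℕ, a (H * L * 4 ^ q) ≤ B / 2 ^ (q * d) := by
    have hq' : ∀ q : ℕ, ∃ n ≤ H * L * 4 ^ q, a n ≤ B / 2 ^ (q * d) := by
      intro q
      induction q with
      | zero => exact ⟨0, Nat.zero_le _, by simp [hB]; positivity⟩
      | succ q ih =>
        obtain ⟨n, hn, han⟩ := ih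
        refine ⟨n + H * 4 ^ q * L, by rw [pow_succ]; nlinarith, ?_⟩
        have h1 := hsum n (H * 4 ^ q) (2 ^ q) (by positivity)
        push_cast at h1
        have e1 : ((2 : ℝ) ^ q) ^ 2 = 4 ^ q := by rw [← pow_mul, mul_comm, pow_mul]; norm_num
        have e2 : ((2 : ℝ) ^ q) ^ d = 2 ^ (q * d) := by rw [← pow_mul]
        rw [e1, e2] at h1
        have e3 : (2 : ℝ) ^ ((q + 1) * d) = 2 ^ (q * d) * 2 ^ d := by
          rw [add_mul, one_mul, pow_add]
        have h4 : (0 : ℝ) < 4 ^ q := by positivity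
        have h2 : (0 : ℝ) < 2 ^ (q * d) := by positivity
        have h3 : H * a (n + H * 4 ^ q * L) ≤ κ * (B / 2 ^ (q * d)) + H * (κ / 2 ^ (q * d)) := by
          have : κ * (4 ^ q * a n) ≤ κ * (4 ^ q * (B / 2 ^ (q * d))) := by gcongr
          have h5 : 4 ^ q * (H * a (n + H * 4 ^ q * L)) ≤
              4 ^ q * (κ * (B / 2 ^ (q * d)) + H * (κ / 2 ^ (q * d))) := by nlinarith
          exact le_of_mul_le_mul_left h5 h4
        rw [e3, le_div_iff₀ (by positivity)]
        have h6 : H * a (n + H * 4 ^ q * L) * 2 ^ (q * d) ≤ κ * B + H * κ := by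
          have := mul_le_mul_of_nonneg_right h3 h2.le
          refine this.trans (le_of_eq ?_)
          field_simp
        have h7 : (2 : ℝ) ^ (d + 1) = 2 * 2 ^ d := by ring
        have hpos : (0 : ℝ) < 2 ^ d := by positivity
        have h8 : H * (a (n + H * 4 ^ q * L) * (2 ^ (q * d) * 2 ^ d)) ≤ H * B := by
          have h9 : κ * 2 ^ (d + 1) * B ≤ H * B := by
            refine mul_le_mul_of_nonneg_right ?_ hB0
            linarith
          have h10 : H * (κ * 2 ^ (d + 1)) ≤ H * B :=
            mul_le_mul_of_nonneg_left (by rw [hB]; linarith [ha0 0]) hH0.le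
          have h11 := mul_le_mul_of_nonneg_right h6 hpos.le
          rw [h7] at h9 h10
          linarith
        exact le_of_mul_le_mul_left h8 hH0
    intro q
    obtain ⟨n, hn, han⟩ := hq' q
    exact (ha hn).trans han
  refine ⟨B * (2 * √(H * L)) ^ d, by positivity, fun n => ?_⟩
  set q := Nat.log 4 (n / (H * L)) with hqdef
  have hHL : 0 < H * L := by positivity
  have hlt : n < H * L * 4 ^ (q + 1) := by
    have := Nat.lt_pow_succ_log_self (b := 4) (by norm_num) (n / (H * L))
    rw [Nat.div_lt_iff_lt_mul hHL] at this
    rw [mul_comm]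
    exact this
  have hsq : √(n : ℝ) ≤ 2 ^ q * (2 * √(H * L)) := by
    rw [Real.sqrt_le_left (by positivity)]
    have : (n : ℝ) ≤ H * L * 4 ^ (q + 1) := by exact_mod_cast hlt.le
    refine this.trans (le_of_eq ?_)
    rw [mul_pow, mul_pow, Real.sq_sqrt (by positivity), ← pow_mul, mul_comm q 2, pow_mul, pow_succ]
    norm_num
    ring
  have haq : a n ≤ B / 2 ^ (q * d) := by
    rcases Nat.lt_or_ge n (H * L) with h1 | h1
    · have hq0 : q = 0 := by rw [hqdef, Nat.div_eq_of_lt h1]; simp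
      rw [hq0]
      have : a n ≤ a 0 := ha (Nat.zero_le n)
      simp only [zero_mul, pow_zero, div_one]
      exact this.trans (by rw [hB]; linarith [show 0 ≤ κ * 2 ^ (d + 1) by positivity])
    · refine (ha ?_).trans (hq q)
      have h2 : n / (H * L) ≠ 0 := (Nat.div_pos h1 hHL).ne'
      have := Nat.pow_log_le_self 4 h2
      rw [Nat.le_div_iff_mul_le hHL] at this
      rw [mul_comm]
      exact this
  calc a n * √n ^ d ≤ B / 2 ^ (q * d) * (2 ^ q * (2 * √(H * L))) ^ d := by
        gcongr
    _ = B * (2 * √(H * L)) ^ d := by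
        rw [mul_pow, ← pow_mul]
        field_simp

/-- Growth of a weighted moment from a recursive inequality. -/
lemma moment_growth {d L : ℕ} (hL : 0 < L) {a U : ℕ → ℝ} (hU0 : ∀ n, 0 ≤ U n)
    {κ B : ℝ} (hκ : 0 ≤ κ) (hB : 0 ≤ B) (ha : ∀ n, a n * √n ^ d ≤ B)
    (h : ∀ (n : ℕ) (s : ℝ), 0 < s → U (n + L) ≤ (1 + κ / s) * U n + κ * s ^ d * a n) :
    ∃ B', 0 ≤ B' ∧ ∀ n, 1 ≤ n → U n ≤ B' * (n * √n ^ d) := by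
  set H := 2 * κ + 1 with hH
  have hH0 : 0 < H := by positivity
  set B' := 2 * (κ * H ^ d * B) + ∑ k ∈ Finset.range (L + 1), U k with hB'
  have hS0 : 0 ≤ ∑ k ∈ Finset.range (L + 1), U k := Finset.sum_nonneg fun k _ => hU0 k
  have hκHB : 0 ≤ κ * H ^ d * B := by positivity
  have hB'0 : 0 ≤ B' := by positivity
  refine ⟨B', hB'0, fun n => ?_⟩
  induction n using Nat.strong_induction_on with
  | _ n ih =>
    intro hn
    have hn1 : (1 : ℝ) ≤ n := by exact_mod_cast hn
    rcases Nat.lt_or_ge L n with hnL | hnL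
    · obtain ⟨m, rfl⟩ : ∃ m, n = m + L := ⟨n - L, by omega⟩
      have hm : 1 ≤ m := by omega
      have hm1 : (1 : ℝ) ≤ m := by exact_mod_cast hm
      have h1 := ih m (by omega) hm
      have h2 := h m (H * m) (by positivity)
      have hφ : (0 : ℝ) < √m ^ d := by positivity
      have h3 : κ * (H * m) ^ d * a m ≤ κ * H ^ d * B * √m ^ d := by
        have e : (m : ℝ) ^ d = √m ^ d * √m ^ d := by
          rw [← mul_pow, Real.mul_self_sqrt (by positivity)]
        rw [mul_pow, e]
        have := mul_le_mul_of_nonneg_left (ha m) (show 0 ≤ κ * H ^ d * √m ^ d by positivity)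
        linarith
      have h4 : κ / (H * m) * U m ≤ B' / 2 * √m ^ d := by
        have h5 : κ / (H * m) * U m ≤ κ / (H * m) * (B' * (m * √m ^ d)) := by gcongr
        refine h5.trans ?_
        have h6 : κ / (H * m) * (B' * (m * √m ^ d)) = κ / H * (B' * √m ^ d) := by
          field_simp
        have h7 : κ / H ≤ 1 / 2 := by
          rw [div_le_iff₀ hH0, hH]
          linarith
        rw [h6]
        have := mul_le_mul_of_nonneg_right h7 (show 0 ≤ B' * √m ^ d by positivity)
        linarith
      have h8 : κ * H ^ d * B * √m ^ d ≤ B' / 2 * √m ^ d := by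
        refine mul_le_mul_of_nonneg_right ?_ hφ.le
        rw [hB']
        linarith
      have h9 : U (m + L) ≤ B' * ((m + 1) * √m ^ d) := by linarith
      refine h9.trans (mul_le_mul_of_nonneg_left ?_ hB'0)
      have hL1 : (1 : ℝ) ≤ L := by exact_mod_cast hL
      push_cast
      gcongr
      linarith
    · have h1 : U n ≤ ∑ k ∈ Finset.range (L + 1), U k :=
        Finset.single_le_sum (f := U) (fun k _ => hU0 k) (Finset.mem_range.2 (by omega))
      have h2 : U n ≤ B' := by rw [hB']; linarith
      have h3 : (1 : ℝ) ≤ √n ^ d := one_le_pow₀ (Real.one_le_sqrt.2 hn1)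
      have h4 : (1 : ℝ) ≤ n * √n ^ d := one_le_mul_of_one_le_of_one_le hn1 h3
      exact h2.trans (le_mul_of_one_le_right hB'0 h4)

/-! ### Polynomial weights -/

section Weights

variable {d : ℕ}

/-- `1 + |x|²`. -/
def wt (x : Zd d) : ℝ := 1 + ∑ i, (x i : ℝ) ^ 2

lemma one_le_wt (x : Zd d) : 1 ≤ wt x :=
  le_add_of_nonneg_right (Finset.sum_nonneg fun _ _ => sq_nonneg _)

lemma wt_pos (x : Zd d) : 0 < wt x := one_pos.trans_le (one_le_wt x)

lemma wt_sub_sq_le (x v : Zd d) : (wt (v + x) - wt x) ^ 2 ≤ 10 * wt v ^ 2 * wt x := by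
  set A := ∑ i, (x i : ℝ) ^ 2 with hA
  set B := ∑ i, (v i : ℝ) ^ 2 with hB
  set I := ∑ i, (v i : ℝ) * x i with hI
  have hA0 : 0 ≤ A := Finset.sum_nonneg fun _ _ => sq_nonneg _
  have hB0 : 0 ≤ B := Finset.sum_nonneg fun _ _ => sq_nonneg _
  have h1 : wt (v + x) - wt x = 2 * I + B := by
    simp only [wt, hB, hI, Pi.add_apply, Int.cast_add, add_sq, Finset.sum_add_distrib,
      Finset.mul_sum, mul_assoc]
    ring
  have h2 : I ^ 2 ≤ B * A := Finset.sum_mul_sq_le_sq_mul_sq _ _ _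
  have h3 : wt v = 1 + B := rfl
  have h4 : wt x = 1 + A := rfl
  rw [h1, h3, h4]
  nlinarith [sq_nonneg (2 * I - B), mul_nonneg hB0 hA0, mul_nonneg hA0 (sq_nonneg B),
    mul_nonneg hB0 hB0]

lemma wt_add_le (x v : Zd d) : wt (v + x) ≤ 2 * wt v * wt x := by
  have h1 : wt (v + x) ≤ 1 + (2 * ∑ i, (v i : ℝ) ^ 2 + 2 * ∑ i, (x i : ℝ) ^ 2) := by
    rw [wt, Finset.mul_sum, Finset.mul_sum, ← Finset.sum_add_distrib]
    gcongr with i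
    simp only [Pi.add_apply, Int.cast_add]
    nlinarith [sq_nonneg ((v i : ℝ) - x i)]
  have h2 : 0 ≤ ∑ i, (v i : ℝ) ^ 2 := Finset.sum_nonneg fun _ _ => sq_nonneg _
  have h3 : 0 ≤ ∑ i, (x i : ℝ) ^ 2 := Finset.sum_nonneg fun _ _ => sq_nonneg _
  have h4 := mul_nonneg h2 h3
  simp only [wt] at h1 ⊢
  nlinarith

lemma sq_pow_sub_pow_le {a b S : ℝ} (ha : 0 ≤ a) (hb : 0 ≤ b) (haS : a ≤ S) (hbS : b ≤ S) (k : ℕ) :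
    (a ^ (k + 1) - b ^ (k + 1)) ^ 2 ≤ (k + 1) ^ 2 * S ^ (2 * k) * (a - b) ^ 2 := by
  have h1 : |a ^ (k + 1) - b ^ (k + 1)| ≤ (k + 1) * S ^ k * |a - b| := by
    rw [← geom_sum₂_mul, abs_mul]
    refine mul_le_mul_of_nonneg_right ?_ (abs_nonneg _)
    rw [abs_of_nonneg (Finset.sum_nonneg fun i _ => by positivity)]
    have h2 : ∀ i ∈ Finset.range (k + 1), a ^ i * b ^ (k + 1 - 1 - i) ≤ S ^ k := by
      intro i hi
      have hik : i + (k + 1 - 1 - i) = k := by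
        have := Finset.mem_range.1 hi
        omega
      calc a ^ i * b ^ (k + 1 - 1 - i) ≤ S ^ i * S ^ (k + 1 - 1 - i) := by
            have : 0 ≤ S := ha.trans haS
            gcongr
        _ = S ^ k := by rw [← pow_add, hik]
    refine (Finset.sum_le_card_nsmul _ _ _ h2).trans (le_of_eq ?_)
    simp
  have h3 := pow_le_pow_left₀ (abs_nonneg _) h1 2
  rw [sq_abs] at h3
  refine h3.trans (le_of_eq ?_)
  rw [mul_pow, mul_pow, sq_abs, ← pow_mul, mul_comm k 2]

lemma wt_pow_sub_sq_le (k : ℕ) {ρ : ℝ} (x a b e : Zd d)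
    (ha : wt a ≤ ρ) (hb : wt b ≤ ρ) (he : wt e ≤ ρ) :
    (wt (a + x) ^ (k + 1) - wt (b + x) ^ (k + 1)) ^ 2 ≤
      ((k + 1) ^ 2 * (2 * ρ) ^ (2 * k) * (40 * ρ ^ 2) * (2 * ρ) ^ k) *
        (wt x ^ (k + 1) * wt (e + x) ^ k) := by
  have hx := wt_pos x
  have hρ' : 1 ≤ ρ := (one_le_wt a).trans ha
  have h1 : wt (a + x) ≤ 2 * ρ * wt x := (wt_add_le x a).trans (by gcongr)
  have h2 : wt (b + x) ≤ 2 * ρ * wt x := (wt_add_le x b).trans (by gcongr)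
  have h3 : (wt (a + x) - wt x) ^ 2 ≤ 10 * ρ ^ 2 * wt x := (wt_sub_sq_le x a).trans
    (by have := wt_pos a; gcongr)
  have h4 : (wt (b + x) - wt x) ^ 2 ≤ 10 * ρ ^ 2 * wt x := (wt_sub_sq_le x b).trans
    (by have := wt_pos b; gcongr)
  have h5 : (wt (a + x) - wt (b + x)) ^ 2 ≤ 40 * ρ ^ 2 * wt x := by
    nlinarith [sq_nonneg ((wt (a + x) - wt x) + (wt (b + x) - wt x))]
  have h6 : wt x ≤ 2 * ρ * wt (e + x) := by
    have h7 := wt_add_le (e + x) (-e)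
    rw [neg_add_cancel_left] at h7
    have h8 : wt (-e) = wt e := by simp [wt]
    rw [h8] at h7
    have := wt_pos (e + x)
    exact h7.trans (by gcongr)
  refine (sq_pow_sub_pow_le (wt_pos _).le (wt_pos _).le h1 h2 k).trans ?_
  calc (k + 1 : ℝ) ^ 2 * (2 * ρ * wt x) ^ (2 * k) * (wt (a + x) - wt (b + x)) ^ 2
      ≤ (k + 1 : ℝ) ^ 2 * (2 * ρ * wt x) ^ (2 * k) * (40 * ρ ^ 2 * wt x) := by gcongr
    _ = ((k + 1 : ℝ) ^ 2 * (2 * ρ) ^ (2 * k) * (40 * ρ ^ 2) * wt x ^ (k + 1)) * wt x ^ k := by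
        rw [mul_pow (2 * ρ)]
        ring
    _ ≤ ((k + 1 : ℝ) ^ 2 * (2 * ρ) ^ (2 * k) * (40 * ρ ^ 2) * wt x ^ (k + 1)) *
          (2 * ρ * wt (e + x)) ^ k := by gcongr
    _ = _ := by
        rw [mul_pow (2 * ρ)]
        ring

lemma wt_pow_le_split (k : ℕ) {s : ℝ} (hs : 0 < s) (x : Zd d) :
    wt x ^ k ≤ wt x ^ (k + 1) / s + s ^ k := by
  have hx := wt_pos x
  rcases le_total (wt x) s with h | h
  · have : wt x ^ k ≤ s ^ k := by gcongr
    have h0 : 0 ≤ wt x ^ (k + 1) / s := by positivity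
    linarith
  · have : wt x ^ k ≤ wt x ^ (k + 1) / s := by
      rw [le_div_iff₀ hs, pow_succ]
      gcongr
    have h0 : 0 ≤ s ^ k := by positivity
    linarith

lemma sum_inv_sq_le {N : ℝ} (hN : 0 < N) (m : ℕ) :
    ∑ k ∈ Finset.Icc (-(m : ℤ)) m, 1 / (N + (k : ℝ) ^ 2) ≤ 1 / N + 4 / √N := by
  have hs : 0 < √N := Real.sqrt_pos.2 hN
  have hss : √N * √N = N := Real.mul_self_sqrt hN.le
  have key : ∑ k ∈ Finset.Icc (-(m : ℤ)) m, 1 / (N + (k : ℝ) ^ 2) ≤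
      1 / N + 4 * (1 / √N - 1 / (√N + m)) := by
    induction m with
    | zero => simp
    | succ m ih =>
      have e : Finset.Icc (-((m + 1 : ℕ) : ℤ)) ((m + 1 : ℕ) : ℤ) =
          insert (-((m + 1 : ℕ) : ℤ)) (insert ((m + 1 : ℕ) : ℤ) (Finset.Icc (-(m : ℤ)) m)) := by
        ext k
        simp only [Finset.mem_Icc, Finset.mem_insert]
        push_cast
        omega
      rw [e, Finset.sum_insert, Finset.sum_insert]
      · have h1 : 1 / (N + ((m : ℝ) + 1) ^ 2) ≤ 2 * (1 / (√N + m) - 1 / (√N + (m + 1))) := by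
          have h2 : 1 / (√N + m) - 1 / (√N + (m + 1)) = 1 / ((√N + m) * (√N + (m + 1))) := by
            field_simp
            ring
          rw [h2, mul_one_div, div_le_div_iff₀ (by positivity) (by positivity)]
          nlinarith [sq_nonneg (√N - (m + 1)), hs.le, Nat.cast_nonneg (α := ℝ) m]
        push_cast
        rw [neg_sq]
        linarith
      · simp
      · simp only [Finset.mem_insert, Finset.mem_Icc, not_or]
        push_cast
        omega
  refine key.trans ?_
  have : 0 ≤ 1 / (√N + m) := by positivity
  have e : 4 / √N = 4 * (1 / √N) := by ring
  rw [e]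
  linarith

/-- The cube of radius `m`. -/
def box (d m : ℕ) : Finset (Zd d) := Fintype.piFinset fun _ => Finset.Icc (-(m : ℤ)) m

lemma mem_box {m : ℕ} {x : Zd d} : x ∈ box d m ↔ ∀ i, |x i| ≤ m := by
  simp only [box, Fintype.mem_piFinset, Finset.mem_Icc, abs_le]

/-- Points outside a large cube carry little inverse weight. -/
lemma sum_inv_wt_le {N : ℕ} (hN : 1 ≤ N) {R : ℝ} (hR : 1 ≤ R) {m : ℕ} (hm : R * √N ≤ m)
    (F : Finset (Zd d)) (hF : ∀ x ∈ F, x ∉ box d m) :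
    ∑ x ∈ F, (wt x ^ (d + 1))⁻¹ ≤ 10 ^ d / (R ^ 2 * N * √N ^ d) := by
  have hN1 : (1 : ℝ) ≤ N := by exact_mod_cast hN
  have hN0 : (0 : ℝ) < N := by linarith
  have hR0 : 0 < R := by linarith
  obtain ⟨m', hm'⟩ : ∃ m' : ℕ, F ⊆ box d m' := by
    refine ⟨∑ x ∈ F, ∑ i, (x i).natAbs, fun x hx => mem_box.2 fun i => ?_⟩
    have h1 : (x i).natAbs ≤ ∑ i, (x i).natAbs :=
      Finset.single_le_sum (f := fun i => (x i).natAbs) (fun _ _ => Nat.zero_le _)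
        (Finset.mem_univ i)
    have h2 : ∑ i, (x i).natAbs ≤ ∑ x ∈ F, ∑ i, (x i).natAbs :=
      Finset.single_le_sum (f := fun x : Zd d => ∑ i, (x i).natAbs) (fun _ _ => Nat.zero_le _) hx
    rw [Int.abs_eq_natAbs]
    exact_mod_cast h1.trans h2
  have hpt : ∀ x ∈ F, (wt x ^ (d + 1))⁻¹ ≤ (R ^ 2 * N)⁻¹ * ∏ i, 2 * (1 / (N + (x i : ℝ) ^ 2)) := by
    intro x hx
    have h1 := hF x hx
    rw [mem_box] at h1
    push Not at h1
    obtain ⟨i, hi⟩ := h1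
    have h2 : (m : ℝ) ≤ |(x i : ℝ)| := by exact_mod_cast hi.le
    have h3 : R ^ 2 * N ≤ (x i : ℝ) ^ 2 := by
      rw [← sq_abs (x i : ℝ)]
      have := pow_le_pow_left₀ (by positivity) (hm.trans h2) 2
      rwa [mul_pow, Real.sq_sqrt hN0.le] at this
    have h4 : ∀ j, (x j : ℝ) ^ 2 ≤ wt x := fun j => by
      have := Finset.single_le_sum (f := fun j => (x j : ℝ) ^ 2) (fun _ _ => sq_nonneg _)
        (Finset.mem_univ j)
      rw [wt]
      linarith
    have h5 : R ^ 2 * N ≤ wt x := h3.trans (h4 i)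
    have h6 : (N : ℝ) ≤ wt x := (le_mul_of_one_le_left hN0.le (one_le_pow₀ hR)).trans h5
    have hx0 := wt_pos x
    rw [pow_succ, mul_inv, mul_comm]
    refine mul_le_mul (inv_anti₀ (by positivity) h5) ?_ (by positivity) (by positivity)
    have h7 : (wt x ^ d)⁻¹ = ∏ _i : Fin d, (wt x)⁻¹ := by simp
    rw [h7]
    refine Finset.prod_le_prod (fun _ _ => by positivity) fun j _ => ?_
    rw [mul_one_div, le_div_iff₀ (by positivity), inv_mul_le_iff₀ hx0]
    linarith [h4 j]
  calc ∑ x ∈ F, (wt x ^ (d + 1))⁻¹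
      ≤ ∑ x ∈ F, (R ^ 2 * N)⁻¹ * ∏ i, 2 * (1 / (N + (x i : ℝ) ^ 2)) := Finset.sum_le_sum hpt
    _ ≤ ∑ x ∈ box d m', (R ^ 2 * N)⁻¹ * ∏ i, 2 * (1 / (N + (x i : ℝ) ^ 2)) :=
        Finset.sum_le_sum_of_subset_of_nonneg hm' fun x _ _ => by positivity
    _ = (R ^ 2 * N)⁻¹ * ∏ _i : Fin d, ∑ k ∈ Finset.Icc (-(m' : ℤ)) m',
          2 * (1 / (N + (k : ℝ) ^ 2)) := by
        rw [← Finset.mul_sum, Finset.prod_univ_sum]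
        rfl
    _ ≤ (R ^ 2 * N)⁻¹ * ∏ _i : Fin d, 10 / √N := by
        refine mul_le_mul_of_nonneg_left (Finset.prod_le_prod
          (fun _ _ => Finset.sum_nonneg fun _ _ => by positivity) fun _ _ => ?_) (by positivity)
        rw [← Finset.mul_sum]
        have h1 := sum_inv_sq_le hN0 m'
        have h2 : 1 / (N : ℝ) ≤ 1 / √N := by
          refine one_div_le_one_div_of_le (by positivity) ?_
          rw [Real.sqrt_le_left hN0.le]
          nlinarith
        have e : 10 / √(N : ℝ) = 2 * (1 / √N + 4 / √N) := by ring
        rw [e]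
        linarith
    _ = 10 ^ d / (R ^ 2 * N * √N ^ d) := by
        simp only [Finset.prod_const, Finset.card_univ, Fintype.card_fin, div_pow]
        field_simp

end Weights

namespace CycleData
namespace Admissible

variable {d K : ℕ} {D : CycleData d K (Zd d)} {c C ε : ℝ} {N : ℕ}

lemma integral_dens_le (h : D.Admissible Measure.count c C ε N) (hT : ∀ x y, D.T x y = x + y)
    (m : ℕ) : ∫ x, D.dens m x ∂Measure.count ≤ c⁻¹ := by
  have hc := h.c_pos
  have h1 := h.integral_M_mul_dens hT m fun _ => 1
  have h2 : D.avg^[m] (fun _ => (1 : ℝ)) 0 = 1 := by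
    have : D.avg (fun _ => (1 : ℝ)) = fun _ => 1 := by
      funext x
      exact h.avg_const 1 x
    rw [Function.iterate_fixed this]
  rw [h2] at h1
  rw [← one_div, le_div_iff₀ hc, ← h1, mul_comm, ← integral_const_mul]
  have hi := integrable_count_of_finite (dens_finite (D := D) m)
  simp only [mul_one]
  refine integral_mono (hi.const_mul c) (h.integrable_M_mul hi) fun x => ?_
  exact mul_le_mul_of_nonneg_right (h.M_lower x) (h.dens_nonneg m x)

lemma densSq_nash (h : D.Admissible Measure.count c C ε N) (hT : ∀ x y, D.T x y = x + y)
    {L : ℕ} (hL : ∀ i, D.n i ∣ L) (hL0 : 0 < L) :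
    ∃ κ : ℝ, ∀ m r : ℕ, 0 < r → D.densSq (fun _ => 1) m ≤
      κ * (r ^ 2 * (D.densSq (fun _ => 1) m - D.densSq (fun _ => 1) (m + L)) + 1 / r ^ d) := by
  have hc := h.c_pos
  have hC : 0 < C := hc.trans_le ((h.M_lower 0).trans (h.M_upper 0))
  have hk := h.coerConst_nonneg
  set κ1 := 2 * (1 + d : ℝ) ^ 2 * (coerConst c ε N * (4 * L)) with hκ1
  set κ2 := 2 * (L * c⁻¹) ^ 2 with hκ2
  refine ⟨C * (κ1 + κ2), fun m r hr => ?_⟩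
  have hr1 : (1 : ℝ) ≤ r := by exact_mod_cast hr
  set g : Zd d → ℝ := fun x => ∑ k ∈ Finset.range L, D.dens (m + k) x with hg
  have hgf : g.support.Finite :=
    finite_support_of_imp (s := Finset.range L) (g := fun k => D.dens (m + k))
      (fun k _ => dens_finite _) fun x hx => Finset.sum_eq_zero hx
  have hg0 : ∀ x, 0 ≤ g x := fun x => Finset.sum_nonneg fun k _ => h.dens_nonneg _ x
  set δ := D.densSq (fun _ => 1) m - D.densSq (fun _ => 1) (m + L) with hδ
  have hδ0 : 0 ≤ δ := sub_nonneg.2 (h.densSq_one_antitone hT (by omega))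
  have hgrad : ∀ i, transDiff g (Pi.single i 1) ≤ coerConst c ε N * (4 * L * δ) := by
    intro i
    refine (h.integral_cocycle_sq_le (G := fun x y => g (x + y) - g y) (fun x y ω => ?_)
      (fun v _ => integrable_count_of_finite (finite_support_transDiff hgf v)) i).trans
      (mul_le_mul_of_nonneg_left (h.edge_grad_le hT hL m) hk)
    simp only [hT, add_assoc]
    ring
  have hgi : ∫ x, g x ∂Measure.count ≤ L * c⁻¹ := by
    rw [hg, integral_finsetSum _ fun k _ => integrable_count_of_finite (dens_finite _)]
    refine (Finset.sum_le_card_nsmul _ _ _ fun k _ => h.integral_dens_le hT (m + k)).trans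
      (le_of_eq ?_)
    simp
  have hgi0 : 0 ≤ ∫ x, g x ∂Measure.count := integral_nonneg hg0
  have h1 := nash hgf hg0 (S := coerConst c ε N * (4 * L * δ)) (by positivity) hgrad hr
  have h2 : D.densSq (fun _ => 1) m ≤ C * ∫ x, g x ^ 2 ∂Measure.count := by
    rw [densSq, ← integral_const_mul]
    have hgs : (fun x => g x ^ 2).support.Finite := by
      simp only [sq]
      exact finite_support_mul_right hgf _
    refine integral_mono (h.integrable_M_mul (integrable_count_of_finite (dens_sq_finite m _)))
      ((integrable_count_of_finite hgs).const_mul C) fun x => ?_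
    have h3 : D.dens m x ≤ g x := by
      have := Finset.single_le_sum (f := fun k => D.dens (m + k) x)
        (fun k _ => h.dens_nonneg (m + k) x) (Finset.mem_range.2 hL0)
      simpa using this
    have h4 := h.dens_nonneg m x
    simp only [mul_one]
    exact mul_le_mul (h.M_upper x) (pow_le_pow_left₀ h4 h3 2) (sq_nonneg _) hC.le
  have hrd : (0 : ℝ) < r ^ d := by positivity
  have h5 : 2 * (1 + d * r : ℝ) ^ 2 * (coerConst c ε N * (4 * L * δ)) ≤ κ1 * (r ^ 2 * δ) := by
    have h6 : (1 + d * r : ℝ) ^ 2 ≤ (1 + d : ℝ) ^ 2 * r ^ 2 := by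
      rw [← mul_pow]
      gcongr
      nlinarith [Nat.cast_nonneg (α := ℝ) d]
    calc _ ≤ 2 * ((1 + d : ℝ) ^ 2 * r ^ 2) * (coerConst c ε N * (4 * L * δ)) := by gcongr
      _ = _ := by rw [hκ1]; ring
  have h7 : 2 * (∫ x, g x ∂Measure.count) ^ 2 / (r : ℝ) ^ d ≤ κ2 * (1 / r ^ d) := by
    rw [mul_one_div, hκ2]
    gcongr
  have hκ1' : 0 ≤ κ1 := by positivity
  have hκ2' : 0 ≤ κ2 := by positivity
  have e1 : 0 ≤ κ1 * (1 / (r : ℝ) ^ d) := by positivity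
  have e2 : 0 ≤ κ2 * ((r : ℝ) ^ 2 * δ) := by positivity
  rw [mul_assoc]
  refine h2.trans (mul_le_mul_of_nonneg_left ?_ hC.le)
  linarith

lemma exists_wt_bound (h : D.Admissible Measure.count c C ε N) :
    ∃ ρ : ℝ, 0 ≤ ρ ∧ ∀ i j k, wt (D.cyc i j - D.cyc i k) ≤ ρ := by
  refine ⟨∑ i, ∑ j ∈ Finset.range (D.n i), ∑ k ∈ Finset.range (D.n i),
    wt (D.z i j - D.z i k), Finset.sum_nonneg fun i _ => Finset.sum_nonneg fun j _ =>
      Finset.sum_nonneg fun k _ => (wt_pos _).le, fun i j k => ?_⟩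
  have hj := Finset.mem_range.2 (Nat.mod_lt j (h.len_pos i))
  have hk := Finset.mem_range.2 (Nat.mod_lt k (h.len_pos i))
  refine (Finset.single_le_sum (f := fun k => wt (D.z i (j % D.n i) - D.z i k))
    (fun _ _ => (wt_pos _).le) hk).trans ?_
  refine (Finset.single_le_sum (f := fun j => ∑ k ∈ Finset.range (D.n i), wt (D.z i j - D.z i k))
    (fun _ _ => Finset.sum_nonneg fun _ _ => (wt_pos _).le) hj).trans ?_
  exact Finset.single_le_sum (f := fun i => ∑ j ∈ Finset.range (D.n i),
    ∑ k ∈ Finset.range (D.n i), wt (D.z i j - D.z i k))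
    (fun _ _ => Finset.sum_nonneg fun _ _ => Finset.sum_nonneg fun _ _ => (wt_pos _).le)
    (Finset.mem_univ i)

lemma densSq_nonneg (h : D.Admissible Measure.count c C ε N) {w : Zd d → ℝ} (hw : ∀ x, 0 ≤ w x)
    (m : ℕ) : 0 ≤ D.densSq w m :=
  integral_nonneg fun x => mul_nonneg (h.M_pos x).le (mul_nonneg (sq_nonneg _) (hw x))

lemma densSq_succ_le (h : D.Admissible Measure.count c C ε N) (hT : ∀ x y, D.T x y = x + y)
    {w : Zd d → ℝ} (hw : ∀ x, 0 ≤ w x) {κ : ℝ}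
    (hκ : ∀ i j x, w (D.cyc i (j + 1) + x) ≤ κ * w (D.cyc i j + x)) (m : ℕ) :
    D.densSq w (m + 1) ≤ κ * D.densSq w m := by
  have h1 := h.dissipation_eq hT m w
  have h2 : 0 ≤ D.edge (fun x y => (D.dens m x - D.dens (m + 1) y) ^ 2 * w y) := by
    refine integral_nonneg fun x => mul_nonneg (h.M_pos x).le (Finset.sum_nonneg fun v _ =>
      mul_nonneg (h.p_nonneg v x) (mul_nonneg (sq_nonneg _) (hw _)))
  have e1 : FinEdge fun x y => D.dens m x ^ 2 * (w y - w x) := fun v =>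
    dens_sq_finite m fun x => w (v + x) - w x
  have e2 : FinEdge fun x _ : Zd d => D.dens m x ^ 2 * w x := fun _ => dens_sq_finite m w
  have h3 : D.edge (fun x y => D.dens m x ^ 2 * (w y - w x)) ≤
      D.edge (fun x _ => (κ - 1) * (D.dens m x ^ 2 * w x)) := by
    refine h.edge_mono hT e1 (e2.const_mul _) fun i x => Finset.sum_le_sum fun j _ => ?_
    have := mul_le_mul_of_nonneg_left (hκ i j x) (sq_nonneg (D.dens m (D.cyc i j + x)))
    linarith
  rw [edge_const_mul, h.edge_left fun x => D.dens m x ^ 2 * w x] at h3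
  have h4 : ∫ x, D.M x * (D.dens m x ^ 2 * w x) ∂Measure.count = D.densSq w m := rfl
  rw [h4] at h3
  linarith

/-- On-diagonal decay and weighted growth of the heat kernel. -/
lemma exists_densSq_bounds (h : D.Admissible Measure.count c C ε N)
    (hT : ∀ x y, D.T x y = x + y) :
    ∃ B B' : ℝ, 0 ≤ B ∧ 0 ≤ B' ∧ (∀ n : ℕ, D.densSq (fun _ => 1) n * √n ^ d ≤ B) ∧
      ∀ n : ℕ, 1 ≤ n → D.densSq (fun x => wt x ^ (d + 1)) n ≤ B' * (n * √n ^ d) := by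
  set L := ∏ i, D.n i with hLdef
  have hL : ∀ i, D.n i ∣ L := fun i => Finset.dvd_prod_of_mem _ (Finset.mem_univ i)
  have hL0 : 0 < L := Finset.prod_pos fun i _ => h.len_pos i
  obtain ⟨κ, hκ⟩ := h.densSq_nash hT hL hL0
  obtain ⟨B, hB0, hB⟩ := decay_of_nash hL0 (h.densSq_one_antitone hT)
    (fun m => h.densSq_nonneg (fun _ => zero_le_one) m) hκ
  obtain ⟨ρ, hρ0, hρ⟩ := h.exists_wt_bound
  set U : ℕ → ℝ := D.densSq fun x => wt x ^ (d + 1) with hU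
  set Y : ℕ → ℝ := D.densSq fun x => wt x ^ d with hY
  have hU0 : ∀ n, 0 ≤ U n := fun n => h.densSq_nonneg (fun x => (pow_pos (wt_pos x) _).le) n
  set a : ℕ → ℝ := D.densSq fun _ => 1 with ha
  have ha0 : ∀ n, 0 ≤ a n := fun n => h.densSq_nonneg (fun _ => zero_le_one) n
  set κ' : ℝ := (d + 1) ^ 2 * (2 * ρ) ^ (2 * d) * (40 * ρ ^ 2) * (2 * ρ) ^ d with hκ'
  have hκ'0 : 0 ≤ κ' := by positivity
  have hW : ∀ n, U (n + L) ≤ U n + 4 * L ^ 2 * κ' * ∑ k ∈ Finset.range (L + 1), Y (n + k) := by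
    refine h.densSq_weighted_le hT hL hL0 (w := fun x => wt x ^ (d + 1)) (w' := fun x => wt x ^ d)
      (fun x => pow_pos (wt_pos x) _) (fun x => (pow_pos (wt_pos x) _).le) hκ'0 ?_ ?_
    · intro i x j j' k
      have := wt_pow_sub_sq_le d (D.cyc i k + x) (D.cyc i j' - D.cyc i k)
        (D.cyc i j - D.cyc i k) (D.cyc i k - D.cyc i k) (hρ i _ _) (hρ i _ _) (hρ i _ _)
      simpa only [← add_assoc, sub_add_cancel] using this
    · intro i x j j' k
      have := wt_pow_sub_sq_le d (D.cyc i (k + 1) + x) (D.cyc i j' - D.cyc i (k + 1))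
        (D.cyc i j - D.cyc i (k + 1)) (D.cyc i k - D.cyc i (k + 1)) (hρ i _ _) (hρ i _ _)
        (hρ i _ _)
      simpa only [← add_assoc, sub_add_cancel] using this
  have hsplit : ∀ (n : ℕ) (s : ℝ), 0 < s → Y n ≤ U n / s + s ^ d * a n := by
    intro n s hs
    have i1 : ∀ w : Zd d → ℝ, Integrable (fun x => D.M x * (D.dens n x ^ 2 * w x)) Measure.count := fun w =>
      h.integrable_M_mul (integrable_count_of_finite (dens_sq_finite n w))
    have : U n / s + s ^ d * a n = ∫ x, D.M x * (D.dens n x ^ 2 * (wt x ^ (d + 1))) / s +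
        s ^ d * (D.M x * (D.dens n x ^ 2 * 1)) ∂Measure.count := by
      rw [integral_add ((i1 _).div_const _) ((i1 fun _ => 1).const_mul _), integral_div,
        integral_const_mul]
      rfl
    rw [this]
    refine integral_mono (i1 _) (((i1 _).div_const _).add ((i1 fun _ => 1).const_mul _))
      fun x => ?_
    have h1 := mul_le_mul_of_nonneg_left (wt_pow_le_split d hs x)
      (mul_nonneg (h.M_pos x).le (sq_nonneg (D.dens n x)))
    refine (le_of_eq ?_).trans (h1.trans (le_of_eq ?_))
    · ring
    · ring
  set κ1 : ℝ := max 1 ((2 * ρ) ^ (d + 1)) with hκ1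
  have hκ11 : 1 ≤ κ1 := le_max_left _ _
  have hstep : ∀ n, U (n + 1) ≤ κ1 * U n := by
    refine h.densSq_succ_le hT (fun x => (pow_pos (wt_pos x) _).le) fun i j x => ?_
    have h1 := wt_add_le (D.cyc i j + x) (D.cyc i (j + 1) - D.cyc i j)
    rw [← add_assoc, sub_add_cancel] at h1
    have h2 := wt_pos (D.cyc i j + x)
    have h3 : wt (D.cyc i (j + 1) + x) ≤ 2 * ρ * wt (D.cyc i j + x) := h1.trans (by
      have := hρ i (j + 1) j
      gcongr)
    have h4 := pow_le_pow_left₀ (wt_pos _).le h3 (d + 1)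
    rw [mul_pow] at h4
    exact h4.trans (mul_le_mul_of_nonneg_right (le_max_right _ _) (by positivity))
  have hstep' : ∀ n k, U (n + k) ≤ κ1 ^ k * U n := by
    intro n k
    induction k with
    | zero => simp
    | succ k ih =>
      refine (hstep (n + k)).trans ?_
      rw [pow_succ', mul_assoc]
      exact mul_le_mul_of_nonneg_left ih (by positivity)
  set κ2 : ℝ := 4 * L ^ 2 * κ' * ((L + 1) * κ1 ^ L) with hκ2
  have hκ2' : 0 ≤ κ2 := by positivity
  have hrec : ∀ (n : ℕ) (s : ℝ), 0 < s → U (n + L) ≤ (1 + κ2 / s) * U n + κ2 * s ^ d * a n := by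
    intro n s hs
    have h1 : ∀ k ∈ Finset.range (L + 1), Y (n + k) ≤ κ1 ^ L * (U n / s + s ^ d * a n) := by
      intro k hk
      have hkL : k ≤ L := by have := Finset.mem_range.1 hk; omega
      have h2 : U (n + k) ≤ κ1 ^ L * U n := (hstep' n k).trans
        (mul_le_mul_of_nonneg_right (pow_le_pow_right₀ hκ11 hkL) (hU0 n))
      have h3 : a (n + k) ≤ κ1 ^ L * a n := (h.densSq_one_antitone hT (Nat.le_add_right n k)).trans
        (le_mul_of_one_le_left (ha0 n) (one_le_pow₀ hκ11))
      refine (hsplit (n + k) s hs).trans ?_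
      rw [mul_add, ← mul_div_assoc]
      have h4 : s ^ d * a (n + k) ≤ s ^ d * (κ1 ^ L * a n) := by gcongr
      have h5 : U (n + k) / s ≤ κ1 ^ L * U n / s := by gcongr
      linarith
    have h6 := Finset.sum_le_card_nsmul _ _ _ h1
    rw [Finset.card_range, nsmul_eq_mul] at h6
    refine (hW n).trans ?_
    have h7 := mul_le_mul_of_nonneg_left h6 (show 0 ≤ 4 * (L : ℝ) ^ 2 * κ' by positivity)
    have h8 : 4 * (L : ℝ) ^ 2 * κ' * (((L + 1 : ℕ) : ℝ) * (κ1 ^ L * (U n / s + s ^ d * a n))) =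
        κ2 / s * U n + κ2 * s ^ d * a n := by
      rw [hκ2]
      push_cast
      ring
    linarith
  obtain ⟨B', hB'0, hB'⟩ := moment_growth hL0 hU0 hκ2' hB0 hB hrec
  exact ⟨B, B', hB0, hB'0, hB, hB'⟩

lemma iterate_avg_sq_le (h : D.Admissible Measure.count c C ε N) (hT : ∀ x y, D.T x y = x + y)
    (m : ℕ) {w : Zd d → ℝ} (hw : ∀ x, 0 < w x) (S : Set (Zd d)) {σ : ℝ}
    (hS : ∀ F : Finset (Zd d), (∀ x ∈ F, x ∈ S) → ∑ x ∈ F, (w x)⁻¹ ≤ σ) :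
    (D.avg^[m] (fun x => if x ∈ S then (1 : ℝ) else 0) 0) ^ 2 ≤ D.densSq w m * (C * σ) := by
  have hC : 0 ≤ C := (h.M_pos 0).le.trans (h.M_upper 0)
  set F : Finset (Zd d) := (dens_finite (D := D) m).toFinset with hF
  have hout : ∀ x ∉ F, D.dens m x = 0 := fun x hx => by simpa [hF] using hx
  set F' := F.filter (· ∈ S) with hF'
  rw [← h.integral_M_mul_dens hT, densSq, integral_count_eq_sum (s := F),
    integral_count_eq_sum (s := F)]
  · have e1 : ∑ x ∈ F, D.M x * (D.dens m x * if x ∈ S then (1 : ℝ) else 0) =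
        ∑ x ∈ F', D.M x * D.dens m x := by
      rw [hF', Finset.sum_filter]
      refine Finset.sum_congr rfl fun x _ => ?_
      split_ifs <;> simp
    rw [e1]
    have h1 : (∑ x ∈ F', D.M x * D.dens m x) ^ 2 ≤
        (∑ x ∈ F', D.M x * (D.dens m x ^ 2 * w x)) * ∑ x ∈ F', D.M x * (w x)⁻¹ :=
      Finset.sum_sq_le_sum_mul_sum_of_sq_le_mul _
        (fun x _ => mul_nonneg (h.M_pos x).le (mul_nonneg (sq_nonneg _) (hw x).le))
        (fun x _ => mul_nonneg (h.M_pos x).le (inv_nonneg.2 (hw x).le)) fun x _ => by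
          have := (hw x).ne'
          refine le_of_eq ?_
          field_simp
    refine h1.trans (mul_le_mul ?_ ?_ (Finset.sum_nonneg fun x _ =>
      mul_nonneg (h.M_pos x).le (inv_nonneg.2 (hw x).le)) (Finset.sum_nonneg fun x _ =>
      mul_nonneg (h.M_pos x).le (mul_nonneg (sq_nonneg _) (hw x).le)))
    · exact Finset.sum_le_sum_of_subset_of_nonneg (Finset.filter_subset _ _) fun x _ _ =>
        mul_nonneg (h.M_pos x).le (mul_nonneg (sq_nonneg _) (hw x).le)
    · refine le_trans ?_ (mul_le_mul_of_nonneg_left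
        (hS F' fun x hx => (Finset.mem_filter.1 hx).2) hC)
      rw [Finset.mul_sum]
      exact Finset.sum_le_sum fun x _ =>
        mul_le_mul_of_nonneg_right (h.M_upper x) (inv_nonneg.2 (hw x).le)
  · intro x hx
    rw [hout x hx]
    ring
  · intro x hx
    rw [hout x hx]
    ring

/-- The walk does not charge sets of small density, and is diffusively tight. -/
lemma exists_iterate_avg_bound (h : D.Admissible Measure.count c C ε N)
    (hT : ∀ x y, D.T x y = x + y) :
    ∃ κ : ℝ, 0 ≤ κ ∧ ∀ (n : ℕ) (R : ℝ) (m : ℕ) (S : Set (Zd d)), 1 ≤ n → 1 ≤ R → R * √n ≤ m →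
      (D.avg^[n] (fun x => if x ∈ S then (1 : ℝ) else 0) 0) ^ 2 ≤
        κ * (((box d m).filter (· ∈ S)).card / √n ^ d + 1 / R ^ 2) := by
  obtain ⟨B, B', hB0, hB'0, hB, hB'⟩ := h.exists_densSq_bounds hT
  have hC : 0 ≤ C := (h.M_pos 0).le.trans (h.M_upper 0)
  refine ⟨2 * (B * C) + 2 * (B' * C * 10 ^ d), by positivity, fun n R m S hn hR hm => ?_⟩
  have hn0 : (0 : ℝ) < n := by exact_mod_cast hn
  have hR0 : 0 < R := by linarith
  have hφ : (0 : ℝ) < √n ^ d := by positivity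
  obtain ⟨S1, hS1⟩ : ∃ S' : Set (Zd d), S' = {x | x ∈ S ∧ x ∈ box d m} := ⟨_, rfl⟩
  obtain ⟨S2, hS2⟩ : ∃ S' : Set (Zd d), S' = {x | x ∈ S ∧ x ∉ box d m} := ⟨_, rfl⟩
  have hsplit : (fun x => if x ∈ S then (1 : ℝ) else 0) = fun x =>
      (if x ∈ S1 then (1 : ℝ) else 0) + if x ∈ S2 then (1 : ℝ) else 0 := by
    funext x
    by_cases h1 : x ∈ S <;> by_cases h2 : x ∈ box d m <;> simp [hS1, hS2, h1, h2]
  have hadd : D.avg^[n] (fun x => if x ∈ S then (1 : ℝ) else 0) 0 =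
      D.avg^[n] (fun x => if x ∈ S1 then (1 : ℝ) else 0) 0 +
      D.avg^[n] (fun x => if x ∈ S2 then (1 : ℝ) else 0) 0 := by
    rw [hsplit]
    simp only [← h.integral_M_mul_dens hT, mul_add]
    refine integral_add (h.integrable_M_mul (integrable_count_of_finite
      (finite_support_mul_right (dens_finite n) _))) (h.integrable_M_mul
      (integrable_count_of_finite (finite_support_mul_right (dens_finite n) _)))
  have h1 := h.iterate_avg_sq_le hT n (w := fun _ => 1) (fun _ => one_pos) S1
    (σ := (((box d m).filter (· ∈ S)).card : ℝ)) fun F hF => by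
      simp only [inv_one, Finset.sum_const, nsmul_eq_mul, mul_one]
      have : F ⊆ (box d m).filter (· ∈ S) := fun x hx =>
        Finset.mem_filter.2 (by have := hF x hx; rw [hS1] at this; exact this.symm)
      exact_mod_cast Finset.card_le_card this
  have h2 := h.iterate_avg_sq_le hT n (w := fun x => wt x ^ (d + 1))
    (fun x => pow_pos (wt_pos x) _) S2 (σ := 10 ^ d / (R ^ 2 * n * √n ^ d)) fun F hF =>
      sum_inv_wt_le hn hR hm F fun x hx => (by have := hF x hx; rw [hS2] at this; exact this.2)
  set k : ℝ := (((box d m).filter (· ∈ S)).card : ℝ) with hk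
  have hk0 : 0 ≤ k := Nat.cast_nonneg _
  have h3 : D.densSq (fun _ => 1) n * (C * k) ≤ B * C * (k / √n ^ d) := by
    have := (le_div_iff₀ hφ).2 (hB n)
    refine (mul_le_mul_of_nonneg_right this (by positivity)).trans (le_of_eq ?_)
    ring
  have h4 : D.densSq (fun x => wt x ^ (d + 1)) n * (C * (10 ^ d / (R ^ 2 * n * √n ^ d))) ≤
      B' * C * 10 ^ d * (1 / R ^ 2) := by
    refine (mul_le_mul_of_nonneg_right (hB' n hn) (by positivity)).trans (le_of_eq ?_)
    field_simp
  rw [hadd]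
  set x := D.avg^[n] (fun x => if x ∈ S1 then (1 : ℝ) else 0) 0
  set y := D.avg^[n] (fun x => if x ∈ S2 then (1 : ℝ) else 0) 0
  have h5 : (x + y) ^ 2 ≤ 2 * x ^ 2 + 2 * y ^ 2 := by nlinarith [sq_nonneg (x - y)]
  have h6 : 0 ≤ B * C * (1 / R ^ 2) := by positivity
  have h7 : 0 ≤ B' * C * 10 ^ d * (k / √n ^ d) := by positivity
  nlinarith

end Admissible

namespace Admissible

variable {d K : ℕ} {Ω : Type*} [MeasurableSpace Ω] {D : CycleData d K Ω} {μ : Measure Ω}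
  {c C ε : ℝ} {N : ℕ}

lemma iterate_lattice_avg (h : D.Admissible μ c C ε N) (ω : Ω) (n : ℕ) {E : Type*}
    [AddCommGroup E] [Module ℝ E] (F : Zd d → E) :
    (D.lattice ω).avg^[n] F = (D.step ω)^[n] F := by
  have : (D.lattice ω).avg (E := E) = D.step ω := funext (h.lattice_avg ω)
  rw [this]

lemma exists_iterate_step_bound (h : D.Admissible μ c C ε N) (ω : Ω) :
    ∃ κ : ℝ, 0 ≤ κ ∧ ∀ (n : ℕ) (R : ℝ) (m : ℕ) (S : Set (Zd d)), 1 ≤ n → 1 ≤ R → R * √n ≤ m →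
      ((D.step ω)^[n] (fun x => if x ∈ S then (1 : ℝ) else 0) 0) ^ 2 ≤
        κ * (((box d m).filter (· ∈ S)).card / √n ^ d + 1 / R ^ 2) := by
  obtain ⟨κ, hκ0, hκ⟩ := (h.lattice_admissible ω).exists_iterate_avg_bound fun _ _ => rfl
  refine ⟨κ, hκ0, fun n R m S hn hR hm => ?_⟩
  have := hκ n R m S hn hR hm
  rwa [h.iterate_lattice_avg] at this

end Admissible
end CycleData

/-- Bounded measurable real functions. -/
def BddMeas {Ω : Type*} [MeasurableSpace Ω] (f : Ω → ℝ) : Prop :=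
  Measurable f ∧ ∃ B, ∀ ω, |f ω| ≤ B

namespace BddMeas

variable {Ω : Type*} [MeasurableSpace Ω] {f g : Ω → ℝ}

lemma const (a : ℝ) : BddMeas (fun _ : Ω => a) := ⟨measurable_const, |a|, fun _ => le_rfl⟩

lemma add (hf : BddMeas f) (hg : BddMeas g) : BddMeas (fun ω => f ω + g ω) := by
  obtain ⟨hf1, A, hA⟩ := hf
  obtain ⟨hg1, B, hB⟩ := hg
  exact ⟨hf1.add hg1, A + B, fun ω => (abs_add_le _ _).trans (add_le_add (hA ω) (hB ω))⟩

lemma sub (hf : BddMeas f) (hg : BddMeas g) : BddMeas (fun ω => f ω - g ω) := by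
  obtain ⟨hf1, A, hA⟩ := hf
  obtain ⟨hg1, B, hB⟩ := hg
  exact ⟨hf1.sub hg1, A + B, fun ω => (abs_sub _ _).trans (add_le_add (hA ω) (hB ω))⟩

lemma mul (hf : BddMeas f) (hg : BddMeas g) : BddMeas (fun ω => f ω * g ω) := by
  obtain ⟨hf1, A, hA⟩ := hf
  obtain ⟨hg1, B, hB⟩ := hg
  refine ⟨hf1.mul hg1, A * B, fun ω => ?_⟩
  rw [abs_mul]
  exact mul_le_mul (hA ω) (hB ω) (abs_nonneg _) ((abs_nonneg _).trans (hA ω))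

lemma const_mul (a : ℝ) (hf : BddMeas f) : BddMeas (fun ω => a * f ω) := (const a).mul hf

lemma sq (hf : BddMeas f) : BddMeas (fun ω => f ω ^ 2) := by
  simpa only [pow_two] using hf.mul hf

lemma abs (hf : BddMeas f) : BddMeas (fun ω => |f ω|) := by
  obtain ⟨hf1, A, hA⟩ := hf
  exact ⟨_root_.measurable_abs.comp hf1, A, fun ω => by rw [abs_abs]; exact hA ω⟩

lemma sum {ι : Type*} (s : Finset ι) {F : ι → Ω → ℝ} (hF : ∀ i ∈ s, BddMeas (F i)) :
    BddMeas (fun ω => ∑ i ∈ s, F i ω) := by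
  induction s using Finset.induction_on with
  | empty => simpa using const (Ω := Ω) 0
  | insert a s ha ih =>
    simp_rw [Finset.sum_insert ha]
    exact (hF a (by simp)).add (ih fun i hi => hF i (by simp [hi]))

lemma comp (hf : BddMeas f) {φ : Ω → Ω} (hφ : Measurable φ) : BddMeas (fun ω => f (φ ω)) := by
  obtain ⟨hf1, A, hA⟩ := hf
  exact ⟨hf1.comp hφ, A, fun ω => hA _⟩

lemma integrable {μ : Measure Ω} [IsFiniteMeasure μ] (hf : BddMeas f) : Integrable f μ := by
  obtain ⟨hf1, A, hA⟩ := hf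
  exact Integrable.of_bound hf1.aestronglyMeasurable A (Filter.Eventually.of_forall hA)

end BddMeas

/-- Almost minimizers of a quadratic form along a decreasing sequence of midpoint convex sets
form a rapidly converging sequence. -/
lemma exists_rapid_seq {V : Type*} [AddCommGroup V] [Module ℝ V] (q : V → ℝ) (S : ℕ → Set V)
    (B : ℝ) (hq0 : ∀ x, 0 ≤ q x)
    (hpar : ∀ x ∈ S 0, ∀ y ∈ S 0, 4 * q ((1 / 2 : ℝ) • (x + y)) + q (y - x) = 2 * q x + 2 * q y)
    (hanti : Antitone S)
    (hmid : ∀ k, ∀ x ∈ S k, ∀ y ∈ S k, (1 / 2 : ℝ) • (x + y) ∈ S k)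
    (hex : ∀ k, ∃ x ∈ S k, q x ≤ B) :
    ∃ u : ℕ → V, (∀ k, u k ∈ S k) ∧ ∀ k, q (u (k + 1) - u k) ≤ (1 / 16 : ℝ) ^ k := by
  set m : ℕ → ℝ := fun k => sInf (q '' S k) with hm
  have hbdd : ∀ k, BddBelow (q '' S k) := fun k => ⟨0, by rintro _ ⟨x, -, rfl⟩; exact hq0 x⟩
  have hne : ∀ k, (q '' S k).Nonempty := fun k => by
    obtain ⟨x, hx, -⟩ := hex k
    exact ⟨_, x, hx, rfl⟩
  have hmono : Monotone m := fun a b hab =>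
    csInf_le_csInf (hbdd a) (hne b) (Set.image_mono (hanti hab))
  have hmB : ∀ k, m k ≤ B := fun k => by
    obtain ⟨x, hx, hxB⟩ := hex k
    exact (csInf_le (hbdd k) ⟨x, hx, rfl⟩).trans hxB
  have hlim := tendsto_atTop_ciSup hmono ⟨B, by rintro _ ⟨k, rfl⟩; exact hmB k⟩
  set L := ⨆ k, m k with hL
  have hmL : ∀ k, m k ≤ L := fun k => le_ciSup ⟨B, by rintro _ ⟨k, rfl⟩; exact hmB k⟩ k
  have hpos : ∀ j : ℕ, (0 : ℝ) < (1 / 16) ^ j / 8 := fun j => by positivity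
  obtain ⟨φ, hφ, hφL⟩ := Filter.extraction_forall_of_eventually (P := fun j k =>
    L - (1 / 16 : ℝ) ^ j / 8 < m k) fun j => hlim.eventually_const_lt (by linarith [hpos j])
  have hu : ∀ j, ∃ x ∈ S (φ j), q x < m (φ j) + (1 / 16 : ℝ) ^ j / 8 := fun j => by
    obtain ⟨_, ⟨x, hx, rfl⟩, hlt⟩ := exists_lt_of_csInf_lt (hne (φ j))
      (show sInf (q '' S (φ j)) < m (φ j) + (1 / 16 : ℝ) ^ j / 8 by
        simp only [hm]; linarith [hpos j])
    exact ⟨x, hx, hlt⟩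
  choose u hu1 hu2 using hu
  refine ⟨u, fun k => hanti (hφ.id_le k) (hu1 k), fun k => ?_⟩
  have h1 : u (k + 1) ∈ S (φ k) := hanti (hφ.monotone (Nat.le_succ k)) (hu1 (k + 1))
  have h2 := csInf_le (hbdd (φ k)) ⟨_, hmid _ _ (hu1 k) _ h1, rfl⟩
  have h3 := hpar (u k) (hanti (Nat.zero_le _) (hu1 k)) (u (k + 1)) (hanti (Nat.zero_le _) h1)
  have h4 : m (φ k) ≤ q ((1 / 2 : ℝ) • (u k + u (k + 1))) := h2
  have h5 := hu2 k
  have h6 := hu2 (k + 1)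
  have h7 := hφL k
  have h8 := hmL (φ k)
  have h9 := hmL (φ (k + 1))
  have h10 : (1 / 16 : ℝ) ^ (k + 1) ≤ (1 / 16) ^ k :=
    pow_le_pow_of_le_one (by norm_num) (by norm_num) (Nat.le_succ k)
  linarith

/-- A sequence decaying geometrically in `L²` is geometrically dominated by one `L²` function. -/
lemma exists_L2_dominating {Ω : Type*} [MeasurableSpace Ω] {μ : Measure Ω} (Q : ℕ → Ω → ℝ)
    (hQ : ∀ l, Measurable (Q l)) (hintg : ∀ l, Integrable (fun ω => Q l ω ^ 2) μ) (κ : ℝ)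
    (hκ : ∀ l, ∫ ω, Q l ω ^ 2 ∂μ ≤ κ * (1 / 16) ^ l) :
    ∃ G : Ω → ℝ, Measurable G ∧ (∀ ω, 0 ≤ G ω) ∧ Integrable (fun ω => G ω ^ 2) μ ∧
      ∀ᵐ ω ∂μ, ∀ l, |Q l ω| ≤ (1 / 2) ^ l * G ω := by
  have hmeas : ∀ l, Measurable fun ω => ENNReal.ofReal (4 ^ l * Q l ω ^ 2) := fun l =>
    (((hQ l).pow_const 2).const_mul _).ennreal_ofReal
  set g : Ω → ℝ≥0∞ := fun ω => ∑' l, ENNReal.ofReal (4 ^ l * Q l ω ^ 2) with hg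
  have hgm : Measurable g := Measurable.tsum hmeas
  have hκ0 : 0 ≤ κ := by
    have := (integral_nonneg fun ω => sq_nonneg (Q 0 ω)).trans (hκ 0)
    simpa using this
  have hfin : ∫⁻ ω, g ω ∂μ ≠ ∞ := by
    rw [lintegral_tsum fun l => (hmeas l).aemeasurable]
    have h1 : ∀ l, ∫⁻ ω, ENNReal.ofReal (4 ^ l * Q l ω ^ 2) ∂μ
        ≤ ENNReal.ofReal (κ * (1 / 4) ^ l) := fun l => by
      rw [← ofReal_integral_eq_lintegral_ofReal ((hintg l).const_mul _)
        (Filter.Eventually.of_forall fun ω => by positivity), integral_const_mul]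
      refine ENNReal.ofReal_le_ofReal ?_
      calc (4 : ℝ) ^ l * ∫ ω, Q l ω ^ 2 ∂μ ≤ 4 ^ l * (κ * (1 / 16) ^ l) := by
            gcongr; exact hκ l
        _ = κ * (1 / 4) ^ l := by
            rw [show (1 / 4 : ℝ) = 4 * (1 / 16) by norm_num, mul_pow]; ring
    refine ne_top_of_le_ne_top ?_ (ENNReal.tsum_le_tsum h1)
    rw [← ENNReal.ofReal_tsum_of_nonneg (fun l => by positivity)
      ((summable_geometric_of_lt_one (by norm_num) (by norm_num)).mul_left κ)]
    exact ENNReal.ofReal_ne_top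
  have hsq : ∀ ω, Real.sqrt (g ω).toReal ^ 2 = (g ω).toReal := fun ω =>
    Real.sq_sqrt ENNReal.toReal_nonneg
  refine ⟨fun ω => Real.sqrt (g ω).toReal, hgm.ennreal_toReal.sqrt, fun ω => Real.sqrt_nonneg _,
    ?_, ?_⟩
  · simp_rw [hsq]
    exact integrable_toReal_of_lintegral_ne_top hgm.aemeasurable hfin
  · filter_upwards [ae_lt_top hgm hfin] with ω hω l
    have h1 : 4 ^ l * Q l ω ^ 2 ≤ (g ω).toReal := by
      rw [← ENNReal.ofReal_le_iff_le_toReal hω.ne]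
      exact ENNReal.le_tsum (f := fun l => ENNReal.ofReal (4 ^ l * Q l ω ^ 2)) l
    have h2 : 2 ^ l * |Q l ω| ≤ Real.sqrt (g ω).toReal := by
      refine Real.le_sqrt_of_sq_le ?_
      rw [mul_pow, sq_abs, ← pow_mul, mul_comm l 2, pow_mul]
      norm_num
      exact h1
    calc |Q l ω| = (1 / 2) ^ l * (2 ^ l * |Q l ω|) := by
          rw [← mul_assoc, ← mul_pow]; norm_num
      _ ≤ _ := by gcongr

namespace CycleData

variable {d K : ℕ} {Ω : Type*} [MeasurableSpace Ω] {D : CycleData d K Ω} {μ : Measure Ω}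
  {c C ε : ℝ} {N : ℕ}

/-- The Dirichlet form of the environment chain. -/
def dir (D : CycleData d K Ω) (μ : Measure Ω) (u : Ω → ℝ) : ℝ :=
  ∫ ω, D.M ω * ∑ v ∈ D.jumps, D.p v ω * (u (D.T v ω) - u ω) ^ 2 ∂μ

namespace Admissible

lemma bddMeas_M (h : D.Admissible μ c C ε N) : BddMeas D.M :=
  ⟨h.M_meas, C, fun ω => by rw [abs_of_pos (h.M_pos ω)]; exact h.M_upper ω⟩

lemma bddMeas_p (h : D.Admissible μ c C ε N) (v : Zd d) : BddMeas (D.p v) :=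
  ⟨h.p_meas v, 1, fun ω => by rw [abs_of_nonneg (h.p_nonneg v ω)]; exact h.p_le_one v ω⟩

lemma bddMeas_W (h : D.Admissible μ c C ε N) (i : Fin K) : BddMeas (D.W i) :=
  ⟨h.W_meas i, C, fun ω => by rw [abs_of_nonneg (h.W_nonneg i ω)]; exact h.W_le i ω⟩

lemma bddMeas_comp (h : D.Admissible μ c C ε N) {u : Ω → ℝ} (hu : BddMeas u) (x : Zd d) :
    BddMeas (fun ω => u (D.T x ω)) := hu.comp (h.T_meas x)

lemma bddMeas_sum_p (h : D.Admissible μ c C ε N) {F : Zd d → Ω → ℝ}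
    (hF : ∀ v ∈ D.jumps, BddMeas (F v)) : BddMeas (fun ω => ∑ v ∈ D.jumps, D.p v ω * F v ω) :=
  BddMeas.sum _ fun v hv => (h.bddMeas_p v).mul (hF v hv)

lemma bddMeas_avg (h : D.Admissible μ c C ε N) {u : Ω → ℝ} (hu : BddMeas u) :
    BddMeas (D.avg u) := h.bddMeas_sum_p fun v _ => h.bddMeas_comp hu v

lemma bddMeas_dir (h : D.Admissible μ c C ε N) {u : Ω → ℝ} (hu : BddMeas u) :
    BddMeas (fun ω => D.M ω * ∑ v ∈ D.jumps, D.p v ω * (u (D.T v ω) - u ω) ^ 2) :=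
  h.bddMeas_M.mul (h.bddMeas_sum_p fun v _ => ((h.bddMeas_comp hu v).sub hu).sq)

lemma dir_nonneg (h : D.Admissible μ c C ε N) (u : Ω → ℝ) : 0 ≤ D.dir μ u :=
  integral_nonneg fun ω => mul_nonneg (h.M_pos ω).le
    (Finset.sum_nonneg fun v _ => mul_nonneg (h.p_nonneg v ω) (sq_nonneg _))

lemma dir_const_mul (a : ℝ) (u : Ω → ℝ) :
    D.dir μ (fun ω => a * u ω) = a ^ 2 * D.dir μ u := by
  unfold dir
  rw [← integral_const_mul]
  refine integral_congr_ae (Filter.Eventually.of_forall fun ω => ?_)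
  simp only [Finset.mul_sum]
  refine Finset.sum_congr rfl fun v _ => ?_
  ring

/-- The resolvent equation for the environment chain. -/
lemma exists_resolvent (h : D.Admissible μ c C ε N) {f : Ω → ℝ} (hf : BddMeas f) {l : ℝ}
    (hl : 0 < l) : ∃ u : Ω → ℝ, BddMeas u ∧ ∀ ω, l * u ω + (u ω - D.avg u ω) = f ω := by
  obtain ⟨hfm, B, hB⟩ := hf
  set a : ℝ := (1 + l)⁻¹ with ha
  have ha0 : 0 < a := by positivity
  have ha1 : a < 1 := inv_lt_one_of_one_lt₀ (by linarith)
  have hal : (1 + l) * a = 1 := mul_inv_cancel₀ (by linarith)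
  have hit : ∀ k ω, |D.avg^[k] f ω| ≤ B := fun k => by
    induction k with
    | zero => exact hB
    | succ k ih =>
      intro ω
      rw [Function.iterate_succ_apply']
      exact h.abs_avg_le ih ω
  have hitm : ∀ k, Measurable (D.avg^[k] f) := fun k => by
    induction k with
    | zero => exact hfm
    | succ k ih =>
      rw [Function.iterate_succ_apply']
      exact h.avg_meas ih
  have hgs : Summable fun k : ℕ => a ^ (k + 1) * B :=
    (((summable_geometric_of_lt_one ha0.le ha1).mul_left a).mul_right B).congr
      fun k => by rw [pow_succ']
  have hsum : ∀ ω, Summable fun k => a ^ (k + 1) * D.avg^[k] f ω := fun ω =>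
    Summable.of_norm_bounded hgs fun k => by
      rw [Real.norm_eq_abs, abs_mul, abs_of_pos (by positivity)]
      exact mul_le_mul_of_nonneg_left (hit k ω) (by positivity)
  refine ⟨fun ω => ∑' k, a ^ (k + 1) * D.avg^[k] f ω, ⟨?_, ∑' k : ℕ, a ^ (k + 1) * B, ?_⟩, ?_⟩
  · refine measurable_of_tendsto_metrizable (f := fun n ω =>
      ∑ k ∈ Finset.range n, a ^ (k + 1) * D.avg^[k] f ω)
      (fun n => Finset.measurable_sum _ fun k _ => (hitm k).const_mul _) ?_
    rw [tendsto_pi_nhds]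
    exact fun ω => (hsum ω).hasSum.tendsto_sum_nat
  · intro ω
    rw [← Real.norm_eq_abs]
    refine tsum_of_norm_bounded hgs.hasSum fun k => ?_
    rw [Real.norm_eq_abs, abs_mul, abs_of_pos (by positivity)]
    exact mul_le_mul_of_nonneg_left (hit k ω) (by positivity)
  · intro ω
    have h1 : D.avg (fun ω => ∑' k, a ^ (k + 1) * D.avg^[k] f ω) ω
        = ∑' k, a ^ (k + 1) * D.avg^[k + 1] f ω := by
      symm
      refine HasSum.tsum_eq ?_
      have h2 : HasSum (fun k => ∑ v ∈ D.jumps, D.p v ω • (a ^ (k + 1) * D.avg^[k] f (D.T v ω)))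
          (D.avg (fun ω => ∑' k, a ^ (k + 1) * D.avg^[k] f ω) ω) :=
        hasSum_sum fun v _ => ((hsum (D.T v ω)).hasSum.const_smul (D.p v ω))
      convert h2 using 2 with k
      rw [Function.iterate_succ_apply', avg, Finset.mul_sum]
      refine Finset.sum_congr rfl fun v _ => ?_
      simp only [smul_eq_mul]
      ring
    have h3 : (1 + l) * ∑' k, a ^ (k + 1) * D.avg^[k] f ω
        = f ω + ∑' k, a ^ (k + 1) * D.avg^[k + 1] f ω := by
      rw [(hsum ω).tsum_eq_zero_add, mul_add, ← tsum_mul_left]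
      congr 1
      · rw [← mul_assoc, zero_add, pow_one, hal, one_mul, Function.iterate_zero, id]
      · refine tsum_congr fun k => ?_
        rw [← mul_assoc, pow_succ' a (k + 1), ← mul_assoc, hal, one_mul]
    rw [h1]
    linarith

variable [IsProbabilityMeasure μ]

lemma dir_parallelogram (h : D.Admissible μ c C ε N) {u w : Ω → ℝ} (hu : BddMeas u)
    (hw : BddMeas w) :
    4 * D.dir μ ((1 / 2 : ℝ) • (u + w)) + D.dir μ (w - u) = 2 * D.dir μ u + 2 * D.dir μ w := by
  have h1 : BddMeas ((1 / 2 : ℝ) • (u + w)) := (hu.add hw).const_mul (1 / 2)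
  have h2 : BddMeas (w - u) := hw.sub hu
  unfold dir
  rw [← integral_const_mul, ← integral_const_mul, ← integral_const_mul,
    ← integral_add ((h.bddMeas_dir h1).integrable.const_mul 4) (h.bddMeas_dir h2).integrable,
    ← integral_add ((h.bddMeas_dir hu).integrable.const_mul 2)
      ((h.bddMeas_dir hw).integrable.const_mul 2)]
  refine integral_congr_ae (Filter.Eventually.of_forall fun ω => ?_)
  simp only [Finset.mul_sum, ← Finset.sum_add_distrib]
  refine Finset.sum_congr rfl fun v _ => ?_
  simp only [Pi.smul_apply, Pi.add_apply, Pi.sub_apply, smul_eq_mul]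
  ring

lemma dir_midpoint_le (h : D.Admissible μ c C ε N) {u w : Ω → ℝ} (hu : BddMeas u)
    (hw : BddMeas w) {b : ℝ} (hub : D.dir μ u ≤ b) (hwb : D.dir μ w ≤ b) :
    D.dir μ ((1 / 2 : ℝ) • (u + w)) ≤ b := by
  have h1 := h.dir_parallelogram hu hw
  have h2 := h.dir_nonneg (w - u)
  linarith

lemma integral_M_mul_sub_avg (h : D.Admissible μ c C ε N) {u : Ω → ℝ} (hu : BddMeas u) :
    ∫ ω, D.M ω * (u ω * (u ω - D.avg u ω)) ∂μ = D.dir μ u / 2 := by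
  have h1 := h.integral_M_mul_avg (hu.sq.integrable (μ := μ))
  have hM := h.bddMeas_M
  have h2 : D.dir μ u = ∫ ω, D.M ω * D.avg (fun ω => u ω ^ 2) ω ∂μ
      + ∫ ω, (2 * (D.M ω * (u ω * (u ω - D.avg u ω))) - D.M ω * u ω ^ 2) ∂μ := by
    unfold dir
    rw [← integral_add (hM.mul (h.bddMeas_avg hu.sq)).integrable
      (((hM.mul (hu.mul (hu.sub (h.bddMeas_avg hu)))).const_mul 2).sub (hM.mul hu.sq)).integrable]
    refine integral_congr_ae (Filter.Eventually.of_forall fun ω => ?_)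
    have e1 : ∑ v ∈ D.jumps, D.p v ω * (u (D.T v ω) - u ω) ^ 2
        = D.avg (fun ω => u ω ^ 2) ω - 2 * u ω * D.avg u ω
          + u ω ^ 2 * ∑ v ∈ D.jumps, D.p v ω := by
      simp only [avg, smul_eq_mul, Finset.mul_sum, ← Finset.sum_sub_distrib,
        ← Finset.sum_add_distrib]
      refine Finset.sum_congr rfl fun v _ => ?_
      ring
    simp only
    rw [e1, h.sum_p]
    ring
  rw [integral_sub ((hM.mul (hu.mul (hu.sub (h.bddMeas_avg hu)))).const_mul 2).integrable
    (hM.mul hu.sq).integrable, integral_const_mul, h1] at h2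
  linarith

end Admissible

end CycleData

namespace CycleData

lemma avg_midpoint {d K : ℕ} {Ω : Type*} {D : CycleData d K Ω} (u w : Ω → ℝ) (ω : Ω) :
    D.avg ((1 / 2 : ℝ) • (u + w)) ω = (1 / 2) * (D.avg u ω + D.avg w ω) := by
  rw [← avg_add, ← avg_const_mul]
  rfl

variable {d K : ℕ} {Ω : Type*} [MeasurableSpace Ω] {D : CycleData d K Ω} {μ : Measure Ω}
  {c C ε : ℝ} {N : ℕ}

/-- The local drift in direction `i`. -/
def drift (D : CycleData d K Ω) (i : Fin d) (ω : Ω) : ℝ := ∑ v ∈ D.jumps, D.p v ω * (v i : ℝ)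

/-- The total variation of the `a`-th cycle in direction `i`. -/
def cycleVar (D : CycleData d K Ω) (i : Fin d) (a : Fin K) : ℝ :=
  ∑ j ∈ Finset.range (D.n a), |((D.z a (j + 1) - D.z a j) i : ℝ)|

namespace Admissible

lemma bddMeas_drift (h : D.Admissible μ c C ε N) (i : Fin d) : BddMeas (D.drift i) :=
  h.bddMeas_sum_p fun _ _ => BddMeas.const _

/-- Along a cycle the increments of the position sum to zero, so that a function can be
replaced by its increments. -/
lemma cycle_sum_le (h : D.Admissible μ c C ε N) (i : Fin d) (a : Fin K) (φ : ℕ → ℝ) {w : ℝ}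
    (hw0 : 0 ≤ w) (hw : w ≤ C) :
    ∑ j ∈ Finset.range (D.n a), w * (((D.z a (j + 1) - D.z a j) i : ℝ) * φ j)
      ≤ D.n a * (C * D.cycleVar i a ^ 2)
        + 1 / 4 * ∑ l ∈ Finset.range (D.n a), w * (φ (l + 1) - φ l) ^ 2 := by
  set A := D.cycleVar i a with hA
  have hzero : ∑ j ∈ Finset.range (D.n a), ((D.z a (j + 1) - D.z a j) i : ℝ) = 0 := by
    have := Finset.sum_range_sub (fun j => (D.z a j i : ℝ)) (D.n a)
    simp only [Pi.sub_apply, Int.cast_sub]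
    rw [this, h.closed a, sub_self]
  have hφ : ∀ j ∈ Finset.range (D.n a), |φ j - φ 0|
      ≤ ∑ l ∈ Finset.range (D.n a), |φ (l + 1) - φ l| := fun j hj => by
    rw [← Finset.sum_range_sub φ j]
    refine (Finset.abs_sum_le_sum_abs _ _).trans
      (Finset.sum_le_sum_of_subset_of_nonneg ?_ fun _ _ _ => abs_nonneg _)
    exact Finset.range_subset_range.2 (Finset.mem_range.1 hj).le
  have h1 : ∑ j ∈ Finset.range (D.n a), ((D.z a (j + 1) - D.z a j) i : ℝ) * φ j
      ≤ A * ∑ l ∈ Finset.range (D.n a), |φ (l + 1) - φ l| := by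
    calc ∑ j ∈ Finset.range (D.n a), ((D.z a (j + 1) - D.z a j) i : ℝ) * φ j
        = ∑ j ∈ Finset.range (D.n a), ((D.z a (j + 1) - D.z a j) i : ℝ) * (φ j - φ 0) := by
          simp_rw [mul_sub]
          rw [Finset.sum_sub_distrib, ← Finset.sum_mul, hzero, zero_mul, sub_zero]
      _ ≤ ∑ j ∈ Finset.range (D.n a), |((D.z a (j + 1) - D.z a j) i : ℝ)|
            * ∑ l ∈ Finset.range (D.n a), |φ (l + 1) - φ l| := by
          refine Finset.sum_le_sum fun j hj => ?_
          refine (le_abs_self _).trans ?_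
          rw [abs_mul]
          exact mul_le_mul_of_nonneg_left (hφ j hj) (abs_nonneg _)
      _ = _ := by rw [← Finset.sum_mul, hA, cycleVar]
  rw [← Finset.mul_sum]
  calc w * ∑ j ∈ Finset.range (D.n a), ((D.z a (j + 1) - D.z a j) i : ℝ) * φ j
      ≤ w * (A * ∑ l ∈ Finset.range (D.n a), |φ (l + 1) - φ l|) :=
        mul_le_mul_of_nonneg_left h1 hw0
    _ = ∑ l ∈ Finset.range (D.n a), w * (A * |φ (l + 1) - φ l|) := by
        rw [Finset.mul_sum, Finset.mul_sum]
    _ ≤ ∑ l ∈ Finset.range (D.n a), (C * A ^ 2 + 1 / 4 * (w * (φ (l + 1) - φ l) ^ 2)) := by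
        refine Finset.sum_le_sum fun l _ => ?_
        have e1 : A * |φ (l + 1) - φ l| ≤ A ^ 2 + 1 / 4 * (φ (l + 1) - φ l) ^ 2 := by
          rw [← sq_abs (φ (l + 1) - φ l)]
          nlinarith [sq_nonneg (A - 1 / 2 * |φ (l + 1) - φ l|)]
        have e2 := mul_le_mul_of_nonneg_left e1 hw0
        have e3 : w * A ^ 2 ≤ C * A ^ 2 := mul_le_mul_of_nonneg_right hw (sq_nonneg A)
        linarith
    _ = _ := by
        rw [Finset.sum_add_distrib, Finset.sum_const, Finset.card_range, nsmul_eq_mul,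
          Finset.mul_sum]

variable [IsProbabilityMeasure μ]

lemma dir_eq_sum (h : D.Admissible μ c C ε N) {u : Ω → ℝ} (hu : BddMeas u) :
    D.dir μ u = ∑ a, ∑ j ∈ Finset.range (D.n a),
      ∫ ω, D.W a ω * (u (D.T (D.z a (j + 1)) ω) - u (D.T (D.z a j) ω)) ^ 2 ∂μ := by
  unfold dir
  rw [h.integral_M_mul_sum (F := fun v ω => (u (D.T v ω) - u ω) ^ 2)
    fun v _ => ((h.bddMeas_comp hu v).sub hu).sq.integrable]
  simp_rw [← h.T_add, sub_add_cancel]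

/-- The drift is bounded in the dual of the Dirichlet form. -/
lemma exists_drift_bound (h : D.Admissible μ c C ε N) (i : Fin d) :
    ∃ κ, 0 ≤ κ ∧ ∀ u : Ω → ℝ, BddMeas u →
      ∫ ω, D.M ω * (D.drift i ω * u ω) ∂μ ≤ κ + 1 / 4 * D.dir μ u := by
  have hC : 0 ≤ C := by
    obtain ⟨ω⟩ : Nonempty Ω := nonempty_of_isProbabilityMeasure μ
    exact (h.M_pos ω).le.trans (h.M_upper ω)
  refine ⟨∑ a, D.n a * (C * D.cycleVar i a ^ 2), Finset.sum_nonneg fun a _ => by positivity,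
    fun u hu => ?_⟩
  have h1 : ∫ ω, D.M ω * (D.drift i ω * u ω) ∂μ = ∑ a, ∑ j ∈ Finset.range (D.n a),
      ∫ ω, D.W a ω * (((D.z a (j + 1) - D.z a j) i : ℝ) * u (D.T (D.z a j) ω)) ∂μ := by
    rw [← h.integral_M_mul_sum (F := fun v ω => (v i : ℝ) * u ω)
      fun v _ => (hu.const_mul _).integrable]
    refine integral_congr_ae (Filter.Eventually.of_forall fun ω => ?_)
    simp only [drift, Finset.sum_mul, mul_assoc]
  rw [h1, h.dir_eq_sum hu, Finset.mul_sum, ← Finset.sum_add_distrib]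
  refine Finset.sum_le_sum fun a _ => ?_
  have hi1 : ∀ j ∈ Finset.range (D.n a), Integrable (fun ω => D.W a ω *
      (((D.z a (j + 1) - D.z a j) i : ℝ) * u (D.T (D.z a j) ω))) μ := fun j _ =>
    ((h.bddMeas_W a).mul ((h.bddMeas_comp hu _).const_mul _)).integrable
  have hi2 : ∀ j ∈ Finset.range (D.n a), Integrable (fun ω => D.W a ω *
      (u (D.T (D.z a (j + 1)) ω) - u (D.T (D.z a j) ω)) ^ 2) μ := fun j _ =>
    ((h.bddMeas_W a).mul ((h.bddMeas_comp hu _).sub (h.bddMeas_comp hu _)).sq).integrable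
  rw [← integral_finsetSum _ hi1, ← integral_finsetSum _ hi2]
  calc _ ≤ ∫ ω, (D.n a * (C * D.cycleVar i a ^ 2) + 1 / 4 * ∑ j ∈ Finset.range (D.n a),
        D.W a ω * (u (D.T (D.z a (j + 1)) ω) - u (D.T (D.z a j) ω)) ^ 2) ∂μ := by
        refine integral_mono (integrable_finsetSum _ hi1)
          ((integrable_const _).add ((integrable_finsetSum _ hi2).const_mul _)) fun ω => ?_
        exact h.cycle_sum_le i a (fun j => u (D.T (D.z a j) ω)) (h.W_nonneg a ω) (h.W_le a ω)
    _ = _ := by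
        rw [integral_add (integrable_const _) ((integrable_finsetSum _ hi2).const_mul _)]
        simp [integral_const_mul]

lemma integral_sq_le (h : D.Admissible μ c C ε N) {u : Ω → ℝ} (hu : BddMeas u) :
    c * ∫ ω, u ω ^ 2 ∂μ ≤ ∫ ω, D.M ω * u ω ^ 2 ∂μ := by
  rw [← integral_const_mul]
  exact integral_mono (hu.sq.integrable.const_mul c) (h.bddMeas_M.mul hu.sq).integrable
    fun ω => mul_le_mul_of_nonneg_right (h.M_lower ω) (sq_nonneg _)

/-- The energy identity for the resolvent equation. -/
lemma resolvent_energy (h : D.Admissible μ c C ε N) {f u : Ω → ℝ} (hu : BddMeas u) {l : ℝ}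
    (hres : ∀ ω, l * u ω + (u ω - D.avg u ω) = f ω) :
    l * ∫ ω, D.M ω * u ω ^ 2 ∂μ + D.dir μ u / 2 = ∫ ω, D.M ω * (f ω * u ω) ∂μ := by
  rw [← h.integral_M_mul_sub_avg hu, ← integral_const_mul,
    ← integral_add ((h.bddMeas_M.mul hu.sq).integrable.const_mul l)
      (h.bddMeas_M.mul (hu.mul (hu.sub (h.bddMeas_avg hu)))).integrable]
  refine integral_congr_ae (Filter.Eventually.of_forall fun ω => ?_)
  simp only [← hres]
  ring

lemma _root_.integral_sq_parallelogram {u w : Ω → ℝ} (hu : BddMeas u) (hw : BddMeas w) :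
    4 * ∫ ω, ((1 / 2 : ℝ) • (u + w)) ω ^ 2 ∂μ + ∫ ω, (w - u) ω ^ 2 ∂μ
      = 2 * ∫ ω, u ω ^ 2 ∂μ + 2 * ∫ ω, w ω ^ 2 ∂μ := by
  have h1 : BddMeas ((1 / 2 : ℝ) • (u + w)) := (hu.add hw).const_mul (1 / 2)
  have h2 : BddMeas (w - u) := hw.sub hu
  rw [← integral_const_mul, ← integral_const_mul, ← integral_const_mul,
    ← integral_add (h1.sq.integrable.const_mul 4) h2.sq.integrable,
    ← integral_add (hu.sq.integrable.const_mul 2) (hw.sq.integrable.const_mul 2)]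
  refine integral_congr_ae (Filter.Eventually.of_forall fun ω => ?_)
  simp only [Pi.smul_apply, Pi.add_apply, Pi.sub_apply, smul_eq_mul]
  ring

lemma _root_.integral_sq_midpoint_le {u w : Ω → ℝ} (hu : BddMeas u) (hw : BddMeas w) {b : ℝ}
    (hub : ∫ ω, u ω ^ 2 ∂μ ≤ b) (hwb : ∫ ω, w ω ^ 2 ∂μ ≤ b) :
    ∫ ω, ((1 / 2 : ℝ) • (u + w)) ω ^ 2 ∂μ ≤ b := by
  have h1 := integral_sq_parallelogram (μ := μ) hu hw
  have h2 : 0 ≤ ∫ ω, (w - u) ω ^ 2 ∂μ := integral_nonneg fun ω => sq_nonneg _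
  linarith

/-- Approximate correctors converging rapidly in the Dirichlet form. -/
lemma exists_corrector_seq (h : D.Admissible μ c C ε N) (i : Fin d) :
    ∃ u : ℕ → Ω → ℝ, (∀ k, BddMeas (u k)) ∧
      (∀ k, ∫ ω, (D.drift i ω - (u k ω - D.avg (u k) ω)) ^ 2 ∂μ ≤ (1 / 16) ^ k) ∧
      ∀ k, D.dir μ (u (k + 1) - u k) ≤ (1 / 16) ^ k := by
  obtain ⟨κ, hκ0, hκ⟩ := h.exists_drift_bound i
  have hV := h.bddMeas_drift i
  have hc := h.c_pos
  have hmem := exists_rapid_seq (D.dir μ) (fun k => {u | BddMeas u ∧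
      ∫ ω, (D.drift i ω - (u ω - D.avg u ω)) ^ 2 ∂μ ≤ (1 / 16) ^ k}) (4 * κ) h.dir_nonneg
    (fun x hx y hy => h.dir_parallelogram hx.1 hy.1) ?_ ?_ ?_
  · obtain ⟨u, hu1, hu2⟩ := hmem
    exact ⟨u, fun k => (hu1 k).1, fun k => (hu1 k).2, hu2⟩
  · rintro a b hab u ⟨hu1, hu2⟩
    exact ⟨hu1, hu2.trans (pow_le_pow_of_le_one (by norm_num) (by norm_num) hab)⟩
  · rintro k u ⟨hu1, hu2⟩ w ⟨hw1, hw2⟩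
    refine ⟨(hu1.add hw1).const_mul (1 / 2), ?_⟩
    refine le_trans (le_of_eq ?_) (integral_sq_midpoint_le
      (hV.sub (hu1.sub (h.bddMeas_avg hu1))) (hV.sub (hw1.sub (h.bddMeas_avg hw1))) hu2 hw2)
    refine integral_congr_ae (Filter.Eventually.of_forall fun ω => ?_)
    simp only [avg_midpoint, Pi.smul_apply, Pi.add_apply, smul_eq_mul]
    ring
  · intro k
    set l : ℝ := c / (κ + 1) * (1 / 16) ^ k with hl
    have hl0 : 0 < l := by positivity
    obtain ⟨u, hu, hres⟩ := h.exists_resolvent hV hl0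
    have h1 := h.resolvent_energy hu hres
    have h2 := hκ u hu
    have h3 : 0 ≤ ∫ ω, D.M ω * u ω ^ 2 ∂μ :=
      integral_nonneg fun ω => mul_nonneg (h.M_pos ω).le (sq_nonneg _)
    have h4 := h.dir_nonneg u
    have h5 := h.integral_sq_le hu
    have h6 : l * ∫ ω, D.M ω * u ω ^ 2 ∂μ ≤ κ := by linarith
    refine ⟨u, ⟨hu, ?_⟩, by nlinarith⟩
    have h7 : ∀ ω, D.drift i ω - (u ω - D.avg u ω) = l * u ω := fun ω => by
      rw [← hres]; ring
    simp_rw [h7, mul_pow]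
    rw [integral_const_mul]
    have h8 : c * (l ^ 2 * ∫ ω, u ω ^ 2 ∂μ) ≤ c * (1 / 16) ^ k := by
      calc c * (l ^ 2 * ∫ ω, u ω ^ 2 ∂μ) = l ^ 2 * (c * ∫ ω, u ω ^ 2 ∂μ) := by ring
        _ ≤ l ^ 2 * ∫ ω, D.M ω * u ω ^ 2 ∂μ := by gcongr
        _ = l * (l * ∫ ω, D.M ω * u ω ^ 2 ∂μ) := by ring
        _ ≤ l * (κ + 1) := by gcongr; linarith
        _ = c * (1 / 16) ^ k := by rw [hl]; field_simp
    exact le_of_mul_le_mul_left h8 hc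

/-- Mean zero functions are approximated, modulo coboundaries, by functions of vanishing
Dirichlet energy converging rapidly in `L²`. -/
lemma exists_coboundary_seq (h : D.Admissible μ c C ε N) {f : Ω → ℝ} (hf : BddMeas f) :
    ∃ u : ℕ → Ω → ℝ, (∀ k, BddMeas (u k)) ∧
      (∀ k, D.dir μ (fun ω => f ω - (u k ω - D.avg (u k) ω)) ≤ (1 / 16) ^ k) ∧
      ∀ k, ∫ ω, ((f ω - (u (k + 1) ω - D.avg (u (k + 1)) ω))
        - (f ω - (u k ω - D.avg (u k) ω))) ^ 2 ∂μ ≤ (1 / 16) ^ k := by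
  have hc := h.c_pos
  have hmem := exists_rapid_seq (fun g : Ω → ℝ => ∫ ω, g ω ^ 2 ∂μ)
    (fun k => {g | (∃ u, BddMeas u ∧ g = fun ω => f ω - (u ω - D.avg u ω)) ∧
      D.dir μ g ≤ (1 / 16) ^ k}) ((∫ ω, D.M ω * f ω ^ 2 ∂μ) / c)
    (fun g => integral_nonneg fun ω => sq_nonneg _)
    ?_ ?_ ?_ ?_
  · obtain ⟨g, hg1, hg2⟩ := hmem
    choose u hu1 hu2 using fun k => (hg1 k).1
    refine ⟨u, hu1, fun k => ?_, fun k => ?_⟩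
    · rw [← hu2]
      exact (hg1 k).2
    · have := hg2 k
      rw [hu2 k, hu2 (k + 1)] at this
      exact this
  · rintro _ ⟨⟨u, hu, rfl⟩, -⟩ _ ⟨⟨w, hw, rfl⟩, -⟩
    exact integral_sq_parallelogram (hf.sub (hu.sub (h.bddMeas_avg hu)))
      (hf.sub (hw.sub (h.bddMeas_avg hw)))
  · rintro a b hab u ⟨hu1, hu2⟩
    exact ⟨hu1, hu2.trans (pow_le_pow_of_le_one (by norm_num) (by norm_num) hab)⟩
  · rintro k _ ⟨⟨u, hu, rfl⟩, hu2⟩ _ ⟨⟨w, hw, rfl⟩, hw2⟩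
    refine ⟨⟨(1 / 2 : ℝ) • (u + w), (hu.add hw).const_mul (1 / 2), ?_⟩,
      h.dir_midpoint_le (hf.sub (hu.sub (h.bddMeas_avg hu)))
      (hf.sub (hw.sub (h.bddMeas_avg hw))) hu2 hw2⟩
    funext ω
    simp only [avg_midpoint, Pi.smul_apply, Pi.add_apply, smul_eq_mul]
    ring
  · intro k
    set F := ∫ ω, D.M ω * f ω ^ 2 ∂μ with hF
    have hF0 : 0 ≤ F := integral_nonneg fun ω => mul_nonneg (h.M_pos ω).le (sq_nonneg _)
    set l : ℝ := 1 / (F + 1) * (1 / 16) ^ k with hl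
    have hl0 : 0 < l := by positivity
    obtain ⟨u, hu, hres⟩ := h.exists_resolvent hf hl0
    have h1 := h.resolvent_energy hu hres
    have h4 := h.dir_nonneg u
    have h5 := h.integral_sq_le (hu.const_mul l)
    have h7 : (fun ω => f ω - (u ω - D.avg u ω)) = fun ω => l * u ω := by
      funext ω
      rw [← hres]; ring
    have h2 : 2 * (l * ∫ ω, D.M ω * (f ω * u ω) ∂μ) ≤ F + ∫ ω, D.M ω * (l * u ω) ^ 2 ∂μ := by
      rw [hF, ← integral_add (h.bddMeas_M.mul hf.sq).integrable
        (h.bddMeas_M.mul (hu.const_mul l).sq).integrable, ← integral_const_mul,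
        ← integral_const_mul]
      refine integral_mono ((h.bddMeas_M.mul (hf.mul hu)).integrable.const_mul l |>.const_mul 2)
        ((h.bddMeas_M.mul hf.sq).add (h.bddMeas_M.mul (hu.const_mul l).sq)).integrable
        fun ω => ?_
      have := mul_nonneg (h.M_pos ω).le (sq_nonneg (f ω - l * u ω))
      simp only
      nlinarith
    have h3 : ∫ ω, D.M ω * (l * u ω) ^ 2 ∂μ = l ^ 2 * ∫ ω, D.M ω * u ω ^ 2 ∂μ := by
      rw [← integral_const_mul]
      refine integral_congr_ae (Filter.Eventually.of_forall fun ω => ?_)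
      simp only
      ring
    have h6 : l ^ 2 * ∫ ω, D.M ω * u ω ^ 2 ∂μ + l * D.dir μ u ≤ F := by
      have : l * (l * ∫ ω, D.M ω * u ω ^ 2 ∂μ + D.dir μ u / 2)
        = l * ∫ ω, D.M ω * (f ω * u ω) ∂μ := by rw [h1]
      nlinarith
    have h8 : 0 ≤ l ^ 2 * ∫ ω, D.M ω * u ω ^ 2 ∂μ := by
      rw [← h3]
      exact integral_nonneg fun ω => mul_nonneg (h.M_pos ω).le (sq_nonneg _)
    refine ⟨fun ω => l * u ω, ⟨⟨u, hu, h7.symm⟩, ?_⟩, ?_⟩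
    · rw [dir_const_mul]
      calc l ^ 2 * D.dir μ u = l * (l * D.dir μ u) := by ring
        _ ≤ l * (F + 1) := by gcongr; linarith
        _ = (1 / 16) ^ k := by rw [hl]; field_simp
    · rw [le_div_iff₀ hc]
      nlinarith

end Admissible

end CycleData

section Hopf

variable {Ω : Type*}

/-- The maximal function of the sums `∑_{j<k} R^j f`, `k ≤ n`, truncated at zero. -/
def hopfMax (R : (Ω → ℝ) → Ω → ℝ) (f : Ω → ℝ) : ℕ → Ω → ℝ
  | 0 => fun _ => 0
  | n + 1 => fun ω => max 0 (f ω + R (hopfMax R f n) ω)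

lemma hopfMax_nonneg (R : (Ω → ℝ) → Ω → ℝ) (f : Ω → ℝ) (n : ℕ) (ω : Ω) :
    0 ≤ hopfMax R f n ω := by
  cases n with
  | zero => exact le_rfl
  | succ n => exact le_max_left _ _

lemma hopfMax_le_succ {R : (Ω → ℝ) → Ω → ℝ}
    (hR : ∀ f g : Ω → ℝ, (∀ ω, f ω ≤ g ω) → ∀ ω, R f ω ≤ R g ω) (f : Ω → ℝ) (n : ℕ) :
    ∀ ω, hopfMax R f n ω ≤ hopfMax R f (n + 1) ω := by
  induction n with
  | zero => exact fun ω => hopfMax_nonneg R f 1 ω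
  | succ n ih => exact fun ω => max_le_max le_rfl (by linarith [hR _ _ ih ω])

/-- **Hopf's maximal inequality**. -/
lemma hopf_maximal [MeasurableSpace Ω] {μ : Measure Ω} {R : (Ω → ℝ) → Ω → ℝ} {w : Ω → ℝ}
    (hR : ∀ f g : Ω → ℝ, (∀ ω, f ω ≤ g ω) → ∀ ω, R f ω ≤ R g ω)
    (hRm : ∀ f, Measurable f → Measurable (R f))
    (hRi : ∀ f, Integrable f μ → Integrable (R f) μ)
    (hw : BddMeas w) (hw0 : ∀ ω, 0 ≤ w ω)
    (hinv : ∀ f, Integrable f μ → ∫ ω, w ω * R f ω ∂μ = ∫ ω, w ω * f ω ∂μ)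
    {f : Ω → ℝ} (hfm : Measurable f) (hfi : Integrable f μ) (hR0 : ∀ ω, R (fun _ => 0) ω = 0)
    (n : ℕ) : 0 ≤ ∫ ω, (if 0 < hopfMax R f n ω then w ω * f ω else 0) ∂μ := by
  have hFm : ∀ n, Measurable (hopfMax R f n) := fun n => by
    induction n with
    | zero => exact measurable_const
    | succ n ih => exact measurable_const.max (hfm.add (hRm _ ih))
  have hFi : ∀ n, Integrable (hopfMax R f n) μ := fun n => by
    induction n with
    | zero => exact integrable_zero _ _ _
    | succ n ih => exact (integrable_zero _ _ _).sup (hfi.add (hRi _ ih))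
  obtain ⟨hwm, B, hB⟩ := hw
  have hwi : ∀ g, Integrable g μ → Integrable (fun ω => w ω * g ω) μ := fun g hg =>
    hg.bdd_mul hwm.aestronglyMeasurable (Filter.Eventually.of_forall hB)
  cases n with
  | zero => simp [hopfMax]
  | succ n =>
    have hF := hwi _ (hFi (n + 1))
    have hRF := hwi _ (hRi _ (hFi (n + 1)))
    have hset : MeasurableSet {ω | 0 < hopfMax R f (n + 1) ω} :=
      measurableSet_lt measurable_const (hFm (n + 1))
    calc (0 : ℝ) = ∫ ω, (w ω * hopfMax R f (n + 1) ω - w ω * R (hopfMax R f (n + 1)) ω) ∂μ := by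
          rw [integral_sub hF hRF, hinv _ (hFi _), sub_self]
      _ ≤ _ := by
          refine integral_mono (hF.sub hRF) ?_ fun ω => ?_
          · have := (hwi _ hfi).indicator hset
            refine this.congr (Filter.Eventually.of_forall fun ω => ?_)
            simp [Set.indicator_apply]
          · have hRnn : 0 ≤ R (hopfMax R f (n + 1)) ω := by
              rw [← hR0 ω]
              exact hR _ _ (fun ω => hopfMax_nonneg R f (n + 1) ω) ω
            simp only
            split_ifs with hpos
            · have h1 : hopfMax R f (n + 1) ω = f ω + R (hopfMax R f n) ω := by
                refine max_eq_right (le_of_not_gt fun hlt => ?_)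
                simp only [hopfMax, max_eq_left hlt.le, lt_irrefl] at hpos
              have h2 := hR _ _ (hopfMax_le_succ hR f n) ω
              rw [← mul_sub]
              exact mul_le_mul_of_nonneg_left (by linarith) (hw0 ω)
            · have h1 : hopfMax R f (n + 1) ω = 0 :=
                le_antisymm (not_lt.1 hpos) (hopfMax_nonneg R f (n + 1) ω)
              rw [h1]
              nlinarith [mul_nonneg (hw0 ω) hRnn]

lemma hopfMax_comp_pos_iff (τ : Ω → Ω) (f : Ω → ℝ) (n : ℕ) (ω : Ω) :
    0 < hopfMax (fun g ω => g (τ ω)) f n ω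
      ↔ ∃ k ≤ n, 0 < ∑ j ∈ Finset.range k, f (τ^[j] ω) := by
  have hsucc : ∀ k ω, ∑ j ∈ Finset.range (k + 1), f (τ^[j] ω)
      = f ω + ∑ j ∈ Finset.range k, f (τ^[j] (τ ω)) := fun k ω => by
    rw [Finset.sum_range_succ', add_comm]
    simp only [Function.iterate_succ_apply, Function.iterate_zero, id]
  have h1 : ∀ n ω, ∃ k ≤ n, hopfMax (fun g ω => g (τ ω)) f n ω
      = ∑ j ∈ Finset.range k, f (τ^[j] ω) := fun n => by
    induction n with
    | zero => exact fun ω => ⟨0, le_rfl, by simp [hopfMax]⟩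
    | succ n ih =>
      intro ω
      obtain ⟨k, hk, he⟩ := ih (τ ω)
      rcases max_choice 0 (f ω + hopfMax (fun g ω => g (τ ω)) f n (τ ω)) with h0 | h0
      · exact ⟨0, Nat.zero_le _, by simpa [hopfMax] using h0⟩
      · refine ⟨k + 1, by omega, ?_⟩
        rw [hsucc, ← he]
        exact h0
  have h2 : ∀ n ω, ∀ k ≤ n, ∑ j ∈ Finset.range k, f (τ^[j] ω)
      ≤ hopfMax (fun g ω => g (τ ω)) f n ω := fun n => by
    induction n with
    | zero =>
      intro ω k hk
      obtain rfl : k = 0 := by omega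
      simp [hopfMax]
    | succ n ih =>
      intro ω k hk
      rcases k with _ | k
      · simpa using hopfMax_nonneg _ f (n + 1) ω
      · rw [hsucc]
        exact (add_le_add le_rfl (ih (τ ω) k (by omega))).trans (le_max_right _ _)
  constructor
  · intro hpos
    obtain ⟨k, hk, he⟩ := h1 n ω
    exact ⟨k, hk, he ▸ hpos⟩
  · rintro ⟨k, hk, hpos⟩
    exact hpos.trans_le (h2 n ω k hk)

variable [MeasurableSpace Ω] {μ : Measure Ω} [IsProbabilityMeasure μ]

/-- From the weak type inequality on level sets to the `L²` bound. -/
lemma integral_sq_le_of_level_sets {X q : Ω → ℝ} {B : ℝ} (hX : Measurable X)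
    (hX0 : ∀ ω, 0 ≤ X ω) (hXB : ∀ ω, X ω ≤ B) (hq : BddMeas q)
    (hlev : ∀ l, 0 ≤ l → 0 ≤ ∫ ω, (if l < X ω then q ω - l else 0) ∂μ) :
    ∫ ω, X ω ^ 2 ∂μ ≤ 4 * ∫ ω, q ω ^ 2 ∂μ := by
  have hXbm : BddMeas X := ⟨hX, B, fun ω => by rw [abs_of_nonneg (hX0 ω)]; exact hXB ω⟩
  obtain ⟨hqm, A, hA⟩ := id hq
  have hB : 0 ≤ B := by
    obtain ⟨ω⟩ : Nonempty Ω := nonempty_of_isProbabilityMeasure μ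
    exact (hX0 ω).trans (hXB ω)
  have hintg : Integrable (Function.uncurry fun (ω : Ω) (l : ℝ) => if l < X ω then q ω - l else 0)
      (μ.prod (volume.restrict (Set.Ioc 0 B))) := by
    refine Integrable.of_bound (C := A + B) ?_ ?_
    · refine Measurable.aestronglyMeasurable (Measurable.ite ?_ ?_ measurable_const)
      · exact measurableSet_lt measurable_snd (hX.comp measurable_fst)
      · exact (hqm.comp measurable_fst).sub measurable_snd
    · have hae : ∀ᵐ x ∂(μ.prod (volume.restrict (Set.Ioc 0 B))), x.2 ∈ Set.Ioc 0 B := by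
        refine Measure.quasiMeasurePreserving_snd.ae (p := fun x => x ∈ Set.Ioc 0 B) ?_
        exact ae_restrict_mem measurableSet_Ioc
      filter_upwards [hae] with x hx
      simp only [Function.uncurry, Real.norm_eq_abs]
      have hA' := abs_le.1 (hA x.1)
      split_ifs
      · rw [abs_le]
        constructor <;> linarith [hx.1, hx.2]
      · rw [abs_zero]
        linarith [(abs_nonneg _).trans (hA x.1)]
  have hswap := integral_integral_swap hintg
  have h1 : 0 ≤ ∫ l in Set.Ioc 0 B, ∫ ω, (if l < X ω then q ω - l else 0) ∂μ :=
    setIntegral_nonneg measurableSet_Ioc fun l hl => hlev l hl.1.le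
  have h2 : ∀ ω, ∫ l in Set.Ioc 0 B, (if l < X ω then q ω - l else 0)
      = q ω * X ω - X ω ^ 2 / 2 := fun ω => by
    have e1 : ∫ l in Set.Ioc 0 B, (if l < X ω then q ω - l else 0)
        = ∫ l in Set.Ioc 0 B, (Set.Iio (X ω)).indicator (fun l => q ω - l) l := by
      refine integral_congr_ae (Filter.Eventually.of_forall fun l => ?_)
      simp [Set.indicator_apply]
    rw [e1, setIntegral_indicator measurableSet_Iio]
    have e2 : Set.Ioc 0 B ∩ Set.Iio (X ω) = Set.Ioo 0 (X ω) := by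
      ext l
      simp only [Set.mem_inter_iff, Set.mem_Ioc, Set.mem_Iio, Set.mem_Ioo]
      exact ⟨fun hl => ⟨hl.1.1, hl.2⟩, fun hl => ⟨⟨hl.1, hl.2.le.trans (hXB ω)⟩, hl.2⟩⟩
    rw [e2, ← integral_Ioc_eq_integral_Ioo, ← intervalIntegral.integral_of_le (hX0 ω),
      intervalIntegral.integral_sub (by simp) (by simp)]
    simp
    ring
  simp_rw [h2] at hswap
  rw [← hswap, integral_sub (hq.mul hXbm).integrable (hXbm.sq.integrable.div_const 2),
    integral_div] at h1
  have h3 : ∫ ω, q ω * X ω ∂μ ≤ ∫ ω, (1 / 4 * X ω ^ 2 + q ω ^ 2) ∂μ :=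
    integral_mono (hq.mul hXbm).integrable ((hXbm.sq.const_mul _).add hq.sq).integrable fun ω => by
      simp only
      nlinarith [sq_nonneg (X ω / 2 - q ω)]
  rw [integral_add (hXbm.sq.const_mul _).integrable hq.sq.integrable, integral_const_mul] at h3
  linarith

/-- The `L²` maximal inequality for the ergodic averages of a measure preserving map. -/
lemma exists_ergodic_max {τ : Ω → Ω} (hτ : MeasurePreserving τ μ μ) {q : Ω → ℝ}
    (hq : BddMeas q) (hq0 : ∀ ω, 0 ≤ q ω) :
    ∃ g : Ω → ℝ, BddMeas g ∧ (∀ ω, 0 ≤ g ω) ∧ ∫ ω, g ω ^ 2 ∂μ ≤ 4 * ∫ ω, q ω ^ 2 ∂μ ∧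
      ∀ ω (n : ℕ), ∑ j ∈ Finset.range (n + 1), q (τ^[j] ω) ≤ (n + 1) * g ω := by
  obtain ⟨hqm, B, hB⟩ := id hq
  set A : ℕ → Ω → ℝ := fun n ω => (∑ j ∈ Finset.range (n + 1), q (τ^[j] ω)) / (n + 1) with hAdef
  have hA0 : ∀ n ω, 0 ≤ A n ω := fun n ω =>
    div_nonneg (Finset.sum_nonneg fun j _ => hq0 _) (by positivity)
  have hAB : ∀ n ω, A n ω ≤ B := fun n ω => by
    rw [hAdef, div_le_iff₀ (by positivity)]
    calc ∑ j ∈ Finset.range (n + 1), q (τ^[j] ω) ≤ ∑ j ∈ Finset.range (n + 1), B :=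
          Finset.sum_le_sum fun j _ => (le_abs_self _).trans (hB _)
      _ = B * (n + 1) := by simp [mul_comm]
  have hAm : ∀ n, Measurable (A n) := fun n =>
    (Finset.measurable_sum _ fun j _ => hqm.comp (hτ.measurable.iterate j)).div_const _
  set X : ℕ → Ω → ℝ := fun n ω => partialSups (fun k => A k ω) n with hXdef
  have hXm : ∀ n, Measurable (X n) := fun n => by
    induction n with
    | zero => simpa [hXdef] using hAm 0
    | succ n ih =>
      have : X (n + 1) = fun ω => max (X n ω) (A (n + 1) ω) := by
        funext ω
        exact partialSups_add_one (fun k => A k ω) n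
      rw [this]
      exact ih.max (hAm _)
  have hXB : ∀ n ω, X n ω ≤ B := fun n ω => partialSups_le_iff.2 fun k _ => hAB k ω
  have hX0 : ∀ n ω, 0 ≤ X n ω := fun n ω =>
    (hA0 n ω).trans (le_partialSups (fun k => A k ω) n)
  have hXsq : ∀ n, ∫ ω, X n ω ^ 2 ∂μ ≤ 4 * ∫ ω, q ω ^ 2 ∂μ := fun n => by
    refine integral_sq_le_of_level_sets (hXm n) (hX0 n) (hXB n) hq fun l hl => ?_
    have h1 := hopf_maximal (μ := μ) (R := fun g ω => g (τ ω)) (w := fun _ => 1)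
      (fun f g hfg ω => hfg _) (fun f hf => hf.comp hτ.measurable)
      (fun f hf => hτ.integrable_comp_of_integrable hf) (BddMeas.const 1)
      (fun _ => zero_le_one)
      (fun f hf => by
        simp only [one_mul]
        conv_rhs => rw [← hτ.map_eq]
        rw [integral_map hτ.measurable.aemeasurable]
        rw [hτ.map_eq]
        exact hf.aestronglyMeasurable)
      (f := fun ω => q ω - l) (hqm.sub_const l) (hq.sub (BddMeas.const l)).integrable
      (fun _ => rfl) (n + 1)
    refine h1.trans (le_of_eq (integral_congr_ae (Filter.Eventually.of_forall fun ω => ?_)))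
    simp only [one_mul]
    refine if_congr ?_ rfl rfl
    rw [hopfMax_comp_pos_iff]
    have hk : ∀ k : ℕ, 0 < ∑ j ∈ Finset.range (k + 1), (q (τ^[j] ω) - l) ↔ l < A k ω := fun k => by
      rw [hAdef, lt_div_iff₀ (by positivity), Finset.sum_sub_distrib, sub_pos]
      simp [mul_comm]
    constructor
    · rintro ⟨k, hkn, hpos⟩
      rcases k with _ | k
      · simp at hpos
      · exact ((hk k).1 hpos).trans_le
          (le_partialSups_of_le (fun k => A k ω) (by omega : k ≤ n))
    · intro hlt
      obtain ⟨k, hkn, he⟩ := exists_partialSups_eq (fun k => A k ω) n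
      refine ⟨k + 1, by omega, (hk k).2 ?_⟩
      simp only [hXdef, he] at hlt
      exact hlt
  have hbdd : ∀ ω, BddAbove (Set.range fun n => X n ω) := fun ω =>
    ⟨B, by rintro _ ⟨n, rfl⟩; exact hXB n ω⟩
  have hlim : ∀ ω, Filter.Tendsto (fun n => X n ω) Filter.atTop (nhds (⨆ n, X n ω)) := fun ω =>
    tendsto_atTop_ciSup (partialSups fun k => A k ω).monotone (hbdd ω)
  have hgm : Measurable fun ω => ⨆ n, X n ω :=
    measurable_of_tendsto_metrizable hXm (tendsto_pi_nhds.2 hlim)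
  have hg0 : ∀ ω, 0 ≤ ⨆ n, X n ω := fun ω => (hX0 0 ω).trans (le_ciSup (hbdd ω) 0)
  have hgB : ∀ ω, ⨆ n, X n ω ≤ B := fun ω => ciSup_le fun n => hXB n ω
  refine ⟨fun ω => ⨆ n, X n ω, ⟨hgm, B, fun ω => ?_⟩, hg0, ?_, fun ω n => ?_⟩
  · rw [abs_of_nonneg (hg0 ω)]
    exact hgB ω
  · refine le_of_tendsto (tendsto_integral_of_dominated_convergence (F := fun n ω => X n ω ^ 2)
      (fun _ => B ^ 2) (fun n => ((hXm n).pow_const 2).aestronglyMeasurable) (integrable_const _)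
      (fun n => Filter.Eventually.of_forall fun ω => ?_)
      (Filter.Eventually.of_forall fun ω => (hlim ω).pow 2)) (Filter.Eventually.of_forall hXsq)
    rw [Real.norm_eq_abs, abs_of_nonneg (sq_nonneg _)]
    exact pow_le_pow_left₀ (hX0 n ω) (hXB n ω) 2
  · have h1 : A n ω ≤ ⨆ n, X n ω :=
      (le_partialSups (fun k => A k ω) n).trans (le_ciSup (hbdd ω) n)
    rw [hAdef, div_le_iff₀ (by positivity)] at h1
    linarith

end Hopf

lemma sum_Icc_int_le (n : ℕ) {b : ℤ → ℝ} (hb : ∀ k, 0 ≤ b k) :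
    ∑ k ∈ Finset.Icc (-(n : ℤ)) n, b k
      ≤ ∑ j ∈ Finset.range (n + 1), b j + ∑ j ∈ Finset.range (n + 1), b (-j) := by
  have h1 : ∑ j ∈ Finset.range (n + 1), b j
      = ∑ k ∈ (Finset.range (n + 1)).image (fun j : ℕ => (j : ℤ)), b k := by
    rw [Finset.sum_image fun i _ j _ hij => by exact_mod_cast hij]
  have h2 : ∑ j ∈ Finset.range (n + 1), b (-j)
      = ∑ k ∈ (Finset.range (n + 1)).image (fun j : ℕ => -(j : ℤ)), b k := by
    rw [Finset.sum_image fun i _ j _ hij => by simpa using hij]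
  rw [h1, h2, ← Finset.sum_union_inter]
  refine le_add_of_le_of_nonneg (Finset.sum_le_sum_of_subset_of_nonneg (fun k hk => ?_)
    fun k _ _ => hb k) (Finset.sum_nonneg fun k _ => hb k)
  simp only [Finset.mem_union, Finset.mem_image, Finset.mem_range]
  rw [Finset.mem_Icc] at hk
  rcases le_total 0 k with h0 | h0
  · exact Or.inl ⟨k.toNat, by omega, by omega⟩
  · exact Or.inr ⟨(-k).toNat, by omega, by omega⟩

lemma abs_sub_zero_le_sum_Icc {n : ℕ} {φ b : ℤ → ℝ} (hφ : ∀ k, |φ (k + 1) - φ k| ≤ b k) {k : ℤ}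
    (hk : k ∈ Finset.Icc (-(n : ℤ)) n) :
    |φ k - φ 0| ≤ ∑ j ∈ Finset.Icc (-(n : ℤ)) n, b j := by
  have hb : ∀ k, 0 ≤ b k := fun k => (abs_nonneg _).trans (hφ k)
  rw [Finset.mem_Icc] at hk
  rcases le_total 0 k with h0 | h0
  · obtain ⟨m, rfl⟩ := Int.eq_ofNat_of_zero_le h0
    have e := Finset.sum_range_sub (fun j : ℕ => φ j) m
    simp only [Nat.cast_zero] at e
    rw [← e]
    calc |∑ j ∈ Finset.range m, (φ ((j + 1 : ℕ) : ℤ) - φ j)| ≤ ∑ j ∈ Finset.range m, b j :=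
          (Finset.abs_sum_le_sum_abs _ _).trans
            (Finset.sum_le_sum fun j _ => by simpa using hφ j)
      _ = ∑ k ∈ (Finset.range m).image (fun j : ℕ => (j : ℤ)), b k := by
          rw [Finset.sum_image fun i _ j _ hij => by exact_mod_cast hij]
      _ ≤ _ := by
          refine Finset.sum_le_sum_of_subset_of_nonneg (fun k hk => ?_) fun k _ _ => hb k
          simp only [Finset.mem_image, Finset.mem_range] at hk
          obtain ⟨j, hj, rfl⟩ := hk
          rw [Finset.mem_Icc]
          omega
  · obtain ⟨m, hm⟩ := Int.eq_ofNat_of_zero_le (neg_nonneg.2 h0)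
    obtain rfl : k = -(m : ℤ) := by omega
    have e := Finset.sum_range_sub (fun j : ℕ => φ (-(j : ℤ))) m
    simp only [Nat.cast_zero, neg_zero] at e
    rw [← e]
    calc |∑ j ∈ Finset.range m, (φ (-((j + 1 : ℕ) : ℤ)) - φ (-(j : ℤ)))|
        ≤ ∑ j ∈ Finset.range m, b (-((j : ℤ) + 1)) := by
          refine (Finset.abs_sum_le_sum_abs _ _).trans (Finset.sum_le_sum fun j _ => ?_)
          have := hφ (-((j : ℤ) + 1))
          rw [show -((j : ℤ) + 1) + 1 = -j by ring, abs_sub_comm] at this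
          simpa using this
      _ = ∑ k ∈ (Finset.range m).image (fun j : ℕ => -((j : ℤ) + 1)), b k := by
          rw [Finset.sum_image fun i _ j _ hij => by simpa using hij]
      _ ≤ _ := by
          refine Finset.sum_le_sum_of_subset_of_nonneg (fun k hk => ?_) fun k _ _ => hb k
          simp only [Finset.mem_image, Finset.mem_range] at hk
          obtain ⟨j, hj, rfl⟩ := hk
          rw [Finset.mem_Icc]
          omega

/-- The cube of radius `n` in the coordinate plane spanned by `s`. -/
def boxOn {d : ℕ} (s : Finset (Fin d)) (n : ℕ) : Finset (Zd d) :=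
  Fintype.piFinset fun i => if i ∈ s then Finset.Icc (-(n : ℤ)) n else {0}

lemma boxOn_univ {d n : ℕ} : boxOn (Finset.univ : Finset (Fin d)) n = box d n := by
  simp [boxOn, box]

lemma boxOn_empty {d n : ℕ} : boxOn (∅ : Finset (Fin d)) n = {0} := by
  ext x
  simp [boxOn, funext_iff]

lemma sum_boxOn_insert {d n : ℕ} {s : Finset (Fin d)} {a : Fin d} (ha : a ∉ s) (F : Zd d → ℝ) :
    ∑ y ∈ boxOn (insert a s) n, F y
      = ∑ y ∈ boxOn s n, ∑ k ∈ Finset.Icc (-(n : ℤ)) n, F (y + Pi.single a k) := by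
  rw [← Finset.sum_product']
  symm
  have hmem : ∀ y ∈ boxOn s n, y a = 0 := fun y hy => by
    have := Fintype.mem_piFinset.1 hy a
    simpa [ha] using this
  refine Finset.sum_nbij' (fun p => p.1 + Pi.single a p.2) (fun y => (Function.update y a 0, y a))
    ?_ ?_ ?_ ?_ ?_
  · rintro ⟨y, k⟩ hp
    rw [Finset.mem_product] at hp
    refine Fintype.mem_piFinset.2 fun i => ?_
    by_cases hi : i = a
    · subst hi
      have := hmem y hp.1
      simpa [this] using hp.2
    · have := Fintype.mem_piFinset.1 hp.1 i
      simpa [hi] using this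
  · intro y hy
    rw [Finset.mem_product]
    refine ⟨Fintype.mem_piFinset.2 fun i => ?_, ?_⟩
    · by_cases hi : i = a
      · subst hi
        simp [ha]
      · have := Fintype.mem_piFinset.1 hy i
        simpa [hi] using this
    · have := Fintype.mem_piFinset.1 hy a
      simpa using this
  · rintro ⟨y, k⟩ hp
    rw [Finset.mem_product] at hp
    have h0 := hmem y hp.1
    refine Prod.ext ?_ ?_
    · funext i
      by_cases hi : i = a
      · subst hi
        simp [h0]
      · simp [hi]
    · simp [h0]
  · intro y hy
    funext i
    by_cases hi : i = a
    · subst hi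
      simp
    · simp [hi]
  · rintro ⟨y, k⟩ _
    rfl

lemma card_Icc_neg (n : ℕ) : (Finset.Icc (-(n : ℤ)) n).card = 2 * n + 1 := by
  rw [Int.card_Icc]
  omega

namespace CycleData.Admissible

variable {d K : ℕ} {Ω : Type*} [MeasurableSpace Ω] {D : CycleData d K Ω} {μ : Measure Ω}
  {c C ε : ℝ} {N : ℕ}

lemma iterate_T_single (h : D.Admissible μ c C ε N) (a : Fin d) (s : ℤ) (j : ℕ) (ω : Ω) :
    (D.T (Pi.single a s))^[j] ω = D.T (Pi.single a (j * s)) ω := by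
  induction j with
  | zero => simp [h.T_zero]
  | succ j ih =>
    rw [Function.iterate_succ_apply', ih, ← h.T_add, ← Pi.single_add]
    congr 2
    push_cast
    ring

variable [IsProbabilityMeasure μ]

/-- Maximal inequality for averages over segments in direction `a`. -/
lemma exists_line_max (h : D.Admissible μ c C ε N) (a : Fin d) {q : Ω → ℝ} (hq : BddMeas q)
    (hq0 : ∀ ω, 0 ≤ q ω) :
    ∃ g : Ω → ℝ, BddMeas g ∧ (∀ ω, 0 ≤ g ω) ∧ ∫ ω, g ω ^ 2 ∂μ ≤ 16 * ∫ ω, q ω ^ 2 ∂μ ∧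
      ∀ ω (n : ℕ), ∑ k ∈ Finset.Icc (-(n : ℤ)) n, q (D.T (Pi.single a k) ω)
        ≤ (2 * n + 1) * g ω := by
  obtain ⟨g1, hg1, hg1n, hg1i, hg1s⟩ := exists_ergodic_max (h.pres (Pi.single a 1)) hq hq0
  obtain ⟨g2, hg2, hg2n, hg2i, hg2s⟩ := exists_ergodic_max (h.pres (Pi.single a (-1))) hq hq0
  refine ⟨fun ω => g1 ω + g2 ω, hg1.add hg2, fun ω => add_nonneg (hg1n ω) (hg2n ω), ?_,
    fun ω n => ?_⟩
  · calc ∫ ω, (g1 ω + g2 ω) ^ 2 ∂μ ≤ ∫ ω, (2 * g1 ω ^ 2 + 2 * g2 ω ^ 2) ∂μ :=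
          integral_mono (hg1.add hg2).sq.integrable
            ((hg1.sq.const_mul 2).add (hg2.sq.const_mul 2)).integrable fun ω => by
              simp only
              nlinarith [sq_nonneg (g1 ω - g2 ω)]
      _ = 2 * ∫ ω, g1 ω ^ 2 ∂μ + 2 * ∫ ω, g2 ω ^ 2 ∂μ := by
          rw [integral_add (hg1.sq.const_mul 2).integrable (hg2.sq.const_mul 2).integrable,
            integral_const_mul, integral_const_mul]
      _ ≤ _ := by linarith
  · have h1 := hg1s ω n
    have h2 := hg2s ω n
    simp only [h.iterate_T_single, mul_one, mul_neg] at h1 h2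
    have h3 := sum_Icc_int_le n (b := fun k => q (D.T (Pi.single a k) ω)) fun k => hq0 _
    have h4 := mul_nonneg (Nat.cast_nonneg (α := ℝ) n) (hg1n ω)
    have h5 := mul_nonneg (Nat.cast_nonneg (α := ℝ) n) (hg2n ω)
    linarith

/-- Maximal inequality for averages over cubes in coordinate planes. -/
lemma exists_boxOn_max (h : D.Admissible μ c C ε N) (s : Finset (Fin d)) :
    ∀ q : Ω → ℝ, BddMeas q → (∀ ω, 0 ≤ q ω) →
    ∃ g : Ω → ℝ, BddMeas g ∧ (∀ ω, 0 ≤ g ω) ∧ ∫ ω, g ω ^ 2 ∂μ ≤ 16 ^ s.card * ∫ ω, q ω ^ 2 ∂μ ∧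
      ∀ ω (n : ℕ), ∑ y ∈ boxOn s n, q (D.T y ω) ≤ (2 * n + 1) ^ s.card * g ω := by
  induction s using Finset.induction_on with
  | empty =>
    intro q hq hq0
    exact ⟨q, hq, hq0, by simp, fun ω n => by simp [boxOn_empty, h.T_zero]⟩
  | insert a s ha ih =>
    intro q hq hq0
    obtain ⟨g1, hg1, hg1n, hg1i, hg1s⟩ := h.exists_line_max a hq hq0
    obtain ⟨g, hg, hgn, hgi, hgs⟩ := ih g1 hg1 hg1n
    refine ⟨g, hg, hgn, ?_, fun ω n => ?_⟩
    · rw [Finset.card_insert_of_notMem ha, pow_succ, mul_assoc]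
      exact hgi.trans (mul_le_mul_of_nonneg_left hg1i (by positivity))
    · rw [Finset.card_insert_of_notMem ha, sum_boxOn_insert ha]
      calc ∑ y ∈ boxOn s n, ∑ k ∈ Finset.Icc (-(n : ℤ)) n, q (D.T (y + Pi.single a k) ω)
          ≤ ∑ y ∈ boxOn s n, (2 * n + 1) * g1 (D.T y ω) := by
            refine Finset.sum_le_sum fun y _ => ?_
            have := hg1s (D.T y ω) n
            simp_rw [← h.T_add] at this
            simpa only [add_comm y] using this
        _ ≤ (2 * n + 1) * ((2 * n + 1) ^ s.card * g ω) := by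
            rw [← Finset.mul_sum]
            exact mul_le_mul_of_nonneg_left (hgs ω n) (by positivity)
        _ = _ := by ring

/-- Functions on the lattice whose increments are controlled by stationary functions deviate
little from their value at the origin, on average over cubes. -/
lemma exists_path_max_on (h : D.Admissible μ c C ε N) (s : Finset (Fin d)) :
    ∃ κ : ℝ, 0 ≤ κ ∧ ∀ q : Fin d → Ω → ℝ, (∀ i, BddMeas (q i)) → (∀ i ω, 0 ≤ q i ω) →
    ∃ Q : Ω → ℝ, BddMeas Q ∧ (∀ ω, 0 ≤ Q ω) ∧
      ∫ ω, Q ω ^ 2 ∂μ ≤ κ * ∑ i, ∫ ω, q i ω ^ 2 ∂μ ∧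
      ∀ ω (n : ℕ) (ψ : Zd d → ℝ),
        (∀ x i, |ψ (x + Pi.single i 1) - ψ x| ≤ q i (D.T x ω)) →
        ∑ y ∈ boxOn s n, |ψ y - ψ 0| ≤ (2 * n + 1) ^ (s.card + 1) * Q ω := by
  induction s using Finset.induction_on with
  | empty =>
    exact ⟨0, le_rfl, fun q _ _ => ⟨fun _ => 0, BddMeas.const 0, fun _ => le_rfl, by simp,
      fun ω n ψ _ => by simp [boxOn_empty]⟩⟩
  | insert a s ha ih =>
    obtain ⟨κ, hκ0, ih⟩ := ih
    refine ⟨2 * (16 ^ s.card * 16) + 2 * κ, by positivity, fun q hq hq0 => ?_⟩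
    obtain ⟨Q1, hQ1, hQ1n, hQ1i, hQ1s⟩ := ih q hq hq0
    obtain ⟨g1, hg1, hg1n, hg1i, hg1s⟩ := h.exists_line_max a (hq a) (hq0 a)
    obtain ⟨g, hg, hgn, hgi, hgs⟩ := h.exists_boxOn_max s g1 hg1 hg1n
    refine ⟨fun ω => g ω + Q1 ω, hg.add hQ1, fun ω => add_nonneg (hgn ω) (hQ1n ω), ?_,
      fun ω n ψ hψ => ?_⟩
    · have hS : ∫ ω, q a ω ^ 2 ∂μ ≤ ∑ i, ∫ ω, q i ω ^ 2 ∂μ :=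
        Finset.single_le_sum (f := fun i => ∫ ω, q i ω ^ 2 ∂μ)
          (fun i _ => integral_nonneg fun ω => sq_nonneg _) (Finset.mem_univ a)
      calc ∫ ω, (g ω + Q1 ω) ^ 2 ∂μ ≤ ∫ ω, (2 * g ω ^ 2 + 2 * Q1 ω ^ 2) ∂μ :=
          integral_mono (hg.add hQ1).sq.integrable
            ((hg.sq.const_mul 2).add (hQ1.sq.const_mul 2)).integrable fun ω => by
              simp only
              nlinarith [sq_nonneg (g ω - Q1 ω)]
        _ = 2 * ∫ ω, g ω ^ 2 ∂μ + 2 * ∫ ω, Q1 ω ^ 2 ∂μ := by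
            rw [integral_add (hg.sq.const_mul 2).integrable (hQ1.sq.const_mul 2).integrable,
              integral_const_mul, integral_const_mul]
        _ ≤ 2 * (16 ^ s.card * (16 * ∑ i, ∫ ω, q i ω ^ 2 ∂μ))
            + 2 * (κ * ∑ i, ∫ ω, q i ω ^ 2 ∂μ) := by
            gcongr
            refine hgi.trans ?_
            gcongr
            exact hg1i.trans (by gcongr)
        _ = _ := by ring
    · rw [Finset.card_insert_of_notMem ha, sum_boxOn_insert ha]
      have hline : ∀ y, ∀ k ∈ Finset.Icc (-(n : ℤ)) n,
          |ψ (y + Pi.single a k) - ψ y| ≤ (2 * n + 1) * g1 (D.T y ω) := fun y k hk => by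
        have h1 := abs_sub_zero_le_sum_Icc (n := n) (φ := fun k => ψ (y + Pi.single a k))
          (b := fun k => q a (D.T (y + Pi.single a k) ω)) (fun k => by
            have := hψ (y + Pi.single a k) a
            rwa [add_assoc, ← Pi.single_add] at this) hk
        have h2 := hg1s (D.T y ω) n
        simp_rw [← h.T_add, add_comm _ y] at h2
        simp only [Pi.single_zero, add_zero] at h1
        exact h1.trans h2
      calc ∑ y ∈ boxOn s n, ∑ k ∈ Finset.Icc (-(n : ℤ)) n, |ψ (y + Pi.single a k) - ψ 0|
          ≤ ∑ y ∈ boxOn s n, ∑ k ∈ Finset.Icc (-(n : ℤ)) n,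
              ((2 * n + 1) * g1 (D.T y ω) + |ψ y - ψ 0|) := by
            refine Finset.sum_le_sum fun y _ => Finset.sum_le_sum fun k hk => ?_
            exact (abs_sub_le _ (ψ y) _).trans (add_le_add (hline y k hk) le_rfl)
        _ = (2 * n + 1) * ((2 * n + 1) * ∑ y ∈ boxOn s n, g1 (D.T y ω)
              + ∑ y ∈ boxOn s n, |ψ y - ψ 0|) := by
            simp only [Finset.sum_const, card_Icc_neg, nsmul_eq_mul]
            rw [← Finset.mul_sum, Finset.sum_add_distrib, ← Finset.mul_sum]
            push_cast
            ring
        _ ≤ (2 * n + 1) * ((2 * n + 1) * ((2 * n + 1) ^ s.card * g ω)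
              + (2 * n + 1) ^ (s.card + 1) * Q1 ω) := by
            gcongr
            · exact hgs ω n
            · exact hQ1s ω n ψ hψ
        _ = _ := by ring

end CycleData.Admissible

lemma sum_abs_sub_le_of_geometric {ι : Type*} {s : Finset ι} {f : ℕ → ι → ℝ} {g : ι → ℝ} {A : ℝ}
    (hf : ∀ l, ∑ y ∈ s, |f (l + 1) y - f l y| ≤ (1 / 2) ^ l * A)
    (hlim : ∀ y ∈ s, Filter.Tendsto (fun k => f k y) Filter.atTop (nhds (g y))) (k : ℕ) :
    ∑ y ∈ s, |g y - f k y| ≤ 2 * (1 / 2) ^ k * A := by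
  have hA : 0 ≤ A := by
    have := (Finset.sum_nonneg fun y _ => abs_nonneg _).trans (hf 0)
    simpa using this
  have h1 : ∀ m, ∑ y ∈ s, |f (m + k) y - f k y| ≤ (2 - 2 * (1 / 2) ^ m) * (1 / 2) ^ k * A :=
    fun m => by
      induction m with
      | zero => simp
      | succ m ih =>
        have h2 : ∑ y ∈ s, |f (m + 1 + k) y - f k y| ≤ ∑ y ∈ s, |f (m + k + 1) y - f (m + k) y|
            + ∑ y ∈ s, |f (m + k) y - f k y| := by
          rw [← Finset.sum_add_distrib]
          refine Finset.sum_le_sum fun y _ => ?_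
          rw [show m + 1 + k = m + k + 1 by ring]
          exact abs_sub_le _ _ _
        have h3 := hf (m + k)
        rw [pow_add] at h3
        calc _ ≤ _ := h2
          _ ≤ _ := add_le_add h3 ih
          _ = _ := by rw [pow_succ]; ring
  have hlim2 : Filter.Tendsto (fun m => ∑ y ∈ s, |f (m + k) y - f k y|) Filter.atTop
      (nhds (∑ y ∈ s, |g y - f k y|)) :=
    tendsto_finsetSum _ fun y hy =>
      (((hlim y hy).comp (Filter.tendsto_add_atTop_nat k)).sub_const _).abs
  refine le_of_tendsto hlim2 (Filter.Eventually.of_forall fun m => (h1 m).trans ?_)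
  have : (0 : ℝ) ≤ (1 / 2) ^ m * ((1 / 2) ^ k * A) := by positivity
  linarith

lemma exists_mem_box {d : ℕ} (x : Zd d) : ∃ n : ℕ, x ∈ box d n := by
  refine ⟨∑ i, (x i).natAbs, mem_box.2 fun i => ?_⟩
  have h1 : (x i).natAbs ≤ ∑ i, (x i).natAbs :=
    Finset.single_le_sum (f := fun i => (x i).natAbs) (fun _ _ => Nat.zero_le _)
      (Finset.mem_univ i)
  rw [Int.abs_eq_natAbs]
  exact_mod_cast h1

lemma card_box {d n : ℕ} : (box d n).card = (2 * n + 1) ^ d := by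
  rw [box, Fintype.card_piFinset]
  simp only [card_Icc_neg, Finset.prod_const, Finset.card_univ, Fintype.card_fin]

/-- A function on the lattice that is close, on average over cubes, to bounded functions is
sublinear outside a set of vanishing density. -/
lemma sublinear_of_approx {d : ℕ} {χ : Zd d → ℝ} {f : ℕ → Zd d → ℝ} {B : ℕ → ℝ} {G : ℝ}
    (hB : ∀ k y, |f k y| ≤ B k)
    (happ : ∀ k n : ℕ, ∑ y ∈ box d n, |χ y - f k y| ≤ 2 * (1 / 2) ^ k * ((2 * n + 1) ^ (d + 1) * G))
    {η δ : ℝ} (hη : 0 < η) (hδ : 0 < δ) :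
    ∃ n₀ : ℕ, ∀ n ≥ n₀, (((box d n).filter (fun y => η * n < |χ y|)).card : ℝ) ≤ δ * n ^ d := by
  have hG : 0 ≤ G := by
    have := (Finset.sum_nonneg fun y _ => abs_nonneg _).trans (happ 0 0)
    simp at this
    linarith
  obtain ⟨k, hk⟩ : ∃ k : ℕ, 2 * (1 / 2 : ℝ) ^ k * (3 ^ (d + 1) * G) ≤ η * δ / 2 := by
    have h1 : Filter.Tendsto (fun k : ℕ => 2 * (1 / 2 : ℝ) ^ k * (3 ^ (d + 1) * G)) Filter.atTop
        (nhds (2 * 0 * (3 ^ (d + 1) * G))) :=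
      ((tendsto_pow_atTop_nhds_zero_of_lt_one (by norm_num) (by norm_num)).const_mul 2).mul_const _
    obtain ⟨k, hk⟩ := (h1.eventually_lt_const (u := η * δ / 2) (by
      rw [mul_zero, zero_mul]; positivity)).exists
    exact ⟨k, hk.le⟩
  obtain ⟨n₀, hn₀⟩ := exists_nat_ge (2 * 3 ^ d * B k / (η * δ))
  refine ⟨max n₀ 1, fun n hn => ?_⟩
  have hn1 : (1 : ℝ) ≤ n := by exact_mod_cast (le_max_right _ _).trans hn
  have hn2 : (n₀ : ℝ) ≤ n := by exact_mod_cast (le_max_left _ _).trans hn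
  have hBn : 3 ^ d * B k ≤ η * δ / 2 * n := by
    have := hn₀.trans hn2
    rw [div_le_iff₀ (by positivity)] at this
    linarith
  have hBk : 0 ≤ B k := (abs_nonneg _).trans (hB k 0)
  have h3 : (2 * n + 1 : ℝ) ≤ 3 * n := by linarith
  have h4 : ∑ y ∈ box d n, |χ y| ≤ η * δ * (n : ℝ) ^ (d + 1) := by
    calc ∑ y ∈ box d n, |χ y| ≤ ∑ y ∈ box d n, (|χ y - f k y| + B k) := by
          refine Finset.sum_le_sum fun y _ => ?_
          have := abs_sub_abs_le_abs_sub (χ y) (f k y)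
          linarith [hB k y]
      _ = ∑ y ∈ box d n, |χ y - f k y| + (2 * n + 1) ^ d * B k := by
          rw [Finset.sum_add_distrib, Finset.sum_const, card_box, nsmul_eq_mul]
          push_cast
          ring
      _ ≤ 2 * (1 / 2) ^ k * ((3 * n) ^ (d + 1) * G) + (3 * n) ^ d * B k := by
          refine add_le_add ((happ k n).trans ?_) ?_ <;> gcongr
      _ = (2 * (1 / 2) ^ k * (3 ^ (d + 1) * G)) * n ^ (d + 1) + (3 ^ d * B k) * n ^ d := by
          rw [mul_pow, mul_pow]; ring
      _ ≤ (η * δ / 2) * n ^ (d + 1) + (η * δ / 2 * n) * n ^ d := by gcongr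
      _ = _ := by ring
  have h5 : (((box d n).filter (fun y => η * n < |χ y|)).card : ℝ) * (η * n)
      ≤ ∑ y ∈ box d n, |χ y| := by
    rw [← nsmul_eq_mul]
    refine (Finset.card_nsmul_le_sum _ _ _ fun y hy => (Finset.mem_filter.1 hy).2.le).trans ?_
    exact Finset.sum_le_sum_of_subset_of_nonneg (Finset.filter_subset _ _) fun _ _ _ => abs_nonneg _
  have h6 : (((box d n).filter (fun y => η * n < |χ y|)).card : ℝ) * (η * n)
      ≤ (δ * n ^ d) * (η * n) := h5.trans (h4.trans (le_of_eq (by ring)))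
  exact le_of_mul_le_mul_right h6 (by positivity)

namespace CycleData

variable {d K : ℕ} {Ω : Type*} [MeasurableSpace Ω] {D : CycleData d K Ω} {μ : Measure Ω}
  {c C ε : ℝ} {N : ℕ}

/-- The corrector in direction `i`, together with its approximation by coboundaries. -/
structure IsCorrector (D : CycleData d K Ω) (μ : Measure Ω) (i : Fin d) (χ : Zd d → Ω → ℝ)
    (u : ℕ → Ω → ℝ) : Prop where
  bddMeas : ∀ k, BddMeas (u k)
  meas : ∀ x, Measurable (χ x)
  sq_integrable : ∀ x, Integrable (fun ω => χ x ω ^ 2) μ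
  approx : ∀ x, Filter.Tendsto (fun k => ∫ ω, (χ x ω - (u k (D.T x ω) - u k ω)) ^ 2 ∂μ)
    Filter.atTop (nhds 0)
  cocycle : ∀ᵐ ω ∂μ, ∀ x y, χ (x + y) ω = χ x (D.T y ω) + χ y ω
  harmonic : ∀ᵐ ω ∂μ, ∑ v ∈ D.jumps, D.p v ω * ((v i : ℝ) + χ v ω) = 0
  sublinear : ∀ᵐ ω ∂μ, ∀ η > 0, ∀ δ > 0, ∃ n₀ : ℕ, ∀ n ≥ n₀,
    (((box d n).filter (fun y => η * n < |χ y ω|)).card : ℝ) ≤ δ * n ^ d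

namespace Admissible

lemma ae_forall_T (h : D.Admissible μ c C ε N) {P : Ω → Prop} (hP : ∀ᵐ ω ∂μ, P ω) :
    ∀ᵐ ω ∂μ, ∀ x, P (D.T x ω) :=
  ae_all_iff.2 fun x => (h.pres x).quasiMeasurePreserving.ae hP

variable [IsProbabilityMeasure μ]

lemma integral_increment_sq_le (h : D.Admissible μ c C ε N) {w : Ω → ℝ} (hw : BddMeas w)
    (i : Fin d) :
    ∫ ω, |w (D.T (Pi.single i 1) ω) - w ω| ^ 2 ∂μ ≤ coerConst c ε N * D.dir μ w := by
  simp_rw [sq_abs]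
  refine h.integral_cocycle_sq_le (G := fun x ω => w (D.T x ω) - w ω) (fun x y ω => ?_)
    (fun v _ => ((h.bddMeas_comp hw v).sub hw).sq.integrable) i
  rw [h.T_add]
  ring

/-- Increments of a rapidly converging sequence are dominated on average over cubes. -/
lemma exists_increment_dominating (h : D.Admissible μ c C ε N) {u : ℕ → Ω → ℝ}
    (hu : ∀ k, BddMeas (u k)) (hdir : ∀ k, D.dir μ (u (k + 1) - u k) ≤ (1 / 16) ^ k) :
    ∃ G : Ω → ℝ, Measurable G ∧ (∀ ω, 0 ≤ G ω) ∧ Integrable (fun ω => G ω ^ 2) μ ∧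
      ∀ᵐ ω ∂μ, ∀ n l : ℕ, ∑ y ∈ box d n, |(u (l + 1) (D.T y ω) - u (l + 1) ω)
        - (u l (D.T y ω) - u l ω)| ≤ (1 / 2) ^ l * ((2 * n + 1) ^ (d + 1) * G ω) := by
  obtain ⟨κ, hκ0, hκ⟩ := h.exists_path_max_on Finset.univ
  have hw : ∀ l, BddMeas (u (l + 1) - u l) := fun l => (hu (l + 1)).sub (hu l)
  choose Q hQ hQ0 hQi hQs using fun l => hκ
    (fun i ω => |(u (l + 1) - u l) (D.T (Pi.single i 1) ω) - (u (l + 1) - u l) ω|)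
    (fun i => ((h.bddMeas_comp (hw l) _).sub (hw l)).abs) fun i ω => abs_nonneg _
  obtain ⟨G, hG, hG0, hGi, hGQ⟩ := exists_L2_dominating (μ := μ) Q (fun l => (hQ l).1)
    (fun l => (hQ l).sq.integrable) (κ * (d * coerConst c ε N)) fun l => by
      refine (hQi l).trans ?_
      rw [mul_assoc]
      refine mul_le_mul_of_nonneg_left ?_ hκ0
      calc _ ≤ ∑ i : Fin d, coerConst c ε N * (1 / 16) ^ l :=
            Finset.sum_le_sum fun i _ => (h.integral_increment_sq_le (hw l) i).trans
              (mul_le_mul_of_nonneg_left (hdir l) h.coerConst_nonneg)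
        _ = _ := by simp [mul_assoc]
  refine ⟨G, hG, hG0, hGi, ?_⟩
  filter_upwards [hGQ] with ω hω n l
  have h1 := hQs l ω n (fun y => (u (l + 1) - u l) (D.T y ω)) fun x i => by
    rw [add_comm x, h.T_add]
  rw [boxOn_univ, Finset.card_univ, Fintype.card_fin] at h1
  simp only [h.T_zero, Pi.sub_apply] at h1
  calc _ = ∑ y ∈ box d n, |u (l + 1) (D.T y ω) - u l (D.T y ω) - (u (l + 1) ω - u l ω)| :=
        Finset.sum_congr rfl fun y _ => by congr 1; ring
    _ ≤ (2 * n + 1) ^ (d + 1) * Q l ω := h1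
    _ ≤ (2 * n + 1) ^ (d + 1) * ((1 / 2) ^ l * G ω) := by
        gcongr
        exact (le_abs_self _).trans (hω l)
    _ = _ := by ring

lemma exists_isCorrector (h : D.Admissible μ c C ε N) (i : Fin d) :
    ∃ χ u, D.IsCorrector μ i χ u := by
  obtain ⟨u, hu, hres, hdir⟩ := h.exists_corrector_seq i
  obtain ⟨G, hG, hG0, hGi, hGs⟩ := h.exists_increment_dominating hu hdir
  have hDm : ∀ x k, Measurable fun ω => u k (D.T x ω) - u k ω := fun x k =>
    ((hu k).1.comp (h.T_meas x)).sub (hu k).1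
  choose n hn using fun x : Zd d => exists_mem_box x
  set A : Zd d → ℝ := fun x => (2 * n x + 1) ^ (d + 1) with hA
  have hA0 : ∀ x, 0 ≤ A x := fun x => by positivity
  have hlim : ∀ x, ∃ χ : Ω → ℝ, Measurable χ ∧ ∀ᵐ ω ∂μ,
      Filter.Tendsto (fun k => u k (D.T x ω) - u k ω) Filter.atTop (nhds (χ ω)) := fun x => by
    refine measurable_limit_of_tendsto_metrizable_ae (fun k => (hDm x k).aemeasurable) ?_
    filter_upwards [hGs] with ω hω
    refine cauchySeq_tendsto_of_complete
      (cauchySeq_of_le_geometric (1 / 2) (A x * G ω) (by norm_num) fun l => ?_)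
    rw [dist_comm, Real.dist_eq]
    refine le_trans ?_ ((hω (n x) l).trans (le_of_eq (mul_comm _ _)))
    exact Finset.single_le_sum (f := fun y => |(u (l + 1) (D.T y ω) - u (l + 1) ω)
        - (u l (D.T y ω) - u l ω)|) (fun _ _ => abs_nonneg _) (hn x)
  choose χ hχm hχ using hlim
  have hχ' : ∀ᵐ ω ∂μ, ∀ x,
      Filter.Tendsto (fun k => u k (D.T x ω) - u k ω) Filter.atTop (nhds (χ x ω)) :=
    ae_all_iff.2 hχ
  have happ : ∀ᵐ ω ∂μ, ∀ k m : ℕ, ∑ y ∈ box d m, |χ y ω - (u k (D.T y ω) - u k ω)|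
      ≤ 2 * (1 / 2) ^ k * ((2 * m + 1) ^ (d + 1) * G ω) := by
    filter_upwards [hGs, hχ'] with ω h1 h2 k m
    exact sum_abs_sub_le_of_geometric (f := fun k y => u k (D.T y ω) - u k ω) (h1 m)
      (fun y _ => h2 y) k
  have hsq : ∀ x k, ∀ᵐ ω ∂μ, (χ x ω - (u k (D.T x ω) - u k ω)) ^ 2
      ≤ (2 * (1 / 2) ^ k * A x) ^ 2 * G ω ^ 2 := fun x k => by
    filter_upwards [happ] with ω hω
    have h1 : |χ x ω - (u k (D.T x ω) - u k ω)| ≤ 2 * (1 / 2) ^ k * (A x * G ω) :=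
      le_trans (Finset.single_le_sum (f := fun y => |χ y ω - (u k (D.T y ω) - u k ω)|)
        (fun _ _ => abs_nonneg _) (hn x)) (hω k (n x))
    rw [← sq_abs, ← mul_pow]
    exact pow_le_pow_left₀ (abs_nonneg _) (h1.trans (le_of_eq (by ring))) 2
  have hdm : ∀ x k, Measurable fun ω => (χ x ω - (u k (D.T x ω) - u k ω)) ^ 2 := fun x k =>
    ((hχm x).sub (hDm x k)).pow_const 2
  have hdi : ∀ x k, Integrable (fun ω => (χ x ω - (u k (D.T x ω) - u k ω)) ^ 2) μ := fun x k => by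
    refine (hGi.const_mul ((2 * (1 / 2) ^ k * A x) ^ 2)).mono' (hdm x k).aestronglyMeasurable ?_
    filter_upwards [hsq x k] with ω hω
    rwa [Real.norm_eq_abs, abs_of_nonneg (sq_nonneg _)]
  refine ⟨χ, u, hu, hχm, fun x => ?_, fun x => ?_, ?_, ?_, ?_⟩
  · have hb := (((h.bddMeas_comp (hu 0) x).sub (hu 0)).sq.integrable (μ := μ))
    refine (((hdi x 0).const_mul 2).add (hb.const_mul 2)).mono'
      ((hχm x).pow_const 2).aestronglyMeasurable (Filter.Eventually.of_forall fun ω => ?_)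
    rw [Real.norm_eq_abs, abs_of_nonneg (sq_nonneg _)]
    simp only [Pi.add_apply]
    nlinarith [sq_nonneg (χ x ω - 2 * (u 0 (D.T x ω) - u 0 ω))]
  · have h1 : ∀ k, ∫ ω, (χ x ω - (u k (D.T x ω) - u k ω)) ^ 2 ∂μ
        ≤ (2 * (1 / 2) ^ k * A x) ^ 2 * ∫ ω, G ω ^ 2 ∂μ := fun k => by
      rw [← integral_const_mul]
      exact integral_mono_ae (hdi x k) (hGi.const_mul _) (hsq x k)
    have h2 : Filter.Tendsto (fun k : ℕ => (2 * (1 / 2 : ℝ) ^ k * A x) ^ 2 * ∫ ω, G ω ^ 2 ∂μ)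
        Filter.atTop (nhds ((2 * 0 * A x) ^ 2 * ∫ ω, G ω ^ 2 ∂μ)) :=
      ((((tendsto_pow_atTop_nhds_zero_of_lt_one (by norm_num) (by norm_num)).const_mul
        2).mul_const _).pow 2).mul_const _
    refine squeeze_zero (fun k => integral_nonneg fun ω => sq_nonneg _) h1 ?_
    simpa using h2
  · filter_upwards [hχ', h.ae_forall_T hχ'] with ω h1 h2 x y
    refine tendsto_nhds_unique (h1 (x + y)) (((h2 y x).add (h1 y)).congr fun k => ?_)
    rw [h.T_add]
    ring
  · obtain ⟨G', -, -, -, hG'⟩ := exists_L2_dominating (μ := μ)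
      (fun k ω => D.drift i ω - (u k ω - D.avg (u k) ω))
      (fun k => (h.bddMeas_drift i).1.sub ((hu k).1.sub (h.avg_meas (hu k).1)))
      (fun k => ((h.bddMeas_drift i).sub ((hu k).sub (h.bddMeas_avg (hu k)))).sq.integrable)
      1 (fun k => by rw [one_mul]; exact hres k)
    filter_upwards [hχ', hG'] with ω h1 h2
    have h3 : Filter.Tendsto (fun k => D.drift i ω - (u k ω - D.avg (u k) ω)) Filter.atTop
        (nhds 0) := by
      refine squeeze_zero_norm h2 ?_
      simpa using (tendsto_pow_atTop_nhds_zero_of_lt_one (r := (1 / 2 : ℝ)) (by norm_num)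
        (by norm_num)).mul_const (G' ω)
    have h4 : Filter.Tendsto (fun k => ∑ v ∈ D.jumps, D.p v ω * ((v i : ℝ)
        + (u k (D.T v ω) - u k ω))) Filter.atTop
        (nhds (∑ v ∈ D.jumps, D.p v ω * ((v i : ℝ) + χ v ω))) :=
      tendsto_finsetSum _ fun v _ => ((h1 v).const_add _).const_mul _
    refine tendsto_nhds_unique h4 (h3.congr fun k => ?_)
    have h5 : ∑ v ∈ D.jumps, D.p v ω * u k ω = u k ω := by
      rw [← Finset.sum_mul, h.sum_p, one_mul]
    simp only [mul_add, mul_sub, Finset.sum_add_distrib, Finset.sum_sub_distrib, h5, drift, avg,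
      smul_eq_mul]
    ring
  · choose _ B hB using hu
    filter_upwards [happ] with ω hω η hη δ hδ
    exact sublinear_of_approx (f := fun k y => u k (D.T y ω) - u k ω) (B := fun k => 2 * B k)
      (fun k y => (abs_sub _ _).trans (by linarith [hB k (D.T y ω), hB k ω])) hω hη hδ

end Admissible

end CycleData

namespace CycleData

namespace Admissible

variable {d K : ℕ} {Ω : Type*} [MeasurableSpace Ω] {D : CycleData d K Ω} {μ : Measure Ω}
  {c C ε : ℝ} {N : ℕ}

lemma iterate_avg_sub_const (h : D.Admissible μ c C ε N) (g : Ω → ℝ) (l : ℝ) (k : ℕ) :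
    D.avg^[k] (fun ω => g ω - l) = fun ω => D.avg^[k] g ω - l := by
  induction k with
  | zero => rfl
  | succ k ih =>
    rw [Function.iterate_succ_apply', ih, Function.iterate_succ_apply']
    funext ω
    rw [avg_sub (D.avg^[k] g) (fun _ => l), h.avg_const]

lemma sum_iterate_avg_le_hopfMax (h : D.Admissible μ c C ε N) (f : Ω → ℝ) (n : ℕ) :
    ∀ ω, ∑ k ∈ Finset.range n, D.avg^[k] f ω ≤ hopfMax D.avg f n ω := by
  induction n with
  | zero => exact fun ω => le_of_eq (by simp [hopfMax])
  | succ n ih =>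
    intro ω
    refine le_trans ?_ (le_max_right _ _)
    rw [Finset.sum_range_succ', add_comm]
    refine add_le_add le_rfl ?_
    refine le_trans (le_of_eq ?_) (h.avg_mono ih ω)
    rw [avg_sum]
    simp only [Function.iterate_succ_apply']

variable [IsProbabilityMeasure μ]

/-- The maximal ergodic inequality for the environment chain. -/
lemma measure_sum_iterate_avg_le (h : D.Admissible μ c C ε N) {g : Ω → ℝ} (hg : Measurable g)
    (hgi : Integrable g μ) (hg0 : ∀ ω, 0 ≤ g ω) {l : ℝ} (hl : 0 < l) :
    μ {ω | ∃ n : ℕ, l * n < ∑ k ∈ Finset.range n, D.avg^[k] g ω}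
      ≤ ENNReal.ofReal (C / (c * l) * ∫ ω, g ω ∂μ) := by
  have hfm : Measurable fun ω => g ω - l := hg.sub_const l
  have hfi : Integrable (fun ω => g ω - l) μ := hgi.sub (integrable_const l)
  have hmeas : ∀ n, Measurable (hopfMax D.avg (fun ω => g ω - l) n) := fun n => by
    induction n with
    | zero => exact measurable_const
    | succ n ih => exact measurable_const.max (hfm.add (h.avg_meas ih))
  have hE : ∀ n, MeasurableSet {ω | 0 < hopfMax D.avg (fun ω => g ω - l) n ω} := fun n =>
    measurableSet_lt measurable_const (hmeas n)
  have hmono : Monotone fun n => {ω | 0 < hopfMax D.avg (fun ω => g ω - l) n ω} :=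
    monotone_nat_of_le_succ fun n ω hω =>
      lt_of_lt_of_le hω (hopfMax_le_succ (fun f g hfg => h.avg_mono hfg) _ n ω)
  have hbound : ∀ n, μ {ω | 0 < hopfMax D.avg (fun ω => g ω - l) n ω}
      ≤ ENNReal.ofReal (C / (c * l) * ∫ ω, g ω ∂μ) := fun n => by
    have h1 := hopf_maximal (μ := μ) (R := D.avg) (w := D.M) (fun f g hfg => h.avg_mono hfg)
      (fun f hf => h.avg_meas hf) (fun f hf => h.integrable_avg hf) h.bddMeas_M
      (fun ω => (h.M_pos ω).le) (fun f hf => h.integral_M_mul_avg hf) hfm hfi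
      (fun ω => h.avg_const 0 ω) n
    have h2 : ∫ ω, (if 0 < hopfMax D.avg (fun ω => g ω - l) n ω then D.M ω * (g ω - l) else 0) ∂μ
        ≤ ∫ ω, (C * g ω - {ω | 0 < hopfMax D.avg (fun ω => g ω - l) n ω}.indicator
          (fun _ => c * l) ω) ∂μ := by
      refine integral_mono ?_ ((hgi.const_mul C).sub ((integrable_const _).indicator (hE n)))
        fun ω => ?_
      · exact (h.integrable_M_mul hfi).indicator (hE n)
      · have h3 := h.M_lower ω
        have h4 := h.M_upper ω
        have h5 := h.c_pos
        by_cases hω : 0 < hopfMax D.avg (fun ω => g ω - l) n ω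
        · simp only [hω, if_true, Set.indicator, Set.mem_ofPred_eq]
          nlinarith [hg0 ω]
        · simp only [hω, if_false, Set.indicator, Set.mem_ofPred_eq]
          nlinarith [hg0 ω]
    rw [integral_sub (hgi.const_mul C) ((integrable_const _).indicator (hE n)),
      integral_const_mul, integral_indicator_const _ (hE n), smul_eq_mul] at h2
    have hcl : 0 < c * l := mul_pos h.c_pos hl
    rw [← ofReal_measureReal]
    refine ENNReal.ofReal_le_ofReal ?_
    rw [div_mul_eq_mul_div, le_div_iff₀ hcl]
    linarith
  calc μ {ω | ∃ n : ℕ, l * n < ∑ k ∈ Finset.range n, D.avg^[k] g ω}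
      ≤ μ (⋃ n, {ω | 0 < hopfMax D.avg (fun ω => g ω - l) n ω}) := by
        refine measure_mono fun ω hω => ?_
        obtain ⟨n, hn⟩ := hω
        refine Set.mem_iUnion.2 ⟨n, lt_of_lt_of_le ?_ (h.sum_iterate_avg_le_hopfMax _ n ω)⟩
        simp only [h.iterate_avg_sub_const, Finset.sum_sub_distrib, Finset.sum_const,
          Finset.card_range, nsmul_eq_mul]
        linarith
    _ ≤ _ := by
        rw [hmono.measure_iUnion]
        exact iSup_le hbound

lemma exists_coboundary_near_of_bddMeas (h : D.Admissible μ c C ε N) {i : Fin d}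
    (herg : Ergodic (D.T (Pi.single i 1)) μ) {f : Ω → ℝ} (hf : BddMeas f)
    (hf0 : ∫ ω, D.M ω * f ω ∂μ = 0) {δ : ℝ} (hδ : 0 < δ) :
    ∃ u, BddMeas u ∧ ∫ ω, |f ω - (u ω - D.avg u ω)| ∂μ ≤ δ := by
  obtain ⟨u, hu, hdir, hrap⟩ := h.exists_coboundary_seq hf
  set g : ℕ → Ω → ℝ := fun k ω => f ω - (u k ω - D.avg (u k) ω) with hgdef
  have hg : ∀ k, BddMeas (g k) := fun k => hf.sub ((hu k).sub (h.bddMeas_avg (hu k)))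
  obtain ⟨G, hGm, hG0, hGi, hG⟩ := exists_L2_dominating (μ := μ) (fun k ω => g (k + 1) ω - g k ω)
    (fun k => (hg _).1.sub (hg _).1) (fun k => ((hg _).sub (hg _)).sq.integrable) 1
    fun k => by rw [one_mul]; exact hrap k
  obtain ⟨G', -, -, -, hG'⟩ := exists_L2_dominating (μ := μ)
    (fun k ω => g k (D.T (Pi.single i 1) ω) - g k ω)
    (fun k => ((h.bddMeas_comp (hg k) _).sub (hg k)).1)
    (fun k => ((h.bddMeas_comp (hg k) _).sub (hg k)).sq.integrable) (coerConst c ε N)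
    fun k => by
      have h1 := h.integral_increment_sq_le (hg k) i
      simp_rw [sq_abs] at h1
      exact h1.trans (mul_le_mul_of_nonneg_left (hdir k) h.coerConst_nonneg)
  have hGint : Integrable G μ := by
    refine ((integrable_const (1 : ℝ)).add hGi).mono' hGm.aestronglyMeasurable
      (Filter.Eventually.of_forall fun ω => ?_)
    rw [Real.norm_eq_abs, abs_of_nonneg (hG0 ω)]
    simp only [Pi.add_apply]
    nlinarith [sq_nonneg (G ω - 1)]
  have hdist : ∀ᵐ ω ∂μ, ∀ k, dist (g k ω) (g (k + 1) ω) ≤ G ω * (1 / 2) ^ k := by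
    filter_upwards [hG] with ω hω k
    rw [dist_comm, Real.dist_eq, mul_comm]
    exact hω k
  obtain ⟨gl, hglm, hgl⟩ := measurable_limit_of_tendsto_metrizable_ae
    (fun k => (hg k).1.aemeasurable (μ := μ)) (by
      filter_upwards [hdist] with ω hω
      exact cauchySeq_tendsto_of_complete (cauchySeq_of_le_geometric (1 / 2) (G ω)
        (by norm_num) hω))
  have hinv : gl ∘ D.T (Pi.single i 1) =ᵐ[μ] gl := by
    filter_upwards [hgl, (h.pres (Pi.single i 1)).quasiMeasurePreserving.ae hgl, hG'] with ω h1 h2 h3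
    have h4 : Filter.Tendsto (fun k => g k (D.T (Pi.single i 1) ω) - g k ω) Filter.atTop
        (nhds 0) := by
      refine squeeze_zero_norm h3 ?_
      simpa using (tendsto_pow_atTop_nhds_zero_of_lt_one (r := (1 / 2 : ℝ)) (by norm_num)
        (by norm_num)).mul_const (G' ω)
    exact sub_eq_zero.1 (tendsto_nhds_unique (h2.sub h1) h4)
  obtain ⟨a, ha⟩ := herg.ae_eq_const_of_ae_eq_comp_ae hglm.aestronglyMeasurable hinv
  have hclose : ∀ k, ∀ᵐ ω ∂μ, |g k ω - a| ≤ 2 * (1 / 2) ^ k * G ω := fun k => by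
    filter_upwards [hdist, hgl, ha] with ω h1 h2 h3
    have h4 := dist_le_of_le_geometric_of_tendsto (1 / 2) (G ω) (by norm_num) h1 h2 k
    rw [h3, Real.dist_eq] at h4
    refine h4.trans (le_of_eq ?_)
    ring
  have hintg : ∀ k, ∫ ω, |g k ω - a| ∂μ ≤ 2 * (1 / 2) ^ k * ∫ ω, G ω ∂μ := fun k => by
    rw [← integral_const_mul]
    exact integral_mono_ae ((hg k).sub (.const a)).abs.integrable (hGint.const_mul _) (hclose k)
  have hlim : Filter.Tendsto (fun k : ℕ => 2 * (1 / 2 : ℝ) ^ k * ∫ ω, G ω ∂μ) Filter.atTop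
      (nhds 0) := by
    simpa using ((tendsto_pow_atTop_nhds_zero_of_lt_one (r := (1 / 2 : ℝ)) (by norm_num)
        (by norm_num)).const_mul 2).mul_const (∫ ω, G ω ∂μ)
  have hMg : ∀ k, ∫ ω, D.M ω * g k ω ∂μ = 0 := fun k => by
    have h1 : ∀ ω, D.M ω * g k ω = D.M ω * f ω - (D.M ω * u k ω - D.M ω * D.avg (u k) ω) :=
      fun ω => by simp only [hgdef]; ring
    have hi1 := (h.bddMeas_M.mul hf).integrable (μ := μ)
    have hi2 := (h.bddMeas_M.mul (hu k)).integrable (μ := μ)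
    have hi3 := (h.bddMeas_M.mul (h.bddMeas_avg (hu k))).integrable (μ := μ)
    have hi4 : Integrable (fun ω => D.M ω * u k ω - D.M ω * D.avg (u k) ω) μ := hi2.sub hi3
    simp_rw [h1]
    rw [integral_sub hi1 hi4, integral_sub hi2 hi3, hf0,
      h.integral_M_mul_avg (hu k).integrable]
    ring
  have ha0 : a = 0 := by
    have hMp : 0 < ∫ ω, D.M ω ∂μ := by
      refine h.c_pos.trans_le ?_
      calc c = ∫ ω, c ∂μ := by simp
        _ ≤ _ := integral_mono (integrable_const c) h.bddMeas_M.integrable h.M_lower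
    have h1 : ∀ k, |a * ∫ ω, D.M ω ∂μ| ≤ C * (2 * (1 / 2) ^ k * ∫ ω, G ω ∂μ) := fun k => by
      have hC : 0 ≤ C := by
        obtain ⟨ω⟩ : Nonempty Ω := nonempty_of_isProbabilityMeasure μ
        exact (h.M_pos ω).le.trans (h.M_upper ω)
      have h2 : a * ∫ ω, D.M ω ∂μ = - ∫ ω, D.M ω * (g k ω - a) ∂μ := by
        simp_rw [mul_sub]
        rw [integral_sub (h.bddMeas_M.mul (hg k)).integrable
          (h.bddMeas_M.mul (.const a)).integrable, hMg, integral_mul_const]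
        ring
      rw [h2, abs_neg]
      refine le_trans abs_integral_le_integral_abs ?_
      refine le_trans ?_ (mul_le_mul_of_nonneg_left (hintg k) hC)
      rw [← integral_const_mul]
      refine integral_mono (h.bddMeas_M.mul ((hg k).sub (.const a))).abs.integrable
        (((hg k).sub (.const a)).abs.integrable.const_mul C) fun ω => ?_
      simp only [abs_mul, abs_of_pos (h.M_pos ω)]
      exact mul_le_mul_of_nonneg_right (h.M_upper ω) (abs_nonneg _)
    have h2 : |a * ∫ ω, D.M ω ∂μ| ≤ 0 := by
      refine ge_of_tendsto (hlim.const_mul C) ?_ |>.trans (mul_zero C).le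
      exact Filter.Eventually.of_forall h1
    have h3 := abs_nonpos_iff.1 h2
    exact (mul_eq_zero.1 h3).resolve_right hMp.ne'
  obtain ⟨k, hk⟩ := (hlim.eventually_lt_const hδ).exists
  refine ⟨u k, hu k, ?_⟩
  have := (hintg k).trans hk.le
  simpa only [ha0, sub_zero] using this

lemma exists_coboundary_near (h : D.Admissible μ c C ε N) {i : Fin d}
    (herg : Ergodic (D.T (Pi.single i 1)) μ) {f : Ω → ℝ} (hf : Measurable f)
    (hfi : Integrable f μ) (hf0 : ∫ ω, D.M ω * f ω ∂μ = 0) {δ : ℝ} (hδ : 0 < δ) :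
    ∃ u, BddMeas u ∧ ∫ ω, |f ω - (u ω - D.avg u ω)| ∂μ ≤ δ := by
  have hMp : c ≤ ∫ ω, D.M ω ∂μ := by
    calc c = ∫ ω, c ∂μ := by simp
      _ ≤ _ := integral_mono (integrable_const c) h.bddMeas_M.integrable h.M_lower
  have hC : 0 ≤ C := by
    obtain ⟨ω⟩ : Nonempty Ω := nonempty_of_isProbabilityMeasure μ
    exact (h.M_pos ω).le.trans (h.M_upper ω)
  set F : ℕ → Ω → ℝ := fun n ω => if |f ω| ≤ n then f ω else 0 with hF
  have hFb : ∀ n, BddMeas (F n) := fun n => by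
    refine ⟨Measurable.ite (measurableSet_le hf.abs measurable_const) hf measurable_const, n,
      fun ω => ?_⟩
    simp only [hF]
    split_ifs with h1
    · exact h1
    · simp
  have htend : Filter.Tendsto (fun n => ∫ ω, |f ω - F n ω| ∂μ) Filter.atTop (nhds 0) := by
    have h1 : Filter.Tendsto (fun n => ∫ ω, |f ω - F n ω| ∂μ) Filter.atTop
        (nhds (∫ _, (0 : ℝ) ∂μ)) := by
      refine tendsto_integral_of_dominated_convergence (fun ω => |f ω|)
        (fun n => (hf.sub (hFb n).1).abs.aestronglyMeasurable) hfi.abs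
        (fun n => Filter.Eventually.of_forall fun ω => ?_)
        (Filter.Eventually.of_forall fun ω => ?_)
      · simp only [hF, Real.norm_eq_abs, abs_abs]
        split_ifs <;> simp
      · obtain ⟨m, hm⟩ := exists_nat_ge |f ω|
        refine tendsto_const_nhds.congr' ?_
        filter_upwards [Filter.eventually_ge_atTop m] with n hn
        have : |f ω| ≤ n := hm.trans (by exact_mod_cast hn)
        simp [hF, this]
    simpa using h1
  have hpos : 0 < δ / 2 / (1 + C / c) := by
    have := div_nonneg hC h.c_pos.le
    positivity
  obtain ⟨n, hn⟩ := (htend.eventually_lt_const hpos).exists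
  set a : ℝ := (∫ ω, D.M ω * F n ω ∂μ) / ∫ ω, D.M ω ∂μ with ha
  have hMi : Integrable (fun ω => D.M ω * F n ω) μ := (h.bddMeas_M.mul (hFb n)).integrable
  have habs : |a| ≤ C / c * ∫ ω, |f ω - F n ω| ∂μ := by
    have h1 : |∫ ω, D.M ω * F n ω ∂μ| ≤ C * ∫ ω, |f ω - F n ω| ∂μ := by
      have h2 : ∫ ω, D.M ω * F n ω ∂μ = - ∫ ω, D.M ω * (f ω - F n ω) ∂μ := by
        simp_rw [mul_sub]
        rw [integral_sub (h.integrable_M_mul hfi) hMi, hf0]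
        ring
      rw [h2, abs_neg, ← integral_const_mul]
      refine abs_integral_le_integral_abs.trans ?_
      have hsub := hfi.sub ((hFb n).integrable (μ := μ))
      refine integral_mono (h.integrable_M_mul hsub).abs (hsub.abs.const_mul C) fun ω => ?_
      simp only [abs_mul, abs_of_pos (h.M_pos ω)]
      exact mul_le_mul_of_nonneg_right (h.M_upper ω) (abs_nonneg _)
    rw [ha, abs_div, abs_of_pos (h.c_pos.trans_le hMp), div_mul_eq_mul_div]
    exact div_le_div₀ (mul_nonneg hC (integral_nonneg fun _ => abs_nonneg _)) h1 h.c_pos hMp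
  obtain ⟨u, hu, hub⟩ := h.exists_coboundary_near_of_bddMeas herg ((hFb n).sub (.const a))
    (by
      simp_rw [mul_sub]
      rw [integral_sub hMi (h.bddMeas_M.mul (.const a)).integrable, integral_mul_const, ha,
        mul_div_cancel₀ _ (h.c_pos.trans_le hMp).ne', sub_self]) (half_pos hδ)
  refine ⟨u, hu, ?_⟩
  have hi1 : Integrable (fun ω => |f ω - F n ω|) μ := (hfi.sub ((hFb n).integrable (μ := μ))).abs
  have hi2 : Integrable (fun ω => |F n ω - a - (u ω - D.avg u ω)|) μ :=
    (((hFb n).sub (.const a)).sub (hu.sub (h.bddMeas_avg hu))).abs.integrable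
  calc ∫ ω, |f ω - (u ω - D.avg u ω)| ∂μ
      ≤ ∫ ω, (|f ω - F n ω| + |a| + |F n ω - a - (u ω - D.avg u ω)|) ∂μ := by
        refine integral_mono ?_ ((hi1.add (integrable_const _)).add hi2) fun ω => ?_
        · exact (hfi.sub (hu.sub (h.bddMeas_avg hu)).integrable).abs
        · refine le_trans (le_of_eq ?_) (abs_add_three (f ω - F n ω) a _)
          congr 1
          ring
    _ = ∫ ω, |f ω - F n ω| ∂μ + |a| + ∫ ω, |F n ω - a - (u ω - D.avg u ω)| ∂μ := by
        have hi3 : Integrable (fun ω => |f ω - F n ω| + |a|) μ := hi1.add (integrable_const _)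
        rw [integral_add hi3 hi2, integral_add hi1 (integrable_const _)]
        simp
    _ ≤ (1 + C / c) * ∫ ω, |f ω - F n ω| ∂μ + δ / 2 := by linarith
    _ ≤ δ / 2 + δ / 2 := by
        rw [lt_div_iff₀ (by have := div_nonneg hC h.c_pos.le; positivity)] at hn
        linarith
    _ = δ := by ring

/-- The ergodic theorem for the environment chain: a centred function is, along almost every
trajectory average, arbitrarily close to a bounded coboundary. -/
lemma ae_exists_coboundary_near (h : D.Admissible μ c C ε N) {i : Fin d}
    (herg : Ergodic (D.T (Pi.single i 1)) μ) {f : Ω → ℝ} (hf : Measurable f)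
    (hfi : Integrable f μ) (hf0 : ∫ ω, D.M ω * f ω ∂μ = 0) :
    ∀ᵐ ω ∂μ, ∀ δ > 0, ∃ u, BddMeas u ∧ ∀ n : ℕ,
      ∑ k ∈ Finset.range n, D.avg^[k] (fun ω => |f ω - (u ω - D.avg u ω)|) ω ≤ δ * n := by
  choose u hu hub using fun j : ℕ => h.exists_coboundary_near herg hf hfi hf0
    (δ := (1 / 4) ^ j) (by positivity)
  have hgm : ∀ j, Measurable fun ω => |f ω - (u j ω - D.avg (u j) ω)| := fun j =>
    (hf.sub ((hu j).sub (h.bddMeas_avg (hu j))).1).abs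
  have hgi : ∀ j, Integrable (fun ω => |f ω - (u j ω - D.avg (u j) ω)|) μ := fun j =>
    (hfi.sub ((hu j).sub (h.bddMeas_avg (hu j))).integrable).abs
  have hC : 0 ≤ C := by
    obtain ⟨ω⟩ : Nonempty Ω := nonempty_of_isProbabilityMeasure μ
    exact (h.M_pos ω).le.trans (h.M_upper ω)
  have hbd : ∀ j : ℕ, μ {ω | ∃ n : ℕ, (1 / 2 : ℝ) ^ j * n < ∑ k ∈ Finset.range n,
      D.avg^[k] (fun ω => |f ω - (u j ω - D.avg (u j) ω)|) ω}
      ≤ ENNReal.ofReal (C / c * (1 / 2) ^ j) := fun j => by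
    refine (h.measure_sum_iterate_avg_le (hgm j) (hgi j) (fun _ => abs_nonneg _)
      (l := (1 / 2) ^ j) (by positivity)).trans (ENNReal.ofReal_le_ofReal ?_)
    have hcp := h.c_pos
    calc _ ≤ C / (c * (1 / 2) ^ j) * (1 / 4) ^ j := by
          gcongr
          exact hub j
      _ = C / c * (1 / 2) ^ j := by
          rw [show (1 / 4 : ℝ) = 1 / 2 * (1 / 2) by norm_num, mul_pow]
          field_simp
  have hsum : ∑' j : ℕ, μ {ω | ∃ n : ℕ, (1 / 2 : ℝ) ^ j * n < ∑ k ∈ Finset.range n,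
      D.avg^[k] (fun ω => |f ω - (u j ω - D.avg (u j) ω)|) ω} ≠ ⊤ := by
    refine ne_top_of_le_ne_top ?_ (ENNReal.tsum_le_tsum hbd)
    exact (summable_geometric_two.mul_left (C / c)).tsum_ofReal_ne_top
  have hbc := ae_eventually_notMem hsum
  filter_upwards [hbc] with ω hω δ hδ
  obtain ⟨j, hj, hjδ⟩ := (hω.and ((tendsto_pow_atTop_nhds_zero_of_lt_one (r := (1 / 2 : ℝ))
    (by norm_num) (by norm_num)).eventually_lt_const hδ)).exists
  refine ⟨u j, hu j, fun n => ?_⟩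
  simp only [not_exists, not_lt] at hj
  exact (hj n).trans (by gcongr)

end Admissible

end CycleData

lemma norm_exp_mul_I_taylor_le (y : ℝ) :
    ‖Complex.exp (y * Complex.I) - 1 - y * Complex.I + y ^ 2 / 2‖ ≤ 4 * |y| ^ 3 ∧
      ‖Complex.exp (y * Complex.I) - 1 - y * Complex.I + y ^ 2 / 2‖ ≤ 4 * y ^ 2 := by
  have hn : ‖(y : ℂ) * Complex.I‖ = |y| := by simp
  have hy0 := abs_nonneg y
  have hsq : |y| ^ 2 = y ^ 2 := sq_abs y
  rcases le_or_gt |y| 1 with hy | hy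
  · have h1 := Complex.exp_bound (x := (y : ℂ) * Complex.I) (by rw [hn]; exact hy) (n := 3)
      (by norm_num)
    have h2 : Complex.exp (y * Complex.I) - ∑ m ∈ Finset.range 3, (y * Complex.I) ^ m / m.factorial
        = Complex.exp (y * Complex.I) - 1 - y * Complex.I + y ^ 2 / 2 := by
      simp [Finset.sum_range_succ, mul_pow, Nat.factorial]
      ring
    rw [h2, hn] at h1
    have h3 : ‖Complex.exp (y * Complex.I) - 1 - y * Complex.I + y ^ 2 / 2‖ ≤ |y| ^ 3 := by
      refine h1.trans ?_
      norm_num [Nat.factorial]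
      nlinarith [pow_nonneg hy0 3]
    have h4 : |y| ^ 3 ≤ y ^ 2 := by rw [← hsq]; exact pow_le_pow_of_le_one hy0 hy (by norm_num)
    exact ⟨by linarith [pow_nonneg hy0 3], by linarith [sq_nonneg y]⟩
  · have h1 : ‖Complex.exp (y * Complex.I) - 1 - y * Complex.I + y ^ 2 / 2‖
        ≤ 1 + 1 + |y| + y ^ 2 / 2 := by
      refine (norm_add_le _ _).trans (add_le_add ((norm_sub_le _ _).trans (add_le_add
        ((norm_sub_le _ _).trans (le_of_eq ?_)) hn.le)) (le_of_eq ?_))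
      · rw [Complex.norm_exp_ofReal_mul_I, norm_one]
      · rw [norm_div, norm_pow, Complex.norm_real, Real.norm_eq_abs, hsq]
        simp
    have h2 : y ^ 2 ≤ |y| ^ 3 := by rw [← hsq]; exact pow_le_pow_right₀ hy.le (by norm_num)
    have h3 : |y| ≤ y ^ 2 := by rw [← hsq]; nlinarith
    exact ⟨by linarith, by linarith⟩

lemma norm_sum_taylor_le {ι : Type*} {s : Finset ι} {p ξ : ι → ℝ} {B θ : ℝ}
    (hp : ∀ v ∈ s, 0 ≤ p v) (hB : 0 ≤ B) (hθ0 : 0 ≤ θ) :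
    ‖∑ v ∈ s, p v • (Complex.exp ((θ * ξ v : ℝ) * Complex.I) - 1 - (θ * ξ v : ℝ) * Complex.I
        + ((θ * ξ v : ℝ) : ℂ) ^ 2 / 2)‖
      ≤ θ ^ 2 * (4 * B * θ * (∑ v ∈ s, p v * ξ v ^ 2) + 4 * ∑ v ∈ s, if B < |ξ v| then p v * ξ v ^ 2 else 0) := by
  have h1 : θ ^ 2 * (4 * B * θ * (∑ v ∈ s, p v * ξ v ^ 2) + 4 * ∑ v ∈ s, if B < |ξ v| then p v * ξ v ^ 2 else 0) = ∑ v ∈ s, θ ^ 2 * (4 * B * θ * (p v * ξ v ^ 2)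
      + 4 * if B < |ξ v| then p v * ξ v ^ 2 else 0) := by
    rw [← Finset.mul_sum, Finset.sum_add_distrib, ← Finset.mul_sum, ← Finset.mul_sum]
  rw [h1]
  refine (norm_sum_le _ _).trans (Finset.sum_le_sum fun v hv => ?_)
  rw [norm_smul, Real.norm_eq_abs, abs_of_nonneg (hp v hv)]
  obtain ⟨h2, h3⟩ := norm_exp_mul_I_taylor_le (θ * ξ v)
  have hpv := hp v hv
  split_ifs with h4
  · have h5 := mul_le_mul_of_nonneg_left h3 hpv
    have h6 : 0 ≤ θ ^ 2 * (4 * B * θ * (p v * ξ v ^ 2)) := by positivity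
    refine h5.trans ?_
    nlinarith
  · have h5 := mul_le_mul_of_nonneg_left h2 hpv
    refine h5.trans ?_
    have h6 : |ξ v| ^ 3 ≤ B * ξ v ^ 2 := by
      rw [pow_succ, sq_abs, mul_comm]
      exact mul_le_mul_of_nonneg_right (not_lt.1 h4) (sq_nonneg _)
    rw [abs_mul, abs_of_nonneg hθ0, mul_pow]
    have h7 := mul_le_mul_of_nonneg_left h6 (by positivity : 0 ≤ 4 * p v * θ ^ 3)
    linarith

lemma norm_sum_exp_sub_one_mul_le {ι : Type*} {s : Finset ι} {p ξ f : ι → ℝ} {F θ : ℝ}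
    (hp : ∀ v ∈ s, 0 ≤ p v) (hp1 : ∑ v ∈ s, p v = 1) (hF : ∀ v ∈ s, |f v| ≤ F)
    (hθ0 : 0 ≤ θ) :
    ‖∑ v ∈ s, p v • ((Complex.exp ((θ * ξ v : ℝ) * Complex.I) - 1) * (θ ^ 2 / 2 * f v : ℝ))‖
      ≤ θ ^ 2 * (θ * F * (1 + ∑ v ∈ s, p v * ξ v ^ 2)) := by
  have h1 : θ ^ 2 * (θ * F * (1 + ∑ v ∈ s, p v * ξ v ^ 2)) = ∑ v ∈ s, θ ^ 2 * (θ * F * (p v + p v * ξ v ^ 2)) := by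
    rw [← Finset.mul_sum, ← Finset.mul_sum, Finset.sum_add_distrib, hp1]
  rw [h1]
  refine (norm_sum_le _ _).trans (Finset.sum_le_sum fun v hv => ?_)
  have hpv := hp v hv
  rw [norm_smul, Real.norm_eq_abs, abs_of_nonneg hpv, norm_mul, Complex.norm_real,
    Real.norm_eq_abs, abs_mul, abs_of_nonneg (by positivity : 0 ≤ θ ^ 2 / 2)]
  have h2 : ‖Complex.exp ((θ * ξ v : ℝ) * Complex.I) - 1‖ ≤ θ * |ξ v| := by
    have := Real.norm_exp_I_mul_ofReal_sub_one_le (x := θ * ξ v)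
    rw [mul_comm Complex.I] at this
    refine this.trans (le_of_eq ?_)
    rw [norm_mul, Real.norm_eq_abs, Real.norm_eq_abs, abs_of_nonneg hθ0]
  have h3 : |ξ v| ≤ 2 * (1 + ξ v ^ 2) := by
    nlinarith [sq_nonneg (|ξ v| - 1), sq_abs (ξ v), sq_nonneg (ξ v)]
  calc p v * (‖Complex.exp ((θ * ξ v : ℝ) * Complex.I) - 1‖ * (θ ^ 2 / 2 * |f v|))
      ≤ p v * ((θ * (2 * (1 + ξ v ^ 2))) * (θ ^ 2 / 2 * F)) := by
        gcongr
        · exact h2.trans (mul_le_mul_of_nonneg_left h3 hθ0)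
        · exact hF v hv
    _ = _ := by ring

/-- One step of the Gaussian approximation of the characteristic function of a centred jump. -/
lemma norm_sum_exp_sub_le {ι : Type*} {s : Finset ι} {p ξ f : ι → ℝ} {F B σ f₀ g θ : ℝ}
    (hp : ∀ v ∈ s, 0 ≤ p v) (hp1 : ∑ v ∈ s, p v = 1) (hξ : ∑ v ∈ s, p v * ξ v = 0)
    (hF : ∀ v ∈ s, |f v| ≤ F) (hF0 : |f₀| ≤ F) (hB : 0 ≤ B) (hσ : 0 ≤ σ) (hθ0 : 0 ≤ θ)
    (hθ1 : θ ≤ 1) (hσθ : θ ^ 2 * σ / 2 ≤ 1)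
    (hg : ∑ v ∈ s, p v * ξ v ^ 2 = σ + (f₀ - ∑ v ∈ s, p v * f v) + g) :
    ‖∑ v ∈ s, p v • (Complex.exp ((θ * ξ v : ℝ) * Complex.I) * ((1 - θ ^ 2 / 2 * f v : ℝ) : ℂ))
        - ((Real.exp (-(θ ^ 2 * σ / 2)) * (1 - θ ^ 2 / 2 * f₀) : ℝ) : ℂ)‖
      ≤ θ ^ 2 * (θ * ((4 * B + F) * (1 + σ + 2 * F) + σ ^ 2 + F * σ) * (1 + |g|) + |g|
        + 4 * ∑ v ∈ s, if B < |ξ v| then p v * ξ v ^ 2 else 0) := by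
  have hFn : 0 ≤ F := (abs_nonneg _).trans hF0
  set H : ℝ := ∑ v ∈ s, p v * ξ v ^ 2 with hH
  set κ : ℝ := ∑ v ∈ s, if B < |ξ v| then p v * ξ v ^ 2 else 0 with hκ
  set a : ℝ := θ ^ 2 * σ / 2 with ha
  have ha0 : 0 ≤ a := by positivity
  have hH0 : 0 ≤ H := Finset.sum_nonneg fun v hv => mul_nonneg (hp v hv) (sq_nonneg _)
  have hHb : H ≤ σ + 2 * F + |g| := by
    have h1 : |∑ v ∈ s, p v * f v| ≤ F := by
      calc |∑ v ∈ s, p v * f v| ≤ ∑ v ∈ s, |p v * f v| := Finset.abs_sum_le_sum_abs _ _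
        _ ≤ ∑ v ∈ s, p v * F := Finset.sum_le_sum fun v hv => by
            rw [abs_mul, abs_of_nonneg (hp v hv)]
            exact mul_le_mul_of_nonneg_left (hF v hv) (hp v hv)
        _ = F := by rw [← Finset.sum_mul, hp1, one_mul]
    rw [hg]
    linarith [le_abs_self f₀, neg_abs_le (∑ v ∈ s, p v * f v), le_abs_self g]
  set e : ι → ℂ := fun v => Complex.exp ((θ * ξ v : ℝ) * Complex.I) with he
  have hdecomp : ∑ v ∈ s, p v • (e v * ((1 - θ ^ 2 / 2 * f v : ℝ) : ℂ))
        - ((Real.exp (-a) * (1 - θ ^ 2 / 2 * f₀) : ℝ) : ℂ)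
      = ∑ v ∈ s, p v • (e v - 1 - (θ * ξ v : ℝ) * Complex.I + ((θ * ξ v : ℝ) : ℂ) ^ 2 / 2)
        - ∑ v ∈ s, p v • ((e v - 1) * (θ ^ 2 / 2 * f v : ℝ))
        + (((1 - a - Real.exp (-a)) - θ ^ 2 / 2 * f₀ * (1 - Real.exp (-a)) - θ ^ 2 / 2 * g : ℝ)
          : ℂ) := by
    have h1 : ∀ v ∈ s, p v • (e v * ((1 - θ ^ 2 / 2 * f v : ℝ) : ℂ))
        = p v • (e v - 1 - (θ * ξ v : ℝ) * Complex.I + ((θ * ξ v : ℝ) : ℂ) ^ 2 / 2)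
          - p v • ((e v - 1) * (θ ^ 2 / 2 * f v : ℝ)) + (p v : ℂ)
          + (θ * (p v * ξ v : ℝ)) * Complex.I - θ ^ 2 / 2 * (p v * ξ v ^ 2 : ℝ)
          - θ ^ 2 / 2 * (p v * f v : ℝ) := fun v _ => by
      simp only [Complex.real_smul]
      push_cast
      ring
    rw [Finset.sum_congr rfl h1]
    simp only [Finset.sum_sub_distrib, Finset.sum_add_distrib, ← Finset.mul_sum, ← Finset.sum_mul,
      ← Complex.ofReal_sum]
    rw [hp1, hξ, ← hH]
    have h2 : H = σ + (f₀ - ∑ v ∈ s, p v * f v) + g := hg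
    rw [h2, ha]
    push_cast
    ring
  have hmain : ‖∑ v ∈ s, p v • (e v - 1 - (θ * ξ v : ℝ) * Complex.I
      + ((θ * ξ v : ℝ) : ℂ) ^ 2 / 2)‖ ≤ θ ^ 2 * (4 * B * θ * H + 4 * κ) :=
    norm_sum_taylor_le hp hB hθ0
  have hosc : ‖∑ v ∈ s, p v • ((e v - 1) * (θ ^ 2 / 2 * f v : ℝ))‖
      ≤ θ ^ 2 * (θ * F * (1 + H)) := norm_sum_exp_sub_one_mul_le hp hp1 hF hθ0
  have hexp1 : |1 - a - Real.exp (-a)| ≤ a ^ 2 := by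
    have h1 := Real.abs_exp_sub_one_sub_id_le (x := -a) (by rw [abs_neg, abs_of_nonneg ha0]; exact hσθ)
    rw [abs_sub_comm]
    calc _ = |Real.exp (-a) - 1 - -a| := by congr 1; ring
      _ ≤ (-a) ^ 2 := h1
      _ = a ^ 2 := by ring
  have hexp2 : |1 - Real.exp (-a)| ≤ a := by
    rw [abs_of_nonneg (by linarith [Real.exp_le_one_iff.2 (neg_nonpos.2 ha0)])]
    linarith [Real.add_one_le_exp (-a)]
  have hlast : ‖(((1 - a - Real.exp (-a)) - θ ^ 2 / 2 * f₀ * (1 - Real.exp (-a)) - θ ^ 2 / 2 * g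
      : ℝ) : ℂ)‖ ≤ a ^ 2 + θ ^ 2 / 2 * F * a + θ ^ 2 / 2 * |g| := by
    rw [Complex.norm_real, Real.norm_eq_abs]
    refine (abs_sub _ _).trans (add_le_add ((abs_sub _ _).trans (add_le_add hexp1 ?_)) ?_)
    · rw [abs_mul, abs_mul, abs_of_nonneg (by positivity : 0 ≤ θ ^ 2 / 2)]
      gcongr
    · rw [abs_mul, abs_of_nonneg (by positivity : 0 ≤ θ ^ 2 / 2)]
  rw [hdecomp]
  refine (norm_add_le _ _).trans ((add_le_add ((norm_sub_le _ _).trans (add_le_add hmain hosc))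
    hlast).trans ?_)
  have hθ2 : θ ^ 2 ≤ θ := by nlinarith
  have hg0 := abs_nonneg g
  have hHb' : 1 + H ≤ (1 + σ + 2 * F) * (1 + |g|) := by nlinarith
  have h1 : 4 * B * θ * H + θ * F * (1 + H)
      ≤ θ * ((4 * B + F) * (1 + σ + 2 * F)) * (1 + |g|) := by
    calc _ ≤ θ * (4 * B + F) * (1 + H) := by nlinarith [mul_nonneg hB hθ0]
      _ ≤ θ * (4 * B + F) * ((1 + σ + 2 * F) * (1 + |g|)) := by gcongr
      _ = _ := by ring
  have h2 : θ ^ 2 * σ ^ 2 / 4 + F * (θ ^ 2 * σ) / 4 ≤ θ * (σ ^ 2 + F * σ) * (1 + |g|) := by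
    calc _ = θ ^ 2 * (σ ^ 2 + F * σ) / 4 := by ring
      _ ≤ θ * (σ ^ 2 + F * σ) / 4 := by gcongr
      _ ≤ θ * (σ ^ 2 + F * σ) * (1 + |g|) := by
        have : 0 ≤ θ * (σ ^ 2 + F * σ) := by positivity
        nlinarith [mul_nonneg this hg0]
  have h3 : θ ^ 2 * (4 * B * θ * H + 4 * κ) + θ ^ 2 * (θ * F * (1 + H))
        + (a ^ 2 + θ ^ 2 / 2 * F * a + θ ^ 2 / 2 * |g|)
      = θ ^ 2 * ((4 * B * θ * H + θ * F * (1 + H))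
        + (θ ^ 2 * σ ^ 2 / 4 + F * (θ ^ 2 * σ) / 4) + |g| / 2 + 4 * κ) := by
    rw [ha]; ring
  rw [h3]
  refine mul_le_mul_of_nonneg_left ?_ (sq_nonneg θ)
  have h4 : θ * ((4 * B + F) * (1 + σ + 2 * F) + σ ^ 2 + F * σ) * (1 + |g|)
      = θ * ((4 * B + F) * (1 + σ + 2 * F)) * (1 + |g|) + θ * (σ ^ 2 + F * σ) * (1 + |g|) := by ring
  linarith

namespace CycleData

namespace Admissible

variable {d K : ℕ} {Ω : Type*} [MeasurableSpace Ω] {D : CycleData d K Ω} {μ : Measure Ω}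
  {c C ε : ℝ} {N : ℕ}

lemma norm_iterate_step_sub_le (h : D.Admissible μ c C ε N) (ω : Ω) {E : Zd d → ℂ} {ρ : ℝ}
    (hρ0 : 0 ≤ ρ) (hρ1 : ρ ≤ 1) {b : Zd d → ℝ} (hb : ∀ x, ‖D.step ω E x - ρ • E x‖ ≤ b x)
    (n : ℕ) (x : Zd d) :
    ‖(D.step ω)^[n] E x - ρ ^ n • E x‖ ≤ ∑ k ∈ Finset.range n, (D.step ω)^[k] b x := by
  induction n with
  | zero => simp
  | succ n ih =>
    rw [Finset.sum_range_succ, add_comm (∑ k ∈ Finset.range n, _)]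
    have hsplit : (D.step ω)^[n + 1] E x - ρ ^ (n + 1) • E x
        = (D.step ω)^[n] (fun y => D.step ω E y - ρ • E y) x
          + ρ • ((D.step ω)^[n] E x - ρ ^ n • E x) := by
      have h1 : (D.step ω)^[n] (fun y => ρ • E y) x = ρ • (D.step ω)^[n] E x := by
        rw [iterate_step_eq_sum, iterate_step_eq_sum, Finset.smul_sum]
        exact Finset.sum_congr rfl fun v _ => smul_comm _ _ _
      rw [iterate_step_sub (F := D.step ω E), h1, Function.iterate_succ_apply, pow_succ', mul_smul,
        smul_sub]
      abel
    rw [hsplit]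
    refine (norm_add_le _ _).trans (add_le_add ((h.norm_iterate_step_le _ ω n x).trans
      (h.iterate_step_mono hb ω n x)) ?_)
    rw [norm_smul, Real.norm_eq_abs, abs_of_nonneg hρ0]
    exact (mul_le_of_le_one_left (norm_nonneg _) hρ1).trans ih

/-- The central limit theorem for a harmonic function of the walk whose quadratic variation
averages out. -/
lemma tendsto_iterate_step_exp (h : D.Admissible μ c C ε N) (ω : Ω) {Ψ : Zd d → ℝ} {σ : ℝ}
    (hσ : 0 ≤ σ) (hΨ0 : Ψ 0 = 0)
    (hharm : ∀ x, ∑ v ∈ D.jumps, D.p v (D.T x ω) * (Ψ (x + v) - Ψ x) = 0)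
    (hvar : ∀ δ > 0, ∃ f : Zd d → ℝ, (∃ B, ∀ x, |f x| ≤ B) ∧ ∀ n : ℕ,
      ∑ k ∈ Finset.range n, (D.step ω)^[k] (fun x => |∑ v ∈ D.jumps, D.p v (D.T x ω)
        * (Ψ (x + v) - Ψ x) ^ 2 - σ - (f x - D.step ω f x)|) 0 ≤ δ * n)
    (hlind : ∀ δ > 0, ∃ B ≥ 0, ∃ n₀ : ℕ, ∀ n ≥ n₀,
      ∑ k ∈ Finset.range n, (D.step ω)^[k] (fun x => ∑ v ∈ D.jumps,
        if B < |Ψ (x + v) - Ψ x| then D.p v (D.T x ω) * (Ψ (x + v) - Ψ x) ^ 2 else 0) 0 ≤ δ * n) :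
    Filter.Tendsto (fun n : ℕ => (D.step ω)^[n]
      (fun x => Complex.exp ((Ψ x / Real.sqrt n : ℝ) * Complex.I)) 0) Filter.atTop
      (nhds (Real.exp (-σ / 2) : ℝ)) := by
  rw [Metric.tendsto_atTop]
  intro δ hδ
  obtain ⟨f, ⟨F, hF⟩, hf⟩ := hvar (min 1 (δ / 12)) (by positivity)
  obtain ⟨B, hB, n₀, hn₀⟩ := hlind (δ / 24) (by positivity)
  have hF0 : 0 ≤ F := (abs_nonneg _).trans (hF 0)
  set C₁ : ℝ := (4 * B + F) * (1 + σ + 2 * F) + σ ^ 2 + F * σ with hC₁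
  have hC₁0 : 0 ≤ C₁ := by positivity
  have hlim : Filter.Tendsto (fun n : ℕ => 1 / Real.sqrt n) Filter.atTop (nhds 0) := by
    simp only [one_div]
    exact tendsto_inv_atTop_zero.comp (Real.tendsto_sqrt_atTop.comp tendsto_natCast_atTop_atTop)
  obtain ⟨n₁, hn₁⟩ := Filter.eventually_atTop.1 ((hlim.eventually_lt_const
    (u := min 1 (min (1 / (1 + σ)) (δ / (4 * (2 * C₁ + F + 1))))) (by positivity)).and
    (Filter.eventually_ge_atTop (max 1 n₀)))
  refine ⟨n₁, fun n hn => ?_⟩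
  obtain ⟨hθ, hnn⟩ := hn₁ n hn
  have hn1 : 1 ≤ n := (le_max_left _ _).trans hnn
  set θ : ℝ := 1 / Real.sqrt n with hθdef
  have hnpos : (0 : ℝ) < n := by exact_mod_cast hn1
  have hθ0 : 0 ≤ θ := by positivity
  have hθ1 : θ ≤ 1 := (hθ.trans_le (min_le_left _ _)).le
  have hθσ : θ * (1 + σ) ≤ 1 := by
    have := (hθ.trans_le ((min_le_right _ _).trans (min_le_left _ _))).le
    rwa [le_div_iff₀ (by positivity)] at this
  have hθδ : θ * (2 * C₁ + F + 1) ≤ δ / 4 := by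
    have := (hθ.trans_le ((min_le_right _ _).trans (min_le_right _ _))).le
    rw [le_div_iff₀ (by positivity)] at this
    linarith
  have hθn : θ ^ 2 * n = 1 := by
    rw [hθdef, div_pow, Real.sq_sqrt hnpos.le]
    field_simp
  have hσθ : θ ^ 2 * σ / 2 ≤ 1 := by
    have h1 : θ * σ ≤ 1 := by nlinarith
    nlinarith [mul_nonneg hθ0 hσ]
  set e : Zd d → ℂ := fun x => Complex.exp ((θ * Ψ x : ℝ) * Complex.I) with he
  have hnorm : ∀ x, ‖e x‖ = 1 := fun x => Complex.norm_exp_ofReal_mul_I _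
  set E : Zd d → ℂ := fun x => e x * ((1 - θ ^ 2 / 2 * f x : ℝ) : ℂ) with hE
  set g : Zd d → ℝ := fun x => ∑ v ∈ D.jumps, D.p v (D.T x ω) * (Ψ (x + v) - Ψ x) ^ 2 - σ
    - (f x - D.step ω f x) with hg
  set κ : Zd d → ℝ := fun x => ∑ v ∈ D.jumps,
    if B < |Ψ (x + v) - Ψ x| then D.p v (D.T x ω) * (Ψ (x + v) - Ψ x) ^ 2 else 0 with hκ
  have hEe : ∀ x, ‖e x - E x‖ ≤ θ * F / 2 := fun x => by
    have h1 : e x - E x = e x * ((θ ^ 2 / 2 * f x : ℝ) : ℂ) := by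
      simp only [hE]; push_cast; ring
    rw [h1, norm_mul, hnorm, one_mul, Complex.norm_real, Real.norm_eq_abs, abs_mul,
      abs_of_nonneg (by positivity : 0 ≤ θ ^ 2 / 2)]
    calc θ ^ 2 / 2 * |f x| ≤ θ / 2 * F := by
          gcongr
          · nlinarith
          · exact hF x
      _ = _ := by ring
  have hpt : ∀ x, ‖D.step ω E x - Real.exp (-(θ ^ 2 * σ / 2)) • E x‖
      ≤ θ ^ 2 * (θ * C₁ * (1 + |g x|) + |g x| + 4 * κ x) := fun x => by
    have h1 := norm_sum_exp_sub_le (s := D.jumps) (p := fun v => D.p v (D.T x ω))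
      (ξ := fun v => Ψ (x + v) - Ψ x) (f := fun v => f (x + v)) (F := F) (B := B) (σ := σ)
      (f₀ := f x) (g := g x) (θ := θ) (fun v _ => h.p_nonneg v _) (h.sum_p _) (hharm x)
      (fun v _ => hF _) (hF x) hB hσ hθ0 hθ1 hσθ (by simp only [hg, step, smul_eq_mul]; ring)
    have h2 : ∀ w : ℂ, ‖e x * w‖ = ‖w‖ := fun w => by rw [norm_mul, hnorm, one_mul]
    refine le_trans (le_of_eq (Eq.trans ?_ (h2 _))) h1
    rw [mul_sub, Finset.mul_sum]
    congr 2
    · refine Finset.sum_congr rfl fun v _ => ?_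
      simp only [hE, he, Complex.real_smul]
      rw [show (θ * Ψ (x + v) : ℝ) * Complex.I = (θ * Ψ x : ℝ) * Complex.I
        + (θ * (Ψ (x + v) - Ψ x) : ℝ) * Complex.I by push_cast; ring, Complex.exp_add]
      ring
    · rw [Complex.real_smul, Complex.ofReal_mul]
      ring
  have hρ : Real.exp (-(θ ^ 2 * σ / 2)) ^ n = Real.exp (-σ / 2) := by
    rw [← Real.exp_nat_mul]
    congr 1
    calc (n : ℝ) * -(θ ^ 2 * σ / 2) = -((θ ^ 2 * n) * σ / 2) := by ring
      _ = _ := by rw [hθn]; ring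
  have hmain := h.norm_iterate_step_sub_le ω (Real.exp_pos _).le
    (Real.exp_le_one_iff.2 (by simp only [Left.neg_nonpos_iff]; positivity)) hpt n 0
  rw [hρ] at hmain
  have hsum : ∑ k ∈ Finset.range n, (D.step ω)^[k]
      (fun x => θ ^ 2 * (θ * C₁ * (1 + |g x|) + |g x| + 4 * κ x)) 0
      ≤ θ * (2 * C₁) + δ / 12 + δ / 6 := by
    have hlin : ∀ k, (D.step ω)^[k]
        (fun x => θ ^ 2 * (θ * C₁ * (1 + |g x|) + |g x| + 4 * κ x)) 0
        = θ ^ 2 * (θ * C₁ + (θ * C₁ + 1) * (D.step ω)^[k] (fun x => |g x|) 0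
          + 4 * (D.step ω)^[k] κ 0) := fun k => by
      have h1 : (fun x => θ ^ 2 * (θ * C₁ * (1 + |g x|) + |g x| + 4 * κ x))
          = fun x => (θ ^ 2 * (θ * C₁) + |g x| • (θ ^ 2 * (θ * C₁ + 1))) + κ x • (θ ^ 2 * 4) := by
        funext x; simp only [smul_eq_mul]; ring
      rw [h1, iterate_step_add, iterate_step_add (F := fun _ => θ ^ 2 * (θ * C₁)),
        iterate_step_smul_const, iterate_step_smul_const, h.iterate_step_const]
      simp only [smul_eq_mul]; ring
    simp_rw [hlin]
    rw [← Finset.mul_sum _ _ (θ ^ 2), Finset.sum_add_distrib, Finset.sum_add_distrib,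
      ← Finset.mul_sum _ _ (θ * C₁ + 1), ← Finset.mul_sum _ _ (4 : ℝ), Finset.sum_const,
      Finset.card_range, nsmul_eq_mul]
    have h2 := hf n
    have h3 := hn₀ n ((le_max_right _ _).trans hnn)
    have h5 : min 1 (δ / 12) * (n : ℝ) ≤ 1 * n :=
      mul_le_mul_of_nonneg_right (min_le_left _ _) hnpos.le
    have h6 : min 1 (δ / 12) * (n : ℝ) ≤ δ / 12 * n :=
      mul_le_mul_of_nonneg_right (min_le_right _ _) hnpos.le
    set S₁ : ℝ := ∑ k ∈ Finset.range n, (D.step ω)^[k] (fun x => |g x|) 0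
    set S₂ : ℝ := ∑ k ∈ Finset.range n, (D.step ω)^[k] κ 0
    have h7 : S₁ ≤ 1 * n := h2.trans h5
    have h8 : S₁ ≤ δ / 12 * n := h2.trans h6
    have h9 : S₂ ≤ δ / 24 * n := h3
    calc θ ^ 2 * (n * (θ * C₁) + (θ * C₁ + 1) * S₁ + 4 * S₂)
        = θ ^ 2 * (n * (θ * C₁) + (θ * C₁) * S₁ + S₁ + 4 * S₂) := by ring
      _ ≤ θ ^ 2 * (n * (θ * C₁) + (θ * C₁) * (1 * n) + δ / 12 * n + 4 * (δ / 24 * n)) := by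
          gcongr
      _ = (θ ^ 2 * n) * (θ * (2 * C₁) + δ / 12 + δ / 6) := by ring
      _ = _ := by rw [hθn, one_mul]
  have hdiff : ‖(D.step ω)^[n] e 0 - (D.step ω)^[n] E 0‖ ≤ θ * F / 2 := by
    rw [← iterate_step_sub]
    refine (h.norm_iterate_step_le _ ω n 0).trans ((h.iterate_step_mono hEe ω n 0).trans ?_)
    rw [h.iterate_step_const]
  have he0 : e 0 = 1 := by simp [he, hΨ0]
  have hstart : ‖Real.exp (-σ / 2) • E 0 - ((Real.exp (-σ / 2) : ℝ) : ℂ)‖ ≤ θ * F / 2 := by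
    have h1 : Real.exp (-σ / 2) • E 0 - ((Real.exp (-σ / 2) : ℝ) : ℂ)
        = Real.exp (-σ / 2) • (E 0 - e 0) := by
      rw [he0, smul_sub, Complex.real_smul, Complex.real_smul, mul_one]
    rw [h1, norm_smul, Real.norm_eq_abs, abs_of_pos (Real.exp_pos _), norm_sub_rev]
    exact (mul_le_of_le_one_left (norm_nonneg _)
      (Real.exp_le_one_iff.2 (by linarith))).trans (hEe 0)
  have hee : (fun x => Complex.exp ((Ψ x / Real.sqrt n : ℝ) * Complex.I)) = e := by
    funext x
    simp only [he, hθdef]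
    rw [one_div, div_eq_inv_mul]
  rw [hee, dist_eq_norm]
  calc ‖(D.step ω)^[n] e 0 - ((Real.exp (-σ / 2) : ℝ) : ℂ)‖
      = ‖((D.step ω)^[n] e 0 - (D.step ω)^[n] E 0)
        + ((D.step ω)^[n] E 0 - Real.exp (-σ / 2) • E 0)
        + (Real.exp (-σ / 2) • E 0 - ((Real.exp (-σ / 2) : ℝ) : ℂ))‖ := by congr 1; ring
    _ ≤ _ := norm_add₃_le
    _ ≤ θ * F / 2 + (θ * (2 * C₁) + δ / 12 + δ / 6) + θ * F / 2 :=
        add_le_add (add_le_add hdiff (hmain.trans hsum)) hstart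
    _ < δ := by nlinarith

end Admissible

end CycleData

namespace CycleData

variable {d K : ℕ} {Ω : Type*} {D : CycleData d K Ω}

/-- The function `F`, evaluated along the walk in the environment `ω`, averages to `m` up to
bounded coboundaries. -/
def AveragesTo (D : CycleData d K Ω) (ω : Ω) (F : Zd d → ℝ) (m : ℝ) : Prop :=
  ∀ δ > 0, ∃ f : Zd d → ℝ, (∃ B, ∀ x, |f x| ≤ B) ∧ ∀ n : ℕ,
    ∑ k ∈ Finset.range n, (D.step ω)^[k] (fun x => |F x - m - (f x - D.step ω f x)|) 0 ≤ δ * n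

lemma AveragesTo.const_mul {ω : Ω} {F : Zd d → ℝ} {a : ℝ}
    (hF : D.AveragesTo ω F a) (b : ℝ) : D.AveragesTo ω (fun x => b * F x) (b * a) := by
  intro δ hδ
  obtain ⟨f, ⟨B, hB⟩, hf⟩ := hF (δ / (|b| + 1)) (by positivity)
  refine ⟨fun x => b * f x, ⟨|b| * B, fun x => by
    rw [abs_mul]; exact mul_le_mul_of_nonneg_left (hB x) (abs_nonneg b)⟩, fun n => ?_⟩
  have key : (fun x => |b * F x - b * a - (b * f x - D.step ω (fun x => b * f x) x)|)
      = fun x => |F x - a - (f x - D.step ω f x)| • |b| := by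
    funext x
    have h1 : D.step ω (fun x => b * f x) x = b * D.step ω f x := by
      simp only [step, smul_eq_mul, Finset.mul_sum]
      exact Finset.sum_congr rfl fun v _ => by ring
    rw [h1, smul_eq_mul, ← abs_mul]
    congr 1
    ring
  rw [key]
  simp_rw [D.iterate_step_smul_const, smul_eq_mul]
  rw [← Finset.sum_mul]
  have hn : (0 : ℝ) ≤ n := Nat.cast_nonneg n
  calc _ ≤ δ / (|b| + 1) * n * |b| := by gcongr; exact hf n
    _ = δ * n * (|b| / (|b| + 1)) := by ring
    _ ≤ δ * n * 1 := by
        gcongr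
        rw [div_le_one (by positivity)]
        linarith
    _ = δ * n := mul_one _

variable [MeasurableSpace Ω] {μ : Measure Ω} {c C ε : ℝ} {N : ℕ}

lemma AveragesTo.add (h : D.Admissible μ c C ε N) {ω : Ω} {F G : Zd d → ℝ} {a b : ℝ}
    (hF : D.AveragesTo ω F a) (hG : D.AveragesTo ω G b) :
    D.AveragesTo ω (fun x => F x + G x) (a + b) := by
  intro δ hδ
  obtain ⟨f, ⟨B, hB⟩, hf⟩ := hF (δ / 2) (by positivity)
  obtain ⟨g, ⟨B', hB'⟩, hg⟩ := hG (δ / 2) (by positivity)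
  refine ⟨fun x => f x + g x, ⟨B + B', fun x => (abs_add_le _ _).trans (add_le_add (hB x) (hB' x))⟩,
    fun n => ?_⟩
  have key : ∀ x, |F x + G x - (a + b) - (f x + g x - D.step ω (fun x => f x + g x) x)|
      ≤ |F x - a - (f x - D.step ω f x)| + |G x - b - (g x - D.step ω g x)| := fun x => by
    have h1 : D.step ω (fun x => f x + g x) x = D.step ω f x + D.step ω g x := by
      simp [step, mul_add, Finset.sum_add_distrib]
    rw [h1]
    refine le_trans (le_of_eq (congrArg _ ?_)) (abs_add_le _ _)
    ring
  calc _ ≤ ∑ k ∈ Finset.range n, ((D.step ω)^[k] (fun x => |F x - a - (f x - D.step ω f x)|) 0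
          + (D.step ω)^[k] (fun x => |G x - b - (g x - D.step ω g x)|) 0) := by
        refine Finset.sum_le_sum fun k _ => ?_
        rw [← D.iterate_step_add]
        exact h.iterate_step_mono key ω k 0
    _ ≤ δ / 2 * n + δ / 2 * n := by
        rw [Finset.sum_add_distrib]
        exact add_le_add (hf n) (hg n)
    _ = δ * n := by ring

lemma averagesTo_zero (h : D.Admissible μ c C ε N) (ω : Ω) :
    D.AveragesTo ω (fun _ => 0) 0 := by
  refine fun δ hδ => ⟨fun _ => 0, ⟨0, by simp⟩, fun n => ?_⟩
  have h1 : (fun x => |(0 : ℝ) - 0 - (0 - D.step ω (fun _ : Zd d => (0 : ℝ)) x)|)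
      = fun _ => (0 : ℝ) := by
    funext x
    simp [step]
  rw [h1]
  simp_rw [h.iterate_step_const]
  simp only [Finset.sum_const_zero]
  positivity

lemma AveragesTo.sum (h : D.Admissible μ c C ε N) {ω : Ω} {ι : Type*} {s : Finset ι}
    {F : ι → Zd d → ℝ} {a : ι → ℝ} (hF : ∀ i ∈ s, D.AveragesTo ω (F i) (a i)) :
    D.AveragesTo ω (fun x => ∑ i ∈ s, F i x) (∑ i ∈ s, a i) := by
  induction s using Finset.induction_on with
  | empty => simpa using averagesTo_zero h ω
  | insert i s hi ih =>
    simp only [Finset.sum_insert hi]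
    exact AveragesTo.add h (hF i (Finset.mem_insert_self i s))
      (ih fun j hj => hF j (Finset.mem_insert_of_mem hj))

lemma AveragesTo.sum_le (h : D.Admissible μ c C ε N) {ω : Ω} {F : Zd d → ℝ} {m : ℝ}
    (hF : D.AveragesTo ω F m) {δ : ℝ} (hδ : 0 < δ) :
    ∃ n₀ : ℕ, ∀ n ≥ n₀, ∑ k ∈ Finset.range n, (D.step ω)^[k] F 0 ≤ (m + δ) * n := by
  obtain ⟨f, ⟨B, hB⟩, hf⟩ := hF (δ / 2) (by positivity)
  obtain ⟨n₀, hn₀⟩ := exists_nat_ge (2 * B / (δ / 2))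
  refine ⟨n₀, fun n hn => ?_⟩
  have hfn : ∀ k, |(D.step ω)^[k] f 0| ≤ B := fun k => by
    rw [abs_le]
    constructor
    · rw [← h.iterate_step_const (-B) ω k 0]
      exact h.iterate_step_mono (fun x => (abs_le.1 (hB x)).1) ω k 0
    · rw [← h.iterate_step_const B ω k 0]
      exact h.iterate_step_mono (fun x => (abs_le.1 (hB x)).2) ω k 0
  have h1 : ∀ k, (D.step ω)^[k] F 0 ≤ m + ((D.step ω)^[k] f 0 - (D.step ω)^[k + 1] f 0)
      + (D.step ω)^[k] (fun x => |F x - m - (f x - D.step ω f x)|) 0 := fun k => by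
    calc (D.step ω)^[k] F 0
        ≤ (D.step ω)^[k] (fun x => (m + (f x - D.step ω f x))
          + |F x - m - (f x - D.step ω f x)|) 0 :=
          h.iterate_step_mono (fun x => by
            linarith [le_abs_self (F x - m - (f x - D.step ω f x))]) ω k 0
      _ = _ := by
          rw [D.iterate_step_add ω (fun x => m + (f x - D.step ω f x)),
            D.iterate_step_add ω (fun _ => m), D.iterate_step_sub ω f, h.iterate_step_const]
          rfl
  refine (Finset.sum_le_sum fun k _ => h1 k).trans ?_
  rw [Finset.sum_add_distrib, Finset.sum_add_distrib, Finset.sum_range_sub',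
    Finset.sum_const, Finset.card_range, nsmul_eq_mul]
  have h2 := hf n
  have h3 := abs_le.1 (hfn 0)
  have h4 := abs_le.1 (hfn n)
  have h5 : 2 * B ≤ δ / 2 * n := by
    rw [div_le_iff₀ (by positivity)] at hn₀
    refine hn₀.trans ?_
    rw [mul_comm]
    gcongr
  nlinarith

namespace Admissible

lemma integral_M_pos [IsProbabilityMeasure μ] (h : D.Admissible μ c C ε N) : 0 < ∫ ω, D.M ω ∂μ := by
  calc 0 < c := h.c_pos
    _ = ∫ _, c ∂μ := by simp
    _ ≤ _ := integral_mono (integrable_const c) h.bddMeas_M.integrable h.M_lower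

lemma ae_averagesTo [IsProbabilityMeasure μ] (h : D.Admissible μ c C ε N) {i : Fin d}
    (herg : Ergodic (D.T (Pi.single i 1)) μ) {f : Ω → ℝ} (hf : Measurable f)
    (hfi : Integrable f μ) :
    ∀ᵐ ω ∂μ, D.AveragesTo ω (fun x => f (D.T x ω)) ((∫ ω, D.M ω * f ω ∂μ) / ∫ ω, D.M ω ∂μ) := by
  set m := (∫ ω, D.M ω * f ω ∂μ) / ∫ ω, D.M ω ∂μ with hm
  have hMi : Integrable D.M μ := h.bddMeas_M.integrable
  have hMpos := h.integral_M_pos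
  have h0 : ∫ ω, D.M ω * (f ω - m) ∂μ = 0 := by
    simp_rw [mul_sub]
    have h1 : Integrable (fun ω => D.M ω * m) μ := hMi.mul_const m
    rw [integral_sub (h.integrable_M_mul hfi) h1, integral_mul_const, hm]
    field_simp
    ring
  filter_upwards [h.ae_exists_coboundary_near herg (hf.sub_const m)
    (hfi.sub (integrable_const m)) h0] with ω hω δ hδ
  obtain ⟨u, ⟨-, B, hB⟩, hu⟩ := hω δ hδ
  refine ⟨fun x => u (D.T x ω), ⟨B, fun x => hB _⟩, fun n => (le_of_eq ?_).trans (hu n)⟩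
  refine Finset.sum_congr rfl fun k _ => ?_
  rw [h.iterate_avg_eq]
  simp_rw [h.avg_comp_T]

end Admissible

end CycleData

namespace CycleData

variable {d K : ℕ} {Ω : Type*} {D : CycleData d K Ω}

/-- The harmonic coordinate `v_i + χ_i(v, ω)`. -/
def harm (χ : Fin d → Zd d → Ω → ℝ) (i : Fin d) (v : Zd d) (ω : Ω) : ℝ := (v i : ℝ) + χ i v ω

/-- The conditional covariance of the increments of the harmonic coordinates. -/
def covEntry (D : CycleData d K Ω) (χ : Fin d → Zd d → Ω → ℝ) (i j : Fin d) (ω : Ω) : ℝ :=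
  ∑ v ∈ D.jumps, D.p v ω * (harm χ i v ω * harm χ j v ω)

/-- The contribution of large increments to the conditional variance. -/
def tailVar (D : CycleData d K Ω) (χ : Fin d → Zd d → Ω → ℝ) (b : ℕ) (ω : Ω) : ℝ :=
  ∑ v ∈ D.jumps, if (b : ℝ) < ∑ i, harm χ i v ω ^ 2 then D.p v ω * ∑ i, harm χ i v ω ^ 2 else 0

lemma sum_p_mul_sq (χ : Fin d → Zd d → Ω → ℝ) (a : Fin d → ℝ) (ω : Ω) :
    ∑ v ∈ D.jumps, D.p v ω * (∑ i, a i * harm χ i v ω) ^ 2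
      = ∑ i, ∑ j, a i * a j * D.covEntry χ i j ω := by
  simp only [covEntry, Finset.mul_sum, pow_two, Finset.sum_mul]
  rw [Finset.sum_comm]
  rw [Finset.sum_comm]
  conv_lhs => enter [2, v]; rw [Finset.sum_comm]
  rw [Finset.sum_comm]
  refine Finset.sum_congr rfl fun i _ => ?_
  rw [Finset.sum_comm]
  exact Finset.sum_congr rfl fun j _ => Finset.sum_congr rfl fun v _ => by ring

variable [MeasurableSpace Ω] {μ : Measure Ω} {c C ε : ℝ} {N : ℕ}

/-- The limiting covariance matrix. -/
def covMat (D : CycleData d K Ω) (μ : Measure Ω) (χ : Fin d → Zd d → Ω → ℝ) :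
    Matrix (Fin d) (Fin d) ℝ :=
  Matrix.of fun i j => (∫ ω, D.M ω * D.covEntry χ i j ω ∂μ) / ∫ ω, D.M ω ∂μ

lemma isSymm_covMat (χ : Fin d → Zd d → Ω → ℝ) : (D.covMat μ χ).IsSymm := by
  ext i j
  simp only [covMat, Matrix.transpose_apply, Matrix.of_apply, covEntry, mul_comm (harm χ j _ _)]

namespace Admissible

variable {χ : Fin d → Zd d → Ω → ℝ} {u : Fin d → ℕ → Ω → ℝ}

lemma measurable_harm (hχ : ∀ i, D.IsCorrector μ i (χ i) (u i)) (i : Fin d) (v : Zd d) :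
    Measurable (harm χ i v) := ((hχ i).meas v).const_add _

lemma measurable_covEntry (h : D.Admissible μ c C ε N)
    (hχ : ∀ i, D.IsCorrector μ i (χ i) (u i)) (i j : Fin d) : Measurable (D.covEntry χ i j) :=
  Finset.measurable_fun_sum _ fun v _ =>
    (h.p_meas v).mul ((measurable_harm hχ i v).mul (measurable_harm hχ j v))

lemma measurable_tailVar (h : D.Admissible μ c C ε N)
    (hχ : ∀ i, D.IsCorrector μ i (χ i) (u i)) (b : ℕ) : Measurable (D.tailVar χ b) := by
  refine Finset.measurable_fun_sum _ fun v _ => ?_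
  have h1 : Measurable fun ω => ∑ i, harm χ i v ω ^ 2 :=
    Finset.measurable_fun_sum _ fun i _ => (measurable_harm hχ i v).pow_const 2
  exact Measurable.ite (measurableSet_lt measurable_const h1) ((h.p_meas v).mul h1)
    measurable_const

lemma tailVar_nonneg (h : D.Admissible μ c C ε N) (b : ℕ) (ω : Ω) : 0 ≤ D.tailVar χ b ω := by
  refine Finset.sum_nonneg fun v _ => ?_
  split_ifs
  · exact mul_nonneg (h.p_nonneg v ω) (Finset.sum_nonneg fun i _ => sq_nonneg _)
  · exact le_rfl

lemma tailVar_le (h : D.Admissible μ c C ε N) (b : ℕ) (ω : Ω) :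
    D.tailVar χ b ω ≤ ∑ v ∈ D.jumps, ∑ i, harm χ i v ω ^ 2 := by
  refine Finset.sum_le_sum fun v _ => ?_
  have h0 : 0 ≤ ∑ i, harm χ i v ω ^ 2 := Finset.sum_nonneg fun i _ => sq_nonneg _
  split_ifs
  · exact mul_le_of_le_one_left h0 (h.p_le_one v ω)
  · exact h0

variable [IsProbabilityMeasure μ]

lemma integrable_harm_sq (hχ : ∀ i, D.IsCorrector μ i (χ i) (u i)) (i : Fin d) (v : Zd d) :
    Integrable (fun ω => harm χ i v ω ^ 2) μ := by
  have h1 : MemLp (χ i v) 2 μ :=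
    (memLp_two_iff_integrable_sq ((hχ i).meas v).aestronglyMeasurable).2 ((hχ i).sq_integrable v)
  have h2 : MemLp (harm χ i v) 2 μ := (memLp_const (v i : ℝ)).add h1
  exact h2.integrable_sq

lemma integrable_harm_mul (hχ : ∀ i, D.IsCorrector μ i (χ i) (u i)) (i j : Fin d) (v : Zd d) :
    Integrable (fun ω => harm χ i v ω * harm χ j v ω) μ := by
  have key : ∀ k, MemLp (harm χ k v) 2 μ := fun k =>
    (memLp_two_iff_integrable_sq (measurable_harm hχ k v).aestronglyMeasurable).2
      (integrable_harm_sq hχ k v)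
  exact (key i).integrable_mul (key j)

lemma integrable_covEntry (h : D.Admissible μ c C ε N)
    (hχ : ∀ i, D.IsCorrector μ i (χ i) (u i)) (i j : Fin d) : Integrable (D.covEntry χ i j) μ :=
  integrable_finsetSum _ fun v _ => h.integrable_p_mul (integrable_harm_mul hχ i j v) v

lemma integrable_sum_harm_sq (hχ : ∀ i, D.IsCorrector μ i (χ i) (u i)) :
    Integrable (fun ω => ∑ v ∈ D.jumps, ∑ i, harm χ i v ω ^ 2) μ :=
  integrable_finsetSum _ fun v _ => integrable_finsetSum _ fun i _ => integrable_harm_sq hχ i v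

lemma integrable_tailVar (h : D.Admissible μ c C ε N)
    (hχ : ∀ i, D.IsCorrector μ i (χ i) (u i)) (b : ℕ) : Integrable (D.tailVar χ b) μ :=
  (integrable_sum_harm_sq hχ).mono' (h.measurable_tailVar hχ b).aestronglyMeasurable
    (Filter.Eventually.of_forall fun ω => by
      rw [Real.norm_of_nonneg (h.tailVar_nonneg b ω)]
      exact h.tailVar_le b ω)

lemma tendsto_integral_tailVar (h : D.Admissible μ c C ε N)
    (hχ : ∀ i, D.IsCorrector μ i (χ i) (u i)) :
    Filter.Tendsto (fun b : ℕ => (∫ ω, D.M ω * D.tailVar χ b ω ∂μ) / ∫ ω, D.M ω ∂μ)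
      Filter.atTop (nhds 0) := by
  have hlim : ∀ ω, ∀ᶠ b : ℕ in Filter.atTop, D.M ω * D.tailVar χ b ω = 0 := fun ω => by
    obtain ⟨b₀, hb₀⟩ := exists_nat_ge (∑ v ∈ D.jumps, ∑ i, harm χ i v ω ^ 2)
    filter_upwards [Filter.eventually_ge_atTop b₀] with b hb
    have : D.tailVar χ b ω = 0 := by
      refine Finset.sum_eq_zero fun v hv => if_neg (not_lt.2 ?_)
      calc ∑ i, harm χ i v ω ^ 2 ≤ ∑ v ∈ D.jumps, ∑ i, harm χ i v ω ^ 2 :=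
            Finset.single_le_sum (f := fun v => ∑ i, harm χ i v ω ^ 2)
              (fun v _ => Finset.sum_nonneg fun i _ => sq_nonneg _) hv
        _ ≤ b₀ := hb₀
        _ ≤ b := by exact_mod_cast hb
    rw [this, mul_zero]
  have h1 : Filter.Tendsto (fun b : ℕ => ∫ ω, D.M ω * D.tailVar χ b ω ∂μ) Filter.atTop
      (nhds (∫ _, (0 : ℝ) ∂μ)) := by
    refine tendsto_integral_of_dominated_convergence
      (fun ω => D.M ω * ∑ v ∈ D.jumps, ∑ i, harm χ i v ω ^ 2)
      (fun b => (h.M_meas.mul (h.measurable_tailVar hχ b)).aestronglyMeasurable)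
      (h.integrable_M_mul (integrable_sum_harm_sq hχ))
      (fun b => Filter.Eventually.of_forall fun ω => ?_)
      (Filter.Eventually.of_forall fun ω => tendsto_nhds_of_eventually_eq (hlim ω))
    rw [Real.norm_of_nonneg (mul_nonneg (h.M_pos ω).le (h.tailVar_nonneg b ω))]
    exact mul_le_mul_of_nonneg_left (h.tailVar_le b ω) (h.M_pos ω).le
  simpa using h1.div_const (∫ ω, D.M ω ∂μ)

/-- The quenched central limit theorem for the harmonic coordinates, in terms of
characteristic functions. -/
lemma ae_tendsto_iterate_step_exp_harm (h : D.Admissible μ c C ε N)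
    (hχ : ∀ i, D.IsCorrector μ i (χ i) (u i)) {i₀ : Fin d}
    (herg : Ergodic (D.T (Pi.single i₀ 1)) μ) :
    ∀ᵐ ω ∂μ, ∀ a : Fin d → ℝ, 0 ≤ ∑ i, ∑ j, a i * a j * D.covMat μ χ i j →
      Filter.Tendsto (fun n : ℕ => (D.step ω)^[n] (fun x =>
        Complex.exp (((∑ i, a i * harm χ i x ω) / Real.sqrt n : ℝ) * Complex.I)) 0)
        Filter.atTop
        (nhds (Real.exp (-(∑ i, ∑ j, a i * a j * D.covMat μ χ i j) / 2) : ℝ)) := by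
  have hA : ∀ᵐ ω ∂μ, ∀ i j, D.AveragesTo ω (fun x => D.covEntry χ i j (D.T x ω))
      (D.covMat μ χ i j) :=
    ae_all_iff.2 fun i => ae_all_iff.2 fun j =>
      h.ae_averagesTo herg (h.measurable_covEntry hχ i j) (h.integrable_covEntry hχ i j)
  have hB : ∀ᵐ ω ∂μ, ∀ b : ℕ, D.AveragesTo ω (fun x => D.tailVar χ b (D.T x ω))
      ((∫ ω, D.M ω * D.tailVar χ b ω ∂μ) / ∫ ω, D.M ω ∂μ) :=
    ae_all_iff.2 fun b =>
      h.ae_averagesTo herg (h.measurable_tailVar hχ b) (h.integrable_tailVar hχ b)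
  have hcoc : ∀ᵐ ω ∂μ, ∀ i x y, χ i (x + y) ω = χ i x (D.T y ω) + χ i y ω :=
    ae_all_iff.2 fun i => (hχ i).cocycle
  have hharm : ∀ᵐ ω ∂μ, ∀ x i, ∑ v ∈ D.jumps, D.p v (D.T x ω) * harm χ i v (D.T x ω) = 0 :=
    h.ae_forall_T (ae_all_iff.2 fun i => (hχ i).harmonic)
  filter_upwards [hA, hB, hcoc, hharm] with ω hAω hBω hcω hhω a hσ
  have hinc : ∀ x v, ∑ i, a i * harm χ i (x + v) ω - ∑ i, a i * harm χ i x ω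
      = ∑ i, a i * harm χ i v (D.T x ω) := fun x v => by
    rw [← Finset.sum_sub_distrib]
    refine Finset.sum_congr rfl fun i _ => ?_
    simp only [harm]
    rw [add_comm x v, hcω i v x]
    simp only [Pi.add_apply, Int.cast_add]
    ring
  obtain ⟨s, hs⟩ : ∃ s, s = ∑ i, a i ^ 2 := ⟨_, rfl⟩
  have hs0 : 0 ≤ s := hs ▸ Finset.sum_nonneg fun i _ => sq_nonneg _
  have hcs : ∀ v ω', (∑ i, a i * harm χ i v ω') ^ 2 ≤ s * ∑ i, harm χ i v ω' ^ 2 := fun v ω' =>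
    hs ▸ Finset.sum_mul_sq_le_sq_mul_sq _ _ _
  refine h.tendsto_iterate_step_exp ω hσ ?_ ?_ ?_ ?_
  · refine Finset.sum_eq_zero fun i _ => ?_
    have h0 := hcω i 0 0
    rw [add_zero, h.T_zero] at h0
    have h1 : χ i 0 ω = 0 := by linarith
    simp [harm, h1]
  · intro x
    simp_rw [hinc, Finset.mul_sum]
    rw [Finset.sum_comm]
    refine Finset.sum_eq_zero fun i _ => ?_
    calc _ = a i * ∑ v ∈ D.jumps, D.p v (D.T x ω) * harm χ i v (D.T x ω) := by
          rw [Finset.mul_sum]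
          exact Finset.sum_congr rfl fun v _ => by ring
      _ = 0 := by rw [hhω x i, mul_zero]
  · simp_rw [hinc, sum_p_mul_sq]
    exact AveragesTo.sum h fun i _ => AveragesTo.sum h fun j _ => (hAω i j).const_mul _
  · intro δ hδ
    simp_rw [hinc]
    obtain ⟨b, hb⟩ := ((h.tendsto_integral_tailVar hχ).eventually_lt_const
      (show 0 < δ / (s + 1) / 2 by positivity)).exists
    obtain ⟨n₀, hn₀⟩ := AveragesTo.sum_le h (hBω b) (show 0 < δ / (s + 1) / 2 by positivity)
    refine ⟨Real.sqrt (s * b), Real.sqrt_nonneg _, n₀, fun n hn => ?_⟩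
    have hpt : ∀ x, (∑ v ∈ D.jumps, if Real.sqrt (s * b) < |∑ i, a i * harm χ i v (D.T x ω)|
        then D.p v (D.T x ω) * (∑ i, a i * harm χ i v (D.T x ω)) ^ 2 else 0)
        ≤ D.tailVar χ b (D.T x ω) • s := fun x => by
      rw [tailVar, smul_eq_mul, Finset.sum_mul]
      refine Finset.sum_le_sum fun v _ => ?_
      have hp := h.p_nonneg v (D.T x ω)
      have hq : 0 ≤ ∑ i, harm χ i v (D.T x ω) ^ 2 := Finset.sum_nonneg fun i _ => sq_nonneg _
      have h2 := hcs v (D.T x ω)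
      split_ifs with h3 h4
      · calc _ ≤ D.p v (D.T x ω) * (s * ∑ i, harm χ i v (D.T x ω) ^ 2) := by gcongr
          _ = _ := by ring
      · exfalso
        have h5 : s * b < (∑ i, a i * harm χ i v (D.T x ω)) ^ 2 := by
          rw [← sq_abs]
          exact (Real.sqrt_lt' (lt_of_le_of_lt (Real.sqrt_nonneg _) h3)).1 h3
        have h6 : s * ∑ i, harm χ i v (D.T x ω) ^ 2 ≤ s * b :=
          mul_le_mul_of_nonneg_left (not_lt.1 h4) hs0
        linarith
      · positivity
      · simp
    calc _ ≤ ∑ k ∈ Finset.range n,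
          (D.step ω)^[k] (fun x => D.tailVar χ b (D.T x ω) • s) (0 : Zd d) :=
          Finset.sum_le_sum fun k _ => h.iterate_step_mono hpt ω k 0
      _ = (∑ k ∈ Finset.range n, (D.step ω)^[k] (fun x => D.tailVar χ b (D.T x ω)) 0) * s := by
          simp_rw [D.iterate_step_smul_const, smul_eq_mul]
          rw [← Finset.sum_mul]
      _ ≤ (δ / (s + 1) / 2 + δ / (s + 1) / 2) * n * s := by
          gcongr
          refine (hn₀ n hn).trans ?_
          gcongr
      _ = δ * n * (s / (s + 1)) := by ring
      _ ≤ δ * n * 1 := by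
          gcongr
          rw [div_le_one (by positivity)]
          linarith
      _ = δ * n := mul_one _

end Admissible

end CycleData

namespace CycleData

namespace Admissible

variable {d K : ℕ} {Ω : Type*} [MeasurableSpace Ω] {D : CycleData d K Ω} {μ : Measure Ω}
  {c C ε : ℝ} {N : ℕ} [IsProbabilityMeasure μ] {χ : Fin d → Zd d → Ω → ℝ} {u : Fin d → ℕ → Ω → ℝ}

lemma sq_le_integral_of_isCorrector (h : D.Admissible μ c C ε N)
    (hχ : ∀ i, D.IsCorrector μ i (χ i) (u i)) (a : Fin d → ℝ) (i : Fin d) :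
    a i ^ 2 ≤ coerConst c ε N *
      (2 * ∫ ω, D.M ω * ∑ v ∈ D.jumps, D.p v ω * (∑ j, a j * harm χ j v ω) ^ 2 ∂μ) := by
  obtain ⟨s, hs⟩ : ∃ s, s = ∑ j, a j ^ 2 := ⟨_, rfl⟩
  have hs0 : 0 ≤ s := hs ▸ Finset.sum_nonneg fun i _ => sq_nonneg _
  have hC : 0 ≤ C := by
    obtain ⟨ω⟩ : Nonempty Ω := nonempty_of_isProbabilityMeasure μ
    exact (h.M_pos ω).le.trans (h.M_upper ω)
  have hcoer := h.coerConst_nonneg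
  set r : ℕ → Fin d → Zd d → Ω → ℝ :=
    fun k j v ω => χ j v ω - (u j k (D.T v ω) - u j k ω) with hr
  set G : ℕ → Zd d → Ω → ℝ :=
    fun k x ω => ∑ j, a j * ((x j : ℝ) + (u j k (D.T x ω) - u j k ω)) with hG
  have hGbdd : ∀ k x, BddMeas (G k x) := fun k x =>
    BddMeas.sum _ fun j _ => ((BddMeas.const _).add
      ((h.bddMeas_comp ((hχ j).bddMeas k) x).sub ((hχ j).bddMeas k))).const_mul _
  have hGcoc : ∀ k x y ω, G k (x + y) ω = G k x (D.T y ω) + G k y ω := fun k x y ω => by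
    simp only [hG]
    rw [← Finset.sum_add_distrib]
    refine Finset.sum_congr rfl fun j _ => ?_
    rw [h.T_add]
    simp only [Pi.add_apply, Int.cast_add]
    ring
  have hGint : ∀ k, ∫ ω, G k (Pi.single i 1) ω ∂μ = a i := fun k => by
    have h1 : ∀ j, ∫ ω, a j * (((Pi.single i 1 : Zd d) j : ℝ)
        + (u j k (D.T (Pi.single i 1) ω) - u j k ω)) ∂μ
        = a j * ((Pi.single i 1 : Zd d) j : ℝ) := fun j => by
      have hb := ((hχ j).bddMeas k).integrable (μ := μ)
      have hb' := h.integrable_comp hb (Pi.single i 1)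
      have hb2 : Integrable (fun ω => u j k (D.T (Pi.single i 1) ω) - u j k ω) μ := hb'.sub hb
      rw [integral_const_mul, integral_add (integrable_const _) hb2,
        integral_sub hb' hb, h.integral_comp (u j k)]
      simp
    simp only [hG]
    rw [integral_finsetSum _ fun j _ => (((BddMeas.const _).add
      ((h.bddMeas_comp ((hχ j).bddMeas k) _).sub ((hχ j).bddMeas k))).const_mul _).integrable]
    simp_rw [h1]
    rw [Finset.sum_eq_single i (fun j _ hj => by simp [Pi.single_eq_of_ne hj])
      (fun hi => absurd (Finset.mem_univ i) hi)]
    simp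
  have hlow : ∀ k, a i ^ 2 ≤ ∫ ω, G k (Pi.single i 1) ω ^ 2 ∂μ := fun k => by
    have h1 : 0 ≤ ∫ ω, (G k (Pi.single i 1) ω - a i) ^ 2 ∂μ :=
      integral_nonneg fun ω => sq_nonneg _
    have hb := hGbdd k (Pi.single i 1)
    have e1 : Integrable (fun ω => 2 * a i * G k (Pi.single i 1) ω) μ :=
      hb.integrable.const_mul _
    have e2 : Integrable (fun ω => G k (Pi.single i 1) ω ^ 2) μ := hb.sq.integrable
    have e3 : Integrable (fun ω => G k (Pi.single i 1) ω ^ 2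
      - 2 * a i * G k (Pi.single i 1) ω) μ := e2.sub e1
    have h2 : ∫ ω, (G k (Pi.single i 1) ω - a i) ^ 2 ∂μ
        = ∫ ω, (G k (Pi.single i 1) ω ^ 2 - 2 * a i * G k (Pi.single i 1) ω + a i ^ 2) ∂μ :=
      integral_congr_ae (Filter.Eventually.of_forall fun ω => by ring)
    rw [h2, integral_add e3 (integrable_const _), integral_sub e2 e1, integral_const_mul,
      hGint k] at h1
    simp at h1
    linarith
  have hri : ∀ k j v, Integrable (fun ω => r k j v ω ^ 2) μ := fun k j v => by
    have h1 : MemLp (χ j v) 2 μ :=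
      (memLp_two_iff_integrable_sq ((hχ j).meas v).aestronglyMeasurable).2
        ((hχ j).sq_integrable v)
    have hb := (h.bddMeas_comp ((hχ j).bddMeas k) v).sub ((hχ j).bddMeas k)
    have h2 : MemLp (fun ω => u j k (D.T v ω) - u j k ω) 2 μ :=
      (memLp_two_iff_integrable_sq hb.1.aestronglyMeasurable).2 hb.sq.integrable
    exact (h1.sub h2).integrable_sq
  have hξi : Integrable (fun ω => ∑ v ∈ D.jumps, D.p v ω * (∑ j, a j * harm χ j v ω) ^ 2) μ := by
    simp_rw [sum_p_mul_sq]
    exact integrable_finsetSum _ fun i _ => integrable_finsetSum _ fun j _ =>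
      (h.integrable_covEntry hχ i j).const_mul _
  have hRi : ∀ k, Integrable (fun ω => ∑ v ∈ D.jumps, ∑ j, r k j v ω ^ 2) μ := fun k =>
    integrable_finsetSum _ fun v _ => integrable_finsetSum _ fun j _ => hri k j v
  have hup : ∀ k, ∫ ω, D.M ω * ∑ v ∈ D.jumps, D.p v ω * G k v ω ^ 2 ∂μ ≤
      2 * ∫ ω, D.M ω * ∑ v ∈ D.jumps, D.p v ω * (∑ j, a j * harm χ j v ω) ^ 2 ∂μ
        + 2 * C * s * ∑ v ∈ D.jumps, ∑ j, ∫ ω, r k j v ω ^ 2 ∂μ := fun k => by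
    have e1 : Integrable (fun ω => D.M ω * ∑ v ∈ D.jumps, D.p v ω * G k v ω ^ 2) μ :=
      h.integrable_M_mul (integrable_finsetSum _ fun v _ =>
        h.integrable_p_mul (hGbdd k v).sq.integrable v)
    have e2 : Integrable (fun ω => 2 * (D.M ω * ∑ v ∈ D.jumps,
      D.p v ω * (∑ j, a j * harm χ j v ω) ^ 2)) μ := (h.integrable_M_mul hξi).const_mul 2
    have e3 : Integrable (fun ω => 2 * C * s * ∑ v ∈ D.jumps, ∑ j, r k j v ω ^ 2) μ :=
      (hRi k).const_mul _
    have h1 := integral_mono e1 (e2.add e3) fun ω => by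
      have hpt : ∀ v ∈ D.jumps, D.p v ω * G k v ω ^ 2
          ≤ 2 * (D.p v ω * (∑ j, a j * harm χ j v ω) ^ 2) + 2 * (s * ∑ j, r k j v ω ^ 2) := by
        intro v _
        have hsplit : G k v ω = ∑ j, a j * harm χ j v ω - ∑ j, a j * r k j v ω := by
          simp only [hG, hr, harm]
          rw [← Finset.sum_sub_distrib]
          exact Finset.sum_congr rfl fun j _ => by ring
        have hcs : (∑ j, a j * r k j v ω) ^ 2 ≤ s * ∑ j, r k j v ω ^ 2 :=
          hs ▸ Finset.sum_mul_sq_le_sq_mul_sq _ _ _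
        have hp := h.p_nonneg v ω
        have hp1 := h.p_le_one v ω
        have h3 : G k v ω ^ 2 ≤ 2 * (∑ j, a j * harm χ j v ω) ^ 2
            + 2 * (s * ∑ j, r k j v ω ^ 2) := by
          rw [hsplit]
          nlinarith [sq_nonneg (∑ j, a j * harm χ j v ω + ∑ j, a j * r k j v ω)]
        have h4 : 0 ≤ s * ∑ j, r k j v ω ^ 2 := (sq_nonneg _).trans hcs
        nlinarith
      calc D.M ω * ∑ v ∈ D.jumps, D.p v ω * G k v ω ^ 2
          ≤ D.M ω * ∑ v ∈ D.jumps, (2 * (D.p v ω * (∑ j, a j * harm χ j v ω) ^ 2)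
            + 2 * (s * ∑ j, r k j v ω ^ 2)) :=
            mul_le_mul_of_nonneg_left (Finset.sum_le_sum hpt) (h.M_pos ω).le
        _ = 2 * (D.M ω * ∑ v ∈ D.jumps, D.p v ω * (∑ j, a j * harm χ j v ω) ^ 2)
            + D.M ω * (2 * s * ∑ v ∈ D.jumps, ∑ j, r k j v ω ^ 2) := by
            rw [Finset.sum_add_distrib, ← Finset.mul_sum, ← Finset.mul_sum, ← Finset.mul_sum]
            ring
        _ ≤ 2 * (D.M ω * ∑ v ∈ D.jumps, D.p v ω * (∑ j, a j * harm χ j v ω) ^ 2)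
            + C * (2 * s * ∑ v ∈ D.jumps, ∑ j, r k j v ω ^ 2) := by
            have := h.M_upper ω
            have h0 : 0 ≤ ∑ v ∈ D.jumps, ∑ j, r k j v ω ^ 2 :=
              Finset.sum_nonneg fun v _ => Finset.sum_nonneg fun j _ => sq_nonneg _
            gcongr
        _ = 2 * (D.M ω * ∑ v ∈ D.jumps, D.p v ω * (∑ j, a j * harm χ j v ω) ^ 2)
            + 2 * C * s * ∑ v ∈ D.jumps, ∑ j, r k j v ω ^ 2 := by ring
    refine h1.trans (le_of_eq ?_)
    rw [integral_add' e2 e3, integral_const_mul, integral_const_mul,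
      integral_finsetSum _ fun v _ => integrable_finsetSum _ fun j _ => hri k j v]
    simp_rw [integral_finsetSum _ fun j _ => hri k j _]
  have hlim : Filter.Tendsto (fun k => coerConst c ε N *
      (2 * ∫ ω, D.M ω * ∑ v ∈ D.jumps, D.p v ω * (∑ j, a j * harm χ j v ω) ^ 2 ∂μ
        + 2 * C * s * ∑ v ∈ D.jumps, ∑ j, ∫ ω, r k j v ω ^ 2 ∂μ)) Filter.atTop
      (nhds (coerConst c ε N *
      (2 * ∫ ω, D.M ω * ∑ v ∈ D.jumps, D.p v ω * (∑ j, a j * harm χ j v ω) ^ 2 ∂μ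
        + 2 * C * s * ∑ v ∈ D.jumps, ∑ _j : Fin d, (0 : ℝ)))) :=
    ((tendsto_finsetSum _ fun v _ => tendsto_finsetSum _ fun j _ =>
      (hχ j).approx v).const_mul _).const_add _ |>.const_mul _
  refine (ge_of_tendsto' hlim fun k => ?_).trans (le_of_eq (by simp))
  exact (hlow k).trans ((h.integral_cocycle_sq_le (hGcoc k)
    (fun v _ => (hGbdd k v).sq.integrable) i).trans
    (mul_le_mul_of_nonneg_left (hup k) hcoer))

lemma sum_covMat_eq (h : D.Admissible μ c C ε N) (hχ : ∀ i, D.IsCorrector μ i (χ i) (u i))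
    (a : Fin d → ℝ) :
    ∑ i, ∑ j, a i * a j * D.covMat μ χ i j =
      (∫ ω, D.M ω * ∑ v ∈ D.jumps, D.p v ω * (∑ j, a j * harm χ j v ω) ^ 2 ∂μ)
        / ∫ ω, D.M ω ∂μ := by
  simp_rw [sum_p_mul_sq, Finset.mul_sum]
  have hi : ∀ i j, Integrable (fun ω => D.M ω * (a i * a j * D.covEntry χ i j ω)) μ := fun i j =>
    h.integrable_M_mul ((h.integrable_covEntry hχ i j).const_mul _)
  rw [integral_finsetSum _ fun i _ => integrable_finsetSum _ fun j _ => hi i j]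
  simp_rw [integral_finsetSum _ fun j _ => hi _ j]
  rw [Finset.sum_div]
  refine Finset.sum_congr rfl fun i _ => ?_
  rw [Finset.sum_div]
  refine Finset.sum_congr rfl fun j _ => ?_
  rw [covMat, Matrix.of_apply, ← mul_div_assoc, ← integral_const_mul]
  congr 1
  exact integral_congr_ae (Filter.Eventually.of_forall fun ω => by ring)

lemma posDef_covMat (h : D.Admissible μ c C ε N) (hχ : ∀ i, D.IsCorrector μ i (χ i) (u i)) :
    (D.covMat μ χ).PosDef := by
  refine Matrix.PosDef.of_dotProduct_mulVec_pos ?_ fun a ha => ?_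
  · rw [Matrix.IsHermitian, Matrix.conjTranspose_eq_transpose_of_trivial]
    exact isSymm_covMat χ
  · obtain ⟨i, hi⟩ := Function.ne_iff.1 ha
    have hq : star a ⬝ᵥ (D.covMat μ χ).mulVec a = ∑ i, ∑ j, a i * a j * D.covMat μ χ i j := by
      simp only [dotProduct, Matrix.mulVec, star_trivial, Finset.mul_sum]
      exact Finset.sum_congr rfl fun i _ => Finset.sum_congr rfl fun j _ => by ring
    rw [hq, h.sum_covMat_eq hχ]
    refine div_pos ?_ h.integral_M_pos
    have h1 := h.sq_le_integral_of_isCorrector hχ a i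
    have h2 : 0 < a i ^ 2 := by
      have : a i ≠ 0 := hi
      positivity
    by_contra hneg
    have h3 := mul_nonpos_of_nonneg_of_nonpos h.coerConst_nonneg
      (show 2 * ∫ ω, D.M ω * ∑ v ∈ D.jumps, D.p v ω * (∑ j, a j * harm χ j v ω) ^ 2 ∂μ ≤ 0 by
        linarith [not_lt.1 hneg])
    linarith

end Admissible

end CycleData

lemma norm_exp_mul_I_sub_exp_mul_I_le (x y : ℝ) :
    ‖Complex.exp (x * Complex.I) - Complex.exp (y * Complex.I)‖ ≤ |x - y| := by
  have h1 : Complex.exp (x * Complex.I) - Complex.exp (y * Complex.I)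
      = Complex.exp (y * Complex.I) * (Complex.exp (Complex.I * ((x - y : ℝ) : ℂ)) - 1) := by
    rw [mul_sub, ← Complex.exp_add, mul_one]
    congr 2
    push_cast
    ring
  rw [h1, norm_mul, Complex.norm_exp_ofReal_mul_I, one_mul, ← Real.norm_eq_abs]
  exact Real.norm_exp_I_mul_ofReal_sub_one_le

namespace CycleData

/-- The points where some corrector exceeds `t`. -/
def largeSet {d : ℕ} {Ω : Type*} (χ : Fin d → Zd d → Ω → ℝ) (ω : Ω) (t : ℝ) : Set (Zd d) :=
  {x | ∃ i, t < |χ i x ω|}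

namespace Admissible

variable {d K : ℕ} {Ω : Type*} [MeasurableSpace Ω] {D : CycleData d K Ω} {μ : Measure Ω}
  {c C ε : ℝ} {N : ℕ} {χ : Fin d → Zd d → Ω → ℝ} {u : Fin d → ℕ → Ω → ℝ}

/-- A corrector that is sublinear on average is negligible along the walk. -/
lemma iterate_step_corrector_large_le (h : D.Admissible μ c C ε N) {ω : Ω}
    (hsub : ∀ i, ∀ η > 0, ∀ δ > 0, ∃ n₀ : ℕ, ∀ n ≥ n₀,
      (((box d n).filter (fun y => η * n < |χ i y ω|)).card : ℝ) ≤ δ * n ^ d)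
    {η δ : ℝ} (hη : 0 < η) (hδ : 0 < δ) :
    ∃ n₀ : ℕ, ∀ n ≥ n₀, (D.step ω)^[n]
      (fun x => if x ∈ largeSet χ ω (η * √n) then (1 : ℝ) else 0) 0 ≤ δ := by
  obtain ⟨κ, hκ0, hκ⟩ := h.exists_iterate_step_bound ω
  obtain ⟨R, hR⟩ : ∃ R, R = 1 + 2 * κ / δ ^ 2 := ⟨_, rfl⟩
  have hR1 : 1 ≤ R := by rw [hR]; linarith [show 0 ≤ 2 * κ / δ ^ 2 by positivity]
  have hRpos : 0 < R := by linarith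
  have hκR : κ * (1 / R ^ 2) ≤ δ ^ 2 / 2 := by
    have h1 : κ ≤ δ ^ 2 / 2 * R := by
      rw [hR]
      field_simp
      nlinarith [sq_nonneg δ]
    have h2 : δ ^ 2 / 2 * R ≤ δ ^ 2 / 2 * R ^ 2 := by gcongr; nlinarith
    rw [mul_one_div, div_le_iff₀ (by positivity)]
    linarith
  obtain ⟨δ', hδ'⟩ : ∃ δ', δ' = δ ^ 2 / 2 / (κ * (d * (2 * R) ^ d) + 1) := ⟨_, rfl⟩
  have hδ'0 : 0 < δ' := by rw [hδ']; positivity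
  have hκδ : κ * (d * δ' * (2 * R) ^ d) ≤ δ ^ 2 / 2 := by
    have h1 : κ * (d * δ' * (2 * R) ^ d)
        = δ ^ 2 / 2 * (κ * (d * (2 * R) ^ d) / (κ * (d * (2 * R) ^ d) + 1)) := by
      rw [hδ']
      ring
    rw [h1]
    refine mul_le_of_le_one_right (by positivity) ?_
    rw [div_le_one (by positivity)]
    linarith
  choose n₁ hn₁ using fun i => hsub i (η / (2 * R)) (by positivity) δ' hδ'0
  refine ⟨max 1 ((Finset.univ.sup n₁) ^ 2), fun n hn => ?_⟩
  have hn1 : 1 ≤ n := (le_max_left _ _).trans hn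
  have hs1 : 1 ≤ √(n : ℝ) := Real.one_le_sqrt.2 (by exact_mod_cast hn1)
  obtain ⟨m, hm⟩ : ∃ m, m = ⌈R * √(n : ℝ)⌉₊ := ⟨_, rfl⟩
  have hm1 : R * √n ≤ m := hm ▸ Nat.le_ceil _
  have hm2 : (m : ℝ) ≤ 2 * R * √n := by
    have h1 : (m : ℝ) < R * √n + 1 := hm ▸ Nat.ceil_lt_add_one (by positivity)
    nlinarith
  have hmn : ∀ i, n₁ i ≤ m := fun i => by
    have h1 : (n₁ i) ^ 2 ≤ n :=
      (Nat.pow_le_pow_left (Finset.le_sup (Finset.mem_univ i)) 2).trans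
        ((le_max_right _ _).trans hn)
    have h2 : (n₁ i : ℝ) ≤ √n := Real.le_sqrt_of_sq_le (by exact_mod_cast h1)
    have h3 : (n₁ i : ℝ) ≤ m := by nlinarith
    exact_mod_cast h3
  have hcard : (((box d m).filter (· ∈ largeSet χ ω (η * √n))).card : ℝ)
      ≤ d * δ' * (2 * R) ^ d * √n ^ d := by
    have hss : (box d m).filter (· ∈ largeSet χ ω (η * √n)) ⊆
        Finset.univ.biUnion fun i => (box d m).filter fun y => η / (2 * R) * m < |χ i y ω| := by
      intro y hy
      rw [Finset.mem_filter, largeSet, Set.mem_ofPred_eq] at hy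
      obtain ⟨hy, i, hi⟩ := hy
      refine Finset.mem_biUnion.2 ⟨i, Finset.mem_univ i, Finset.mem_filter.2 ⟨hy, ?_⟩⟩
      refine lt_of_le_of_lt ?_ hi
      rw [div_mul_eq_mul_div, div_le_iff₀ (by positivity)]
      nlinarith
    calc (((box d m).filter (· ∈ largeSet χ ω (η * √n))).card : ℝ)
        ≤ ∑ i, (((box d m).filter fun y => η / (2 * R) * m < |χ i y ω|).card : ℝ) := by
          exact_mod_cast (Finset.card_le_card hss).trans Finset.card_biUnion_le
      _ ≤ ∑ _i : Fin d, δ' * (m : ℝ) ^ d := Finset.sum_le_sum fun i _ => hn₁ i m (hmn i)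
      _ = d * δ' * (m : ℝ) ^ d := by simp; ring
      _ ≤ d * δ' * (2 * R * √n) ^ d := by gcongr
      _ = d * δ' * (2 * R) ^ d * √n ^ d := by rw [mul_pow]; ring
  refine le_of_sq_le_sq ((hκ n R m _ hn1 hR1 hm1).trans ?_) hδ.le
  have h3 : (((box d m).filter (· ∈ largeSet χ ω (η * √n))).card : ℝ) / √n ^ d
      ≤ d * δ' * (2 * R) ^ d := by
    rw [div_le_iff₀ (by positivity)]
    exact hcard
  calc _ ≤ κ * (d * δ' * (2 * R) ^ d + 1 / R ^ 2) := by gcongr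
    _ ≤ δ ^ 2 := by rw [mul_add]; linarith

/-- The characteristic functions of the rescaled walk converge. -/
lemma ae_tendsto_iterate_step_exp [IsProbabilityMeasure μ] (h : D.Admissible μ c C ε N)
    (hχ : ∀ i, D.IsCorrector μ i (χ i) (u i)) {i₀ : Fin d}
    (herg : Ergodic (D.T (Pi.single i₀ 1)) μ) :
    ∀ᵐ ω ∂μ, ∀ a : Fin d → ℝ, 0 ≤ ∑ i, ∑ j, a i * a j * D.covMat μ χ i j →
      Filter.Tendsto (fun n : ℕ => (D.step ω)^[n] (fun x =>
        Complex.exp (((∑ i, a i * (x i : ℝ)) / Real.sqrt n : ℝ) * Complex.I)) 0)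
        Filter.atTop
        (nhds (Real.exp (-(∑ i, ∑ j, a i * a j * D.covMat μ χ i j) / 2) : ℝ)) := by
  filter_upwards [h.ae_tendsto_iterate_step_exp_harm hχ herg,
    ae_all_iff.2 fun i => (hχ i).sublinear] with ω hω hsub a ha
  refine (hω a ha).congr_dist ?_
  rw [Metric.tendsto_atTop]
  intro δ hδ
  obtain ⟨s, hs⟩ : ∃ s, s = ∑ i, |a i| := ⟨_, rfl⟩
  have hs0 : 0 ≤ s := hs ▸ Finset.sum_nonneg fun i _ => abs_nonneg _
  obtain ⟨η, hη⟩ : ∃ η, η = δ / 4 / (s + 1) := ⟨_, rfl⟩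
  have hη0 : 0 < η := by rw [hη]; positivity
  have hsη : s * η ≤ δ / 4 := by
    rw [hη, mul_div_assoc', div_le_iff₀ (by positivity)]
    nlinarith
  obtain ⟨n₀, hn₀⟩ := h.iterate_step_corrector_large_le hsub hη0 (δ := δ / 8) (by positivity)
  refine ⟨max 1 n₀, fun n hn => ?_⟩
  have hn1 : 1 ≤ n := (le_max_left _ _).trans hn
  have hsn : 0 < √(n : ℝ) := Real.sqrt_pos.2 (by exact_mod_cast hn1)
  rw [Real.dist_eq, sub_zero, abs_of_nonneg dist_nonneg, dist_eq_norm, ← D.iterate_step_sub]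
  refine (h.norm_iterate_step_le _ ω n 0).trans_lt ?_
  have hpt : ∀ x, ‖Complex.exp (((∑ i, a i * harm χ i x ω) / √n : ℝ) * Complex.I)
      - Complex.exp (((∑ i, a i * (x i : ℝ)) / √n : ℝ) * Complex.I)‖
      ≤ s * η + (if x ∈ largeSet χ ω (η * √n) then (1 : ℝ) else 0) • 2 := fun x => by
    by_cases hx : x ∈ largeSet χ ω (η * √n)
    · rw [if_pos hx]
      refine (norm_sub_le _ _).trans ?_
      rw [Complex.norm_exp_ofReal_mul_I, Complex.norm_exp_ofReal_mul_I, smul_eq_mul]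
      have : 0 ≤ s * η := by positivity
      linarith
    · rw [if_neg hx, zero_smul, add_zero]
      refine (norm_exp_mul_I_sub_exp_mul_I_le _ _).trans ?_
      rw [← sub_div, ← Finset.sum_sub_distrib, abs_div, abs_of_pos hsn, div_le_iff₀ hsn, hs,
        Finset.sum_mul, Finset.sum_mul]
      refine (Finset.abs_sum_le_sum_abs _ _).trans (Finset.sum_le_sum fun i _ => ?_)
      rw [largeSet, Set.mem_ofPred_eq] at hx
      push Not at hx
      have h1 : a i * harm χ i x ω - a i * (x i : ℝ) = a i * χ i x ω := by
        simp only [harm]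
        ring
      rw [h1, abs_mul, mul_assoc]
      exact mul_le_mul_of_nonneg_left (hx i) (abs_nonneg _)
  refine (h.iterate_step_mono hpt ω n 0).trans_lt ?_
  rw [D.iterate_step_add ω (fun _ => s * η), h.iterate_step_const, D.iterate_step_smul_const,
    smul_eq_mul]
  have := hn₀ n ((le_max_right _ _).trans hn)
  linarith

end Admissible

end CycleData

lemma measurableSet_eval_eq {d : ℕ} (m : ℕ) (y : Zd d) :
    MeasurableSet {σ : ℕ → Zd d | σ m = y} :=
  (measurableSet_singleton y).preimage (measurable_pi_apply m)

namespace CycleData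

namespace Admissible

variable {d K : ℕ} {Ω : Type*} [MeasurableSpace Ω] {D : CycleData d K Ω} {μ : Measure Ω}
  {c C ε : ℝ} {N : ℕ} {ω : Ω} {P : Measure (ℕ → Zd d)}

lemma measure_prefix_and_eval_eq (h : D.Admissible μ c C ε N)
    (hP : ∀ (m : ℕ) (xs : ℕ → Zd d), P {σ | ∀ i ≤ m, σ i = xs i}
      = if xs 0 = 0 then ∏ i ∈ Finset.range m,
          ENNReal.ofReal (D.p (xs (i + 1) - xs i) (D.T (xs i) ω)) else 0)
    (j m : ℕ) (xs : ℕ → Zd d) (y : Zd d) :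
    P {σ | (∀ i ≤ m, σ i = xs i) ∧ σ (m + j) = y}
      = P {σ | ∀ i ≤ m, σ i = xs i} * ENNReal.ofReal (D.trans ω j (xs m) y) := by
  induction j generalizing m xs with
  | zero =>
    by_cases hy : xs m = y
    · have h1 : {σ : ℕ → Zd d | (∀ i ≤ m, σ i = xs i) ∧ σ (m + 0) = y}
          = {σ | ∀ i ≤ m, σ i = xs i} := by
        ext σ
        simp only [Set.mem_ofPred_eq, add_zero, and_iff_left_iff_imp]
        exact fun hσ => (hσ m le_rfl).trans hy
      rw [h1]
      simp [trans, hy]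
    · have h1 : {σ : ℕ → Zd d | (∀ i ≤ m, σ i = xs i) ∧ σ (m + 0) = y} = ∅ := by
        ext σ
        simp only [Set.mem_ofPred_eq, add_zero, Set.mem_empty_iff_false, iff_false, not_and]
        exact fun hσ hy' => hy ((hσ m le_rfl).symm.trans hy')
      rw [h1]
      simp [trans, hy]
  | succ j ih =>
    have hunion : {σ : ℕ → Zd d | (∀ i ≤ m, σ i = xs i) ∧ σ (m + (j + 1)) = y}
        = ⋃ w, {σ | (∀ i ≤ m + 1, σ i = Function.update xs (m + 1) w i) ∧
          σ (m + 1 + j) = y} := by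
      ext σ
      simp only [Set.mem_ofPred_eq, Set.mem_iUnion]
      have hidx : m + (j + 1) = m + 1 + j := by ring
      rw [hidx]
      constructor
      · rintro ⟨h1, h2⟩
        refine ⟨σ (m + 1), fun i hi => ?_, h2⟩
        rcases Nat.le_succ_iff.1 hi with hi' | rfl
        · rw [Function.update_of_ne (by omega), h1 i hi']
        · rw [Function.update_self]
      · rintro ⟨w, h1, h2⟩
        refine ⟨fun i hi => ?_, h2⟩
        rw [h1 i (by omega), Function.update_of_ne (by omega)]
    have hdisj : Pairwise (Function.onFun Disjoint fun w => {σ : ℕ → Zd d |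
        (∀ i ≤ m + 1, σ i = Function.update xs (m + 1) w i) ∧ σ (m + 1 + j) = y}) := by
      intro w w' hww
      refine Set.disjoint_left.2 fun σ h1 h2 => hww ?_
      have e1 := h1.1 (m + 1) le_rfl
      have e2 := h2.1 (m + 1) le_rfl
      rw [Function.update_self] at e1 e2
      exact e1.symm.trans e2
    have hmeas : ∀ w, MeasurableSet {σ : ℕ → Zd d |
        (∀ i ≤ m + 1, σ i = Function.update xs (m + 1) w i) ∧ σ (m + 1 + j) = y} := fun w => by
      have : {σ : ℕ → Zd d | ∀ i ≤ m + 1, σ i = Function.update xs (m + 1) w i}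
          = ⋂ i, ⋂ (_ : i ≤ m + 1), {σ | σ i = Function.update xs (m + 1) w i} := by
        ext σ
        simp
      have hpm : MeasurableSet
          {σ : ℕ → Zd d | ∀ i ≤ m + 1, σ i = Function.update xs (m + 1) w i} :=
        this ▸ MeasurableSet.iInter fun i => MeasurableSet.iInter fun _ =>
          measurableSet_eval_eq i _
      exact hpm.inter (measurableSet_eval_eq (m + 1 + j) y)
    have hpre : ∀ w, P {σ | ∀ i ≤ m + 1, σ i = Function.update xs (m + 1) w i}
        = P {σ | ∀ i ≤ m, σ i = xs i} * ENNReal.ofReal (D.p (w - xs m) (D.T (xs m) ω)) := by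
      intro w
      rw [hP, hP, Function.update_of_ne (by omega), Finset.prod_range_succ]
      split_ifs
      · congr 1
        · refine Finset.prod_congr rfl fun i hi => ?_
          have hi' := Finset.mem_range.1 hi
          rw [Function.update_of_ne (by omega), Function.update_of_ne (by omega)]
        · rw [Function.update_self, Function.update_of_ne (by omega)]
      · rw [zero_mul]
    rw [hunion, measure_iUnion hdisj hmeas]
    simp_rw [ih, hpre, Function.update_self, mul_assoc]
    rw [ENNReal.tsum_mul_left]
    congr 1
    have hstep : D.trans ω (j + 1) (xs m) y
        = ∑ v ∈ D.jumps, D.p v (D.T (xs m) ω) * D.trans ω j (xs m + v) y := by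
      simp only [trans]
      rw [Function.iterate_succ_apply']
      rfl
    rw [hstep, ENNReal.ofReal_sum_of_nonneg fun v _ =>
      mul_nonneg (h.p_nonneg _ _) (h.trans_nonneg _ _ _ _),
      ← (Equiv.addLeft (xs m)).tsum_eq, tsum_eq_sum (s := D.jumps)]
    · refine Finset.sum_congr rfl fun v _ => ?_
      rw [ENNReal.ofReal_mul (h.p_nonneg _ _)]
      simp
    · intro v hv
      simp [h.p_eq_zero hv]

lemma measure_eval_eq [IsProbabilityMeasure P] (h : D.Admissible μ c C ε N)
    (hP : ∀ (m : ℕ) (xs : ℕ → Zd d), P {σ | ∀ i ≤ m, σ i = xs i}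
      = if xs 0 = 0 then ∏ i ∈ Finset.range m,
          ENNReal.ofReal (D.p (xs (i + 1) - xs i) (D.T (xs i) ω)) else 0) (m : ℕ) (y : Zd d) :
    P {σ | σ m = y} = ENNReal.ofReal (D.trans ω m 0 y) := by
  have h1 := h.measure_prefix_and_eval_eq hP m 0 (fun _ => 0) y
  have h0 := hP 0 fun _ => 0
  simp only [nonpos_iff_eq_zero, forall_eq, if_true, Finset.range_zero, Finset.prod_empty,
    zero_add] at h1 h0
  rw [h0, one_mul] at h1
  rw [← h1]
  have hae : ∀ᵐ σ ∂P, σ 0 = 0 := (mem_ae_iff_prob_eq_one (measurableSet_eval_eq 0 0)).2 h0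
  refine measure_congr ?_
  filter_upwards [hae] with σ hσ
  exact propext ⟨fun h => ⟨hσ, h⟩, fun h => h.2⟩

lemma integral_comp_eval [IsProbabilityMeasure P] (h : D.Admissible μ c C ε N)
    (hP : ∀ (m : ℕ) (xs : ℕ → Zd d), P {σ | ∀ i ≤ m, σ i = xs i}
      = if xs 0 = 0 then ∏ i ∈ Finset.range m,
          ENNReal.ofReal (D.p (xs (i + 1) - xs i) (D.T (xs i) ω)) else 0)
    {E : Type*} [NormedAddCommGroup E] [NormedSpace ℝ E] [CompleteSpace E]
    (G : Zd d → E) (m : ℕ) :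
    ∫ σ, G (σ m) ∂P = (D.step ω)^[m] G 0 := by
  have hmem : ∀ᵐ σ ∂P, σ m ∈ D.reach m := by
    have h1 : ∀ᵐ σ ∂P, ∀ y, y ∉ D.reach m → σ m ≠ y := by
      refine ae_all_iff.2 fun y => ?_
      by_cases hy : y ∈ D.reach m
      · exact Filter.Eventually.of_forall fun σ h => absurd hy h
      · have h2 : P {σ | σ m = y} = 0 := by
          rw [h.measure_eval_eq hP, D.trans_eq_zero ω (by simpa using hy), ENNReal.ofReal_zero]
        filter_upwards [measure_eq_zero_iff_ae_notMem.1 h2] with σ hσ _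
        exact hσ
    filter_upwards [h1] with σ hσ
    by_contra hn
    exact hσ _ hn rfl
  have hae : (fun σ => G (σ m)) =ᵐ[P]
      fun σ => ∑ r ∈ D.reach m, {σ : ℕ → Zd d | σ m = r}.indicator (fun _ => G r) σ := by
    filter_upwards [hmem] with σ hσ
    rw [Finset.sum_eq_single (σ m)]
    · rw [Set.indicator_of_mem (show σ ∈ {σ' : ℕ → Zd d | σ' m = σ m} from rfl)]
    · exact fun r _ hr => Set.indicator_of_notMem (fun h' => hr h'.symm) _
    · exact fun hn => absurd hσ hn
  rw [integral_congr_ae hae, integral_finsetSum _ fun r _ =>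
    (integrable_const (G r)).indicator (measurableSet_eval_eq m r), iterate_step_eq_sum_image]
  refine Finset.sum_congr rfl fun r _ => ?_
  rw [integral_indicator_const _ (measurableSet_eval_eq m r), measureReal_def, h.measure_eval_eq hP,
    ENNReal.toReal_ofReal (h.trans_nonneg _ _ _ _)]

end Admissible

end CycleData

lemma dotProduct_mulVec_eq_sum {d : ℕ} (A : Matrix (Fin d) (Fin d) ℝ) (a : Fin d → ℝ) :
    a ⬝ᵥ A.mulVec a = ∑ i, ∑ j, a i * a j * A i j := by
  simp only [dotProduct, Matrix.mulVec, Finset.mul_sum]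
  exact Finset.sum_congr rfl fun i _ => Finset.sum_congr rfl fun j _ => by ring

lemma sum_mul_mul_nonneg_of_posSemidef {d : ℕ} {A : Matrix (Fin d) (Fin d) ℝ} (hA : A.PosSemidef)
    (a : Fin d → ℝ) : 0 ≤ ∑ i, ∑ j, a i * a j * A i j := by
  rw [← dotProduct_mulVec_eq_sum]
  simpa using hA.dotProduct_mulVec_nonneg a

/-- Linear images of a centred multivariate Gaussian are one-dimensional Gaussians. -/
lemma map_multivariateGaussian_linearMap {d : ℕ} {A : Matrix (Fin d) (Fin d) ℝ}
    (hA : A.PosSemidef) (L : (Fin d → ℝ) →ₗ[ℝ] ℝ) :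
    Measure.map L (Measure.map (WithLp.ofLp (p := 2))
      (ProbabilityTheory.multivariateGaussian (0 : EuclideanSpace ℝ (Fin d)) A))
      = ProbabilityTheory.gaussianReal 0
          (Real.toNNReal (∑ i, ∑ j, A i j * L (Pi.single i 1) * L (Pi.single j 1))) := by
  have hL : Continuous L := L.continuous_of_finiteDimensional
  have hof : Continuous (WithLp.ofLp (p := 2) (V := Fin d → ℝ)) := PiLp.continuous_ofLp 2 _
  rw [Measure.map_map hL.measurable hof.measurable]
  have hLof : Continuous (L ∘ WithLp.ofLp (p := 2)) := hL.comp hof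
  have : IsProbabilityMeasure (Measure.map (L ∘ WithLp.ofLp (p := 2))
      (ProbabilityTheory.multivariateGaussian (0 : EuclideanSpace ℝ (Fin d)) A)) :=
    Measure.isProbabilityMeasure_map hLof.measurable.aemeasurable
  have hsum : ∑ i, ∑ j, A i j * L (Pi.single i 1) * L (Pi.single j 1)
      = ∑ i, ∑ j, L (Pi.single i 1) * L (Pi.single j 1) * A i j :=
    Finset.sum_congr rfl fun i _ => Finset.sum_congr rfl fun j _ => by ring
  refine Measure.ext_of_charFun (funext fun t => ?_)
  rw [charFun_apply, integral_map hLof.measurable.aemeasurable (by fun_prop),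
    ProbabilityTheory.charFun_gaussianReal]
  have h1 := ProbabilityTheory.charFun_multivariateGaussian (μ := 0) hA
    (WithLp.toLp 2 fun i => t * L (Pi.single i 1))
  rw [charFun_apply] at h1
  have h2 : ∀ x : EuclideanSpace ℝ (Fin d), inner ℝ ((L ∘ WithLp.ofLp (p := 2)) x) t
      = inner ℝ x (WithLp.toLp 2 fun i => t * L (Pi.single i 1)) := fun x => by
    have hLx : L x.ofLp = ∑ i, x.ofLp i * L (Pi.single i 1) := by
      conv_lhs => rw [pi_eq_sum_univ' x.ofLp]
      rw [map_sum]
      refine Finset.sum_congr rfl fun i _ => ?_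
      rw [map_smul, smul_eq_mul]
    rw [PiLp.inner_apply, Function.comp_apply, hLx]
    simp only [RCLike.inner_apply, conj_trivial]
    rw [Finset.mul_sum]
    exact Finset.sum_congr rfl fun i _ => by ring
  simp_rw [h2]
  rw [h1, hsum, Real.coe_toNNReal _ (sum_mul_mul_nonneg_of_posSemidef hA _)]
  congr 1
  have h3 : ∑ i, ∑ j, t * L (Pi.single i 1) * (t * L (Pi.single j 1)) * A i j
      = (∑ i, ∑ j, L (Pi.single i 1) * L (Pi.single j 1) * A i j) * t ^ 2 := by
    simp_rw [Finset.sum_mul]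
    exact Finset.sum_congr rfl fun i _ => Finset.sum_congr rfl fun j _ => by ring
  rw [dotProduct_mulVec_eq_sum, h3]
  simp

/-- Lévy continuity for random vectors with a centred Gaussian limit. -/
lemma tendsto_integral_of_tendsto_charFun {d : ℕ} {A : Matrix (Fin d) (Fin d) ℝ}
    (hA : A.PosSemidef) {S : Type*} [MeasurableSpace S] {P : Measure S} [IsProbabilityMeasure P]
    {Y : ℕ → S → Fin d → ℝ} (hY : ∀ m, Measurable (Y m))
    (hlim : ∀ a : Fin d → ℝ, Filter.Tendsto
      (fun m => ∫ s, Complex.exp ((∑ i, a i * Y m s i : ℝ) * Complex.I) ∂P) Filter.atTop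
      (nhds (Real.exp (-(∑ i, ∑ j, a i * a j * A i j) / 2) : ℝ)))
    (g : BoundedContinuousFunction (Fin d → ℝ) ℝ) :
    Filter.Tendsto (fun m => ∫ s, g (Y m s) ∂P) Filter.atTop
      (nhds (∫ v, g v ∂(Measure.map (WithLp.ofLp (p := 2))
        (ProbabilityTheory.multivariateGaussian (0 : EuclideanSpace ℝ (Fin d)) A)))) := by
  have hof : Continuous (WithLp.ofLp (p := 2) (V := Fin d → ℝ)) := PiLp.continuous_ofLp 2 _
  have hto : Continuous (WithLp.toLp 2 (V := Fin d → ℝ)) := PiLp.continuous_toLp 2 _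
  have hYm : ∀ m, AEMeasurable (fun s => WithLp.toLp 2 (Y m s)) P := fun m =>
    (hto.measurable.comp (hY m)).aemeasurable
  let ν : ℕ → ProbabilityMeasure (EuclideanSpace ℝ (Fin d)) := fun m =>
    ⟨P.map fun s => WithLp.toLp 2 (Y m s), Measure.isProbabilityMeasure_map (hYm m)⟩
  let γ : ProbabilityMeasure (EuclideanSpace ℝ (Fin d)) :=
    ⟨ProbabilityTheory.multivariateGaussian 0 A, inferInstance⟩
  have hconv : Filter.Tendsto ν Filter.atTop (nhds γ) := by
    refine ProbabilityMeasure.tendsto_of_tendsto_charFun fun t => ?_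
    have h1 : charFun (γ : Measure (EuclideanSpace ℝ (Fin d))) t
        = (Real.exp (-(∑ i, ∑ j, t.ofLp i * t.ofLp j * A i j) / 2) : ℝ) := by
      change charFun (ProbabilityTheory.multivariateGaussian 0 A) t = _
      rw [ProbabilityTheory.charFun_multivariateGaussian hA, dotProduct_mulVec_eq_sum,
        Complex.ofReal_exp, inner_zero_right]
      congr 1
      push_cast
      ring
    rw [h1]
    refine (hlim t.ofLp).congr fun m => ?_
    change _ = charFun (P.map fun s => WithLp.toLp 2 (Y m s)) t
    rw [charFun_apply, integral_map (hYm m) (by fun_prop)]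
    refine integral_congr_ae (Filter.Eventually.of_forall fun s => ?_)
    simp only [PiLp.inner_apply, RCLike.inner_apply, conj_trivial]
  have h2 := ProbabilityMeasure.tendsto_iff_forall_integral_tendsto.1 hconv
    (g.compContinuous ⟨_, hof⟩)
  rw [integral_map hof.measurable.aemeasurable g.continuous.aestronglyMeasurable]
  refine h2.congr fun m => ?_
  change ∫ x, g x.ofLp ∂(P.map fun s => WithLp.toLp 2 (Y m s)) = _
  exact integral_map (hYm m) (g.continuous.comp hof).aestronglyMeasurable

theorem quenched_central_limit_theorem
    (d K : ℕ) (hd : 0 < d) (hK : 0 < K) (Ω : Type*) [MeasurableSpace Ω]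
    (μ : Measure Ω) [IsProbabilityMeasure μ]
    (n : Fin K → ℕ) (z : Fin K → ℕ → Zd d)
    (T : Zd d → Ω → Ω) (W : Fin K → Ω → ℝ) (c C : ℝ)
    (hlen : ∀ i, 0 < n i)
    (hcyc : ∀ i, z i (n i) = z i 0)
    (hinj : ∀ i, ∀ j k, j < n i → k < n i → z i j = z i k → j = k)
    (hT : ∀ x y : Zd d, T (x + y) = T x ∘ T y) (hT0 : T 0 = id)
    (hW : ∀ i ω, 0 ≤ W i ω) (hWmeas : ∀ i, Measurable (W i))
    (hc : 0 < c) (hCfin : c ≤ C)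
    (hM : ∀ ω, c ≤ Mfun n z T W ω ∧ Mfun n z T W ω ≤ C)
    -- (a) ℙ is invariant and ergodic w.r.t. each coordinate shift `T_{e_i}`
    (hTpres : ∀ x : Zd d, MeasurePreserving (T x) μ μ)
    (herg : ∀ i : Fin d, Ergodic (T (Pi.single i 1)) μ)
    -- (c) uniform strong irreducibility
    (ε : ℝ) (N : ℕ) (hε : 0 < ε)
    (hirr : ∀ (x : Zd d) (ω : Ω) (e : Zd d), eucNorm e = 1 →
      ∃ m ≤ N, ε ≤ kerpow (Qker n z T W ω) m x (x + e))
    -- the quenched law `P_{0,ω}` of the walk started at `0`, characterized on cylinder sets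
    (P : Ω → Measure (ℕ → Zd d)) (hPprob : ∀ ω, IsProbabilityMeasure (P ω))
    (hP : ∀ (ω : Ω) (m : ℕ) (xs : ℕ → Zd d),
      P ω {σ | ∀ i ≤ m, σ i = xs i}
        = if xs 0 = 0 then
            ∏ i ∈ Finset.range m, ENNReal.ofReal (Qker n z T W ω (xs i) (xs (i + 1)))
          else 0) :
    ∃ A : Matrix (Fin d) (Fin d) ℝ, A.IsSymm ∧ A.PosDef ∧
      ∃ γ : Measure (Fin d → ℝ), IsProbabilityMeasure γ ∧
        -- `γ` is the centered Gaussian distribution with covariance matrix `A`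
        (∀ L : (Fin d → ℝ) →ₗ[ℝ] ℝ, Measure.map L γ
            = ProbabilityTheory.gaussianReal 0
                (Real.toNNReal (∑ i, ∑ j, A i j * L (Pi.single i 1) * L (Pi.single j 1)))) ∧
        -- for ℙ-a.e. ω, the laws of `X_N / √N` under `P_{0,ω}` converge weakly to `γ`
        ∀ᵐ ω ∂μ, ∀ g : BoundedContinuousFunction (Fin d → ℝ) ℝ,
          Filter.Tendsto
            (fun m : ℕ => ∫ σ, g (fun k => ((σ m) k : ℝ) / Real.sqrt m) ∂(P ω))
            Filter.atTop (nhds (∫ v, g v ∂γ)) := by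
  have hstart : ∀ i : Fin d, eucNorm (Pi.single i 1 : Zd d) = 1 := fun i => by
    unfold eucNorm
    rw [Finset.sum_eq_single i (fun j _ hj => by simp [Pi.single_eq_of_ne hj])
      (fun hi => absurd (Finset.mem_univ i) hi)]
    simp
  let D : CycleData d K Ω := ⟨n, z, T, W⟩
  have h : D.Admissible μ c C ε N :=
    { len_pos := hlen
      closed := hcyc
      inj := hinj
      T_add := fun x y ω => congrFun (hT x y) ω
      T_zero := fun ω => congrFun hT0 ω
      W_nonneg := hW
      W_meas := hWmeas
      c_pos := hc
      M_lower := fun ω => (hM ω).1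
      M_upper := fun ω => (hM ω).2
      pres := hTpres
      ε_pos := hε
      irr := fun ω i => by
        obtain ⟨m, hm, hm'⟩ := hirr 0 ω (Pi.single i 1) (hstart i)
        rw [zero_add] at hm'
        exact ⟨m, hm, hm'⟩ }
  choose χ u hχ using fun i => h.exists_isCorrector i
  have hA : (D.covMat μ χ).PosDef := h.posDef_covMat hχ
  refine ⟨D.covMat μ χ, CycleData.isSymm_covMat χ, hA, Measure.map (WithLp.ofLp (p := 2))
    (ProbabilityTheory.multivariateGaussian 0 (D.covMat μ χ)),
    Measure.isProbabilityMeasure_map (PiLp.continuous_ofLp 2 _).measurable.aemeasurable,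
    map_multivariateGaussian_linearMap hA.posSemidef, ?_⟩
  filter_upwards [h.ae_tendsto_iterate_step_exp hχ (herg ⟨0, hd⟩)] with ω hω g
  have := hPprob ω
  have hPω : ∀ (m : ℕ) (xs : ℕ → Zd d), P ω {σ | ∀ i ≤ m, σ i = xs i}
      = if xs 0 = 0 then ∏ i ∈ Finset.range m,
          ENNReal.ofReal (D.p (xs (i + 1) - xs i) (D.T (xs i) ω)) else 0 := hP ω
  refine tendsto_integral_of_tendsto_charFun hA.posSemidef
    (Y := fun m (σ : ℕ → Zd d) k => ((σ m) k : ℝ) / Real.sqrt m) (fun m => ?_) (fun a => ?_) g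
  · have hm : Measurable fun x : Zd d => fun k => (x k : ℝ) / Real.sqrt m :=
      measurable_of_countable _
    exact hm.comp (measurable_pi_apply m)
  · refine (hω a (sum_mul_mul_nonneg_of_posSemidef hA.posSemidef a)).congr fun m => ?_
    rw [← h.integral_comp_eval hPω]
    refine integral_congr_ae (Filter.Eventually.of_forall fun σ => ?_)
    simp only [Finset.sum_div, mul_div_assoc]

end
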